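/- Let λ, α_u, α_v, ρ_u, ρ_v > 0 and suppose n_u/n → α_u and n_v/n → α_v as n → ∞. Let U be uniform on the sphere of radius √(ρ_u n_u) in ℝ^{n_u}, V uniform on the sphere of radius √(ρ_v n_v) in ℝ^{n_v}, Z ∈ ℝ^{n_u×n_v} with i.i.d. standard Gaussian entries, all independent, and Y_{ij} = √(λ/n) U_i V_j + Z_{ij}. Define the average free entropy fₙ = (1/n) E ln ∫ exp( Σ_{i,j} [ √(λ/n) u_i v_j Y_{ij} − (λ/(2n)) u_i² v_j² ] ) dP_u(u) dP_v(v), where P_u, P_v are the uniform probability measures on the respective spheres. Then lim_{n→∞} fₙ = (λ α_u α_v ρ_u ρ_v)/2 − inf_{m_u∈[0,ρ_u]} sup_{m_v∈[0,ρ_v]} i(m_u,m_v), where i(m_u,m_v) = (λ α_u α_v/2)(ρ_u−m_u)(ρ_v−m_v) + (α_u/2) ln(1+λ α_v ρ_u m_v) + (α_v/2) ln(1+λ α_u ρ_v m_u). Equivalently, the average mutual information satisfies lim_{n→∞} I(U,V;Y)/n = inf_{m_u∈[0,ρ_u]} sup_{m_v∈[0,ρ_v]} i(m_u,m_v). -/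

import Mathlib

open MeasureTheory Real Filter

noncomputable section

/-- i.i.d. standard Gaussian measure on `Fin n → ℝ`. -/
def stdGaussian (n : ℕ) : Measure (Fin n → ℝ) :=
  Measure.pi fun _ : Fin n => ProbabilityTheory.gaussianReal 0 1

/-- i.i.d. standard Gaussian measure on matrices `Fin p → Fin q → ℝ`. -/
def stdGaussianMat (p q : ℕ) : Measure (Fin p → Fin q → ℝ) :=
  Measure.pi fun _ : Fin p => stdGaussian q

/-- `P` is the uniform (rotation-invariant) probability measure on the sphere of
radius `r` centered at the origin in `ℝⁿ`. -/
def IsUniformSphere (n : ℕ) (r : ℝ) (P : Measure (Fin n → ℝ)) : Prop :=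
  IsProbabilityMeasure P ∧
  (∀ᵐ x ∂P, ∑ i, (x i) ^ 2 = r ^ 2) ∧
  ∀ O : Matrix (Fin n) (Fin n) ℝ, O ∈ Matrix.orthogonalGroup (Fin n) ℝ →
    P.map (fun x => O.mulVec x) = P

/-- Average free entropy of the rank-one matrix factorization model
`Y_{ij} = √(λ/n) U_i V_j + Z_{ij}`:
`fₙ = (1/n) E ln ∫∫ exp(Σ_{ij} [√(λ/n) u_i v_j Y_{ij} − (λ/(2n)) u_i² v_j²]) dP_u dP_v`. -/
def matrixFreeEntropy (lam : ℝ) (n nu nv : ℕ)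
    (Pu : Measure (Fin nu → ℝ)) (Pv : Measure (Fin nv → ℝ)) : ℝ :=
  (1 / (n : ℝ)) *
    ∫ U, (∫ V, (∫ Z,
        Real.log (∫ u, (∫ v,
          Real.exp (∑ i, ∑ j,
            (Real.sqrt (lam / n) * u i * v j
                * (Real.sqrt (lam / n) * U i * V j + Z i j)
              - lam / (2 * n) * (u i) ^ 2 * (v j) ^ 2)) ∂Pv) ∂Pu)
      ∂(stdGaussianMat nu nv)) ∂Pv) ∂Pu

/-- The replica-symmetric potential `i(m_u, m_v)`. -/
def rsPotential (lam au av ru rv mu mv : ℝ) : ℝ :=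
  lam * au * av / 2 * (ru - mu) * (rv - mv)
    + au * Real.log (1 + lam * av * ru * mv) / 2
    + av * Real.log (1 + lam * au * rv * mu) / 2

/-- `inf_{m_u ∈ [0,ρ_u]} sup_{m_v ∈ [0,ρ_v]} i(m_u,m_v)`. -/
def rsInfSup (lam au av ru rv : ℝ) : ℝ :=
  sInf ((fun mu => sSup ((fun mv => rsPotential lam au av ru rv mu mv) ''
    Set.Icc 0 rv)) '' Set.Icc 0 ru)

namespace SpikedMatrix
open scoped RealInnerProductSpace

section Gauss

variable {E F G : Type*}
  [NormedAddCommGroup E] [InnerProductSpace ℝ E] [FiniteDimensional ℝ E] [MeasurableSpace E]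
  [BorelSpace E]
  [NormedAddCommGroup F] [InnerProductSpace ℝ F] [FiniteDimensional ℝ F] [MeasurableSpace F]
  [BorelSpace F]
  [NormedAddCommGroup G] [InnerProductSpace ℝ G] [FiniteDimensional ℝ G] [MeasurableSpace G]
  [BorelSpace G]

variable (E) in
/-- The standard Gaussian measure of a Euclidean space. -/
abbrev gauss : Measure E := ProbabilityTheory.stdGaussian E

theorem charFun_map_gauss (A : F →L[ℝ] E) (A' : E → F) (hA : ∀ x t, ⟪A x, t⟫ = ⟪x, A' t⟫) (t : E) :
    charFun ((gauss F).map A) t = Complex.exp (-‖A' t‖ ^ 2 / 2) := by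
  rw [← ProbabilityTheory.charFun_stdGaussian, charFun_apply, charFun_apply,
    integral_map A.continuous.aemeasurable (by fun_prop)]
  simp only [hA]

/-- A sum of two independent linear Gaussian images with total covariance the identity is standard
Gaussian. -/
theorem gauss_prod_map_add (A : F →L[ℝ] E) (B : G →L[ℝ] E) (A' : E → F) (B' : E → G)
    (hA : ∀ x t, ⟪A x, t⟫ = ⟪x, A' t⟫) (hB : ∀ x t, ⟪B x, t⟫ = ⟪x, B' t⟫)
    (h : ∀ t, ‖A' t‖ ^ 2 + ‖B' t‖ ^ 2 = ‖t‖ ^ 2) :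
    ((gauss F).prod (gauss G)).map (fun x => A x.1 + B x.2) = gauss E := by
  have h1 : ((gauss F).prod (gauss G)).map (fun x => A x.1 + B x.2)
      = ((gauss F).map A) ∗ ((gauss G).map B) := by
    rw [Measure.conv, Measure.map_prod_map _ _ A.continuous.measurable B.continuous.measurable,
      Measure.map_map (by fun_prop) (by fun_prop)]
    rfl
  rw [h1]
  have : IsProbabilityMeasure ((gauss F).map A) :=
    Measure.isProbabilityMeasure_map A.continuous.aemeasurable
  have : IsProbabilityMeasure ((gauss G).map B) :=
    Measure.isProbabilityMeasure_map B.continuous.aemeasurable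
  apply Measure.ext_of_charFun
  ext t
  rw [charFun_conv, charFun_map_gauss A A' hA, charFun_map_gauss B B' hB,
    ProbabilityTheory.charFun_stdGaussian, ← Complex.exp_add]
  congr 1
  have := congrArg (fun x : ℝ => (x : ℂ)) (h t)
  push_cast at this
  rw [← this]; ring

/-- Linear combination of two independent standard Gaussian vectors. -/
theorem gauss_prod_map_combo (c d : ℝ) (h : c ^ 2 + d ^ 2 = 1) :
    ((gauss E).prod (gauss E)).map (fun x => c • x.1 + d • x.2) = gauss E := by
  have := gauss_prod_map_add (c • ContinuousLinearMap.id ℝ E) (d • ContinuousLinearMap.id ℝ E)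
    (fun t => c • t) (fun t => d • t)
    (fun x t => by simp [inner_smul_left, inner_smul_right])
    (fun x t => by simp [inner_smul_left, inner_smul_right])
    (fun t => by
      rw [norm_smul, norm_smul, mul_pow, mul_pow, ← add_mul]
      simp [h])
  simpa using this

theorem gauss_map_isometry (f : E ≃ₗᵢ[ℝ] F) : (gauss E).map f = gauss F :=
  ProbabilityTheory.stdGaussian_map f

theorem gauss_real : gauss ℝ = ProbabilityTheory.gaussianReal 0 1 := by
  apply Measure.ext_of_charFun
  ext t
  rw [ProbabilityTheory.charFun_stdGaussian, ProbabilityTheory.charFun_gaussianReal]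
  congr 1
  simp [← Complex.ofReal_pow]; ring
  

/-- Decomposition of a standard Gaussian vector along a unit direction. -/
theorem gauss_prod_map_dir (e : E) (he : ‖e‖ = 1) :
    ((gauss ℝ).prod (gauss E)).map (fun x => x.1 • e + (x.2 - ⟪e, x.2⟫ • e)) = gauss E := by
  have h0 : ⟪e, e⟫ = (1 : ℝ) := by rw [real_inner_self_eq_norm_sq, he]; norm_num
  have := gauss_prod_map_add (F := ℝ) (G := E) (E := E)
    (ContinuousLinearMap.toSpanSingleton ℝ e)
    (ContinuousLinearMap.id ℝ E - (innerSL ℝ e).smulRight e)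
    (fun t => ⟪e, t⟫) (fun t => t - ⟪e, t⟫ • e)
    (fun x t => by simp [inner_smul_left, mul_comm])
    (fun x t => by
      simp [inner_sub_left, inner_sub_right, inner_smul_left, inner_smul_right]
      rw [real_inner_comm e x]; ring)
    (fun t => by
      rw [norm_sub_sq_real, norm_smul, he, inner_smul_right, real_inner_comm e t]
      simp; ring)
  simpa using this

end Gauss

theorem lintegral_gaussianReal_shift (f : ℝ → ENNReal) (hf : Measurable f) (a : ℝ) :
    ∫⁻ x, f (x + a) ∂(ProbabilityTheory.gaussianReal 0 1)
      = ∫⁻ x, ENNReal.ofReal (exp (a * x - a ^ 2 / 2)) * f x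
          ∂(ProbabilityTheory.gaussianReal 0 1) := by
  rw [← lintegral_map (f := f) (g := fun x => x + a) hf (by fun_prop),
    ProbabilityTheory.gaussianReal_map_add_const,
    ProbabilityTheory.gaussianReal_of_var_ne_zero _ one_ne_zero,
    ProbabilityTheory.gaussianReal_of_var_ne_zero _ one_ne_zero,
    lintegral_withDensity_eq_lintegral_mul _ (by fun_prop) hf,
    lintegral_withDensity_eq_lintegral_mul _ (by fun_prop) (by fun_prop)]
  congr 1
  ext x
  simp only [Pi.mul_apply]
  rw [← mul_assoc]
  congr 1
  rw [ProbabilityTheory.gaussianPDF, ProbabilityTheory.gaussianPDF,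
    ← ENNReal.ofReal_mul (ProbabilityTheory.gaussianPDFReal_nonneg _ _ _),
    ProbabilityTheory.gaussianPDFReal, ProbabilityTheory.gaussianPDFReal]
  conv_rhs => rw [mul_assoc, ← exp_add]
  congr 3
  simp; ring

section Gauss

variable {E : Type*}
  [NormedAddCommGroup E] [InnerProductSpace ℝ E] [FiniteDimensional ℝ E] [MeasurableSpace E]
  [BorelSpace E]

/-- Cameron–Martin formula. -/
theorem lintegral_gauss_shift (f : E → ENNReal) (hf : Measurable f) (a : E) :
    ∫⁻ z, f (z + a) ∂(gauss E)
      = ∫⁻ z, ENNReal.ofReal (exp (⟪a, z⟫ - ‖a‖ ^ 2 / 2)) * f z ∂(gauss E) := by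
  by_cases ha : a = 0
  · simp [ha]
  have hn : ‖a‖ ≠ 0 := norm_ne_zero_iff.2 ha
  set e : E := ‖a‖⁻¹ • a with he
  have he1 : ‖e‖ = 1 := by simp [he, norm_smul, hn]
  have hae : a = ‖a‖ • e := by simp [he, smul_smul, hn]
  have h0 : ⟪e, e⟫ = (1 : ℝ) := by rw [real_inner_self_eq_norm_sq, he1]; norm_num
  have hm : Measurable (fun x : ℝ × E => x.1 • e + (x.2 - ⟪e, x.2⟫ • e)) := by fun_prop
  conv_lhs => rw [← gauss_prod_map_dir e he1]
  conv_rhs => rw [← gauss_prod_map_dir e he1]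
  rw [lintegral_map (by fun_prop) hm, lintegral_map (by fun_prop) hm,
    lintegral_prod_symm' _ (by fun_prop), lintegral_prod_symm' _ (by fun_prop)]
  congr 1
  ext w
  rw [gauss_real]
  have := lintegral_gaussianReal_shift (fun x => f (x • e + (w - ⟪e, w⟫ • e))) (by fun_prop) ‖a‖
  convert this using 4 with x x
  · conv_lhs => rw [hae]
    rw [add_smul]; abel_nf
  · have h1 : ⟪a, x • e + (w - ⟪e, w⟫ • e)⟫ = ‖a‖ * x := by
      conv_lhs => rw [hae]
      simp only [inner_smul_left, inner_add_right, inner_sub_right, inner_smul_right, h0,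
        RCLike.conj_to_real]
      ring
    rw [h1]

theorem gauss_map_add_eq_withDensity (a : E) :
    (gauss E).map (fun z => z + a)
      = (gauss E).withDensity (fun z => ENNReal.ofReal (exp (⟪a, z⟫ - ‖a‖ ^ 2 / 2))) := by
  ext s hs
  rw [← lintegral_indicator_one hs, lintegral_map (by measurability) (by fun_prop),
    lintegral_gauss_shift _ (by measurability), withDensity_apply _ hs,
    ← lintegral_indicator hs]
  congr 1
  ext z
  by_cases hz : z ∈ s <;> simp [hz]

theorem integral_gauss_shift (f : E → ℝ) (hf : Measurable f) (a : E) :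
    ∫ z, f (z + a) ∂(gauss E)
      = ∫ z, exp (⟪a, z⟫ - ‖a‖ ^ 2 / 2) * f z ∂(gauss E) := by
  rw [← integral_map (φ := fun z => z + a) (f := f) (by fun_prop) hf.aestronglyMeasurable,
    gauss_map_add_eq_withDensity, integral_withDensity_eq_integral_toReal_smul (by fun_prop)
      (by simp)]
  congr 1
  ext z
  rw [ENNReal.toReal_ofReal (exp_pos _).le, smul_eq_mul]

theorem integrable_exp_mul_norm_gauss (c : ℝ) :
    Integrable (fun z : E => exp (c * ‖z‖)) (gauss E) := by
  obtain ⟨C, hC, hi⟩ := ProbabilityTheory.IsGaussian.exists_integrable_exp_sq (gauss E)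
  refine (hi.const_mul (exp (c ^ 2 / (4 * C)))).mono' (by fun_prop) (ae_of_all _ fun z => ?_)
  rw [norm_of_nonneg (exp_pos _).le, ← exp_add]
  gcongr
  have h := sq_nonneg (‖z‖ - c / (2 * C))
  have h2 : C * (‖z‖ - c / (2 * C)) ^ 2 = C * ‖z‖ ^ 2 - c * ‖z‖ + c ^ 2 / (4 * C) := by
    field_simp; ring
  nlinarith

theorem integrable_norm_pow_mul_exp_gauss (k : ℕ) (c : ℝ) :
    Integrable (fun z : E => ‖z‖ ^ k * exp (c * ‖z‖)) (gauss E) := by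
  refine ((integrable_exp_mul_norm_gauss (E := E) (c + 1)).const_mul (k.factorial : ℝ)).mono'
    (by fun_prop) (ae_of_all _ fun z => ?_)
  rw [norm_of_nonneg (by positivity), add_mul, exp_add, one_mul, mul_comm (exp _), ← mul_assoc]
  gcongr
  have := pow_div_factorial_le_exp ‖z‖ (norm_nonneg _) k
  rwa [div_le_iff₀ (by positivity), mul_comm] at this

theorem integrable_norm_pow_gauss (k : ℕ) : Integrable (fun z : E => ‖z‖ ^ k) (gauss E) := by
  simpa using integrable_norm_pow_mul_exp_gauss (E := E) k 0

theorem integrable_norm_gauss : Integrable (fun z : E => ‖z‖) (gauss E) := by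
  simpa using integrable_norm_pow_gauss (E := E) 1

end Gauss

section Gauss

variable {E : Type*}
  [NormedAddCommGroup E] [InnerProductSpace ℝ E] [FiniteDimensional ℝ E] [MeasurableSpace E]
  [BorelSpace E]

/-- Gaussian integration by parts in the direction `a`. -/
theorem integral_inner_mul_gauss (a : E) (H H' : E → ℝ) (hH : Continuous H) (hH' : Continuous H')
    (C C' : ℝ) (hC : ∀ z, |H z| ≤ C) (hC' : ∀ z, |H' z| ≤ C')
    (hd : ∀ z, HasDerivAt (fun t : ℝ => H (z + t • a)) (H' z) 0) :
    ∫ z, ⟪a, z⟫ * H z ∂(gauss E) = ∫ z, H' z ∂(gauss E) := by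
  have hd' : ∀ z : E, ∀ t : ℝ, HasDerivAt (fun t : ℝ => H (z + t • a)) (H' (z + t • a)) t := by
    intro z t
    have h := hd (z + t • a)
    have h2 := HasDerivAt.comp_sub_const t t (by simpa using h)
    refine h2.congr_of_eventuallyEq (Eventually.of_forall fun x => ?_)
    simp only [add_assoc, ← add_smul]
    congr 3; ring
  have h1 : HasDerivAt (fun t : ℝ => ∫ z, H (z + t • a) ∂(gauss E))
      (∫ z, H' (z + (0 : ℝ) • a) ∂(gauss E)) 0 := by
    refine (hasDerivAt_integral_of_dominated_loc_of_deriv_le (s := Set.univ)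
      (F' := fun t z => H' (z + t • a)) (bound := fun _ => C') univ_mem ?_ ?_ ?_ ?_ (integrable_const (μ := gauss E) C') ?_).2
    · exact Eventually.of_forall fun t => (by fun_prop : Continuous _).aestronglyMeasurable
    · refine (integrable_const C).mono' (by fun_prop : Continuous _).aestronglyMeasurable
        (ae_of_all _ fun z => hC _)
    · exact (by fun_prop : Continuous _).aestronglyMeasurable
    · exact ae_of_all _ fun z t _ => hC' _
    · exact ae_of_all _ fun z t _ => hd' z t
  have h2 : HasDerivAt (fun t : ℝ => ∫ z, exp (t * ⟪a, z⟫ - t ^ 2 * ‖a‖ ^ 2 / 2) * H z ∂(gauss E))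
      (∫ z, (exp ((0 : ℝ) * ⟪a, z⟫ - (0 : ℝ) ^ 2 * ‖a‖ ^ 2 / 2)
        * (⟪a, z⟫ - 2 * 0 * ‖a‖ ^ 2 / 2)) * H z ∂(gauss E)) 0 := by
    have hC0 : 0 ≤ C := (abs_nonneg _).trans (hC 0)
    refine (hasDerivAt_integral_of_dominated_loc_of_deriv_le (s := Metric.ball 0 1)
      (F' := fun t z => (exp (t * ⟪a, z⟫ - t ^ 2 * ‖a‖ ^ 2 / 2)
        * (⟪a, z⟫ - 2 * t * ‖a‖ ^ 2 / 2)) * H z)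
      (bound := fun z => exp (‖a‖ * ‖z‖) * (‖a‖ * ‖z‖ + ‖a‖ ^ 2) * C)
      (Metric.ball_mem_nhds _ one_pos) ?_ ?_ ?_ ?_ ?_ ?_).2
    · exact Eventually.of_forall fun t => (by fun_prop : Continuous _).aestronglyMeasurable
    · refine (integrable_const C).mono' (by fun_prop : Continuous _).aestronglyMeasurable
        (ae_of_all _ fun z => ?_)
      simpa using hC z
    · exact (by fun_prop : Continuous _).aestronglyMeasurable
    · refine ae_of_all _ fun z t ht => ?_
      have ht : |t| < 1 := by simpa using ht
      have hi := abs_real_inner_le_norm a z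
      rw [norm_mul, norm_mul, norm_of_nonneg (exp_pos _).le, norm_eq_abs, norm_eq_abs]
      have hti : t * ⟪a, z⟫ ≤ ‖a‖ * ‖z‖ := by
        calc t * ⟪a, z⟫ ≤ |t * ⟪a, z⟫| := le_abs_self _
          _ = |t| * |⟪a, z⟫| := abs_mul _ _
          _ ≤ 1 * (‖a‖ * ‖z‖) := by gcongr
          _ = _ := one_mul _
      have h3 : |⟪a, z⟫ - 2 * t * ‖a‖ ^ 2 / 2| ≤ ‖a‖ * ‖z‖ + ‖a‖ ^ 2 := by
        calc |⟪a, z⟫ - 2 * t * ‖a‖ ^ 2 / 2| ≤ |⟪a, z⟫| + |2 * t * ‖a‖ ^ 2 / 2| := abs_sub _ _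
          _ = |⟪a, z⟫| + |t| * ‖a‖ ^ 2 := by
            rw [show 2 * t * ‖a‖ ^ 2 / 2 = t * ‖a‖ ^ 2 by ring, abs_mul, abs_of_nonneg (sq_nonneg ‖a‖)]
          _ ≤ ‖a‖ * ‖z‖ + 1 * ‖a‖ ^ 2 := by gcongr
          _ = _ := by ring
      gcongr
      · nlinarith [mul_nonneg (sq_nonneg t) (sq_nonneg ‖a‖)]
      · exact hC z
    · have i0 := integrable_norm_pow_mul_exp_gauss (E := E) 0 ‖a‖
      have i1 := integrable_norm_pow_mul_exp_gauss (E := E) 1 ‖a‖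
      refine (((i1.const_mul ‖a‖).add (i0.const_mul (‖a‖ ^ 2))).mul_const C).congr
        (ae_of_all _ fun z => ?_)
      simp only [Pi.add_apply]; ring
    · refine ae_of_all _ fun z t _ => ?_
      have e : HasDerivAt (fun t : ℝ => t * ⟪a, z⟫ - t ^ 2 * ‖a‖ ^ 2 / 2)
          (⟪a, z⟫ - 2 * t * ‖a‖ ^ 2 / 2) t := by
        have := (hasDerivAt_mul_const (x := t) ⟪a, z⟫).fun_sub
          (((hasDerivAt_pow 2 t).mul_const (‖a‖ ^ 2)).div_const 2)
        simpa using this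
      exact e.exp.mul_const _
  have h3 : (fun t : ℝ => ∫ z, H (z + t • a) ∂(gauss E))
      = fun t : ℝ => ∫ z, exp (t * ⟪a, z⟫ - t ^ 2 * ‖a‖ ^ 2 / 2) * H z ∂(gauss E) := by
    ext t
    rw [integral_gauss_shift H hH.measurable (t • a)]
    simp only [norm_smul, inner_smul_left, mul_pow, norm_eq_abs, sq_abs, RCLike.conj_to_real]
  rw [← h3] at h2
  have := h2.unique h1
  simpa using this

end Gauss

theorem integrable_pow_gaussianReal_std (k : ℕ) :
    Integrable (fun x : ℝ => x ^ k) (ProbabilityTheory.gaussianReal 0 1) := by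
  have := integrable_norm_pow_gauss (E := ℝ) k
  rw [gauss_real] at this
  refine this.mono' (by fun_prop) (ae_of_all _ fun x => by simp)

theorem integral_id_gaussianReal_std : ∫ x, x ∂(ProbabilityTheory.gaussianReal 0 1) = 0 := by
  simp

theorem integral_sq_gaussianReal_std : ∫ x, x ^ 2 ∂(ProbabilityTheory.gaussianReal 0 1) = 1 := by
  have h := ProbabilityTheory.variance_id_gaussianReal (μ := 0) (v := 1)
  rw [ProbabilityTheory.variance_eq_integral (by fun_prop)] at h
  simpa using h

section Eucl
variable {ι : Type*} [Fintype ι]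

theorem integral_gauss_eq_pi (f : EuclideanSpace ℝ ι → ℝ) :
    ∫ z, f z ∂(gauss (EuclideanSpace ℝ ι))
      = ∫ x, f (WithLp.toLp 2 x) ∂(Measure.pi fun _ : ι => ProbabilityTheory.gaussianReal 0 1) := by
  rw [gauss, ← ProbabilityTheory.map_pi_eq_stdGaussian]
  exact integral_map_equiv (MeasurableEquiv.toLp 2 (ι → ℝ)) f

theorem integral_norm_add_sq_gauss (a : EuclideanSpace ℝ ι) :
    ∫ z, ‖z + a‖ ^ 2 ∂(gauss (EuclideanSpace ℝ ι)) = ‖a‖ ^ 2 + Fintype.card ι := by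
  have hint : ∀ i, Integrable (fun x : ι → ℝ => (x i + a i) ^ 2)
      (Measure.pi fun _ : ι => ProbabilityTheory.gaussianReal 0 1) := by
    intro i
    refine integrable_comp_eval (μ := fun _ : ι => ProbabilityTheory.gaussianReal 0 1)
      (f := fun y : ℝ => (y + a i) ^ 2) ?_
    have h := ((integrable_pow_gaussianReal_std 2).add
      ((integrable_pow_gaussianReal_std 1).const_mul (2 * a i))).add (integrable_const (a i ^ 2))
    refine h.congr (ae_of_all _ fun y => ?_)
    simp only [Pi.add_apply]; ring
  rw [integral_gauss_eq_pi]
  simp only [EuclideanSpace.norm_sq_eq, norm_eq_abs, sq_abs, PiLp.add_apply]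
  rw [integral_finsetSum _ fun i _ => hint i]
  have : ∀ i, ∫ x : ι → ℝ, (x i + a i) ^ 2
      ∂(Measure.pi fun _ : ι => ProbabilityTheory.gaussianReal 0 1) = a i ^ 2 + 1 := by
    intro i
    rw [integral_comp_eval (μ := fun _ : ι => ProbabilityTheory.gaussianReal 0 1)
      (f := fun y : ℝ => (y + a i) ^ 2) (by fun_prop)]
    have e : ∀ y : ℝ, (y + a i) ^ 2 = (y ^ 2 + (2 * a i) * y) + a i ^ 2 := fun y => by ring
    simp only [e]
    have i1 := integrable_pow_gaussianReal_std 1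
    simp only [pow_one] at i1
    have i2 := (integrable_pow_gaussianReal_std 2).fun_add (i1.const_mul (2 * a i))
    rw [integral_add i2
      (integrable_const _), integral_add (integrable_pow_gaussianReal_std 2) (i1.const_mul (2 * a i)),
      integral_const_mul, integral_sq_gaussianReal_std, integral_id_gaussianReal_std]
    simp; ring
  simp [this, Finset.sum_add_distrib]

theorem integrable_shift_sq_sub_sq (b : ℝ) :
    Integrable (fun y : ℝ => ((y + b) ^ 2 - (b ^ 2 + 1)) ^ 2)
      (ProbabilityTheory.gaussianReal 0 1) := by
  have h := ((((integrable_pow_gaussianReal_std 4).add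
    ((integrable_pow_gaussianReal_std 3).const_mul (4 * b))).add
    ((integrable_pow_gaussianReal_std 2).const_mul (4 * b ^ 2 - 2))).add
    ((integrable_pow_gaussianReal_std 1).const_mul (-4 * b))).add (integrable_const 1)
  refine h.congr (ae_of_all _ fun y => ?_)
  simp only [Pi.add_apply]; ring

/-- The variance of the squared norm of a shifted standard Gaussian vector is at most linear in
its mean. -/
theorem exists_integral_norm_sq_sub_sq_le : ∃ C : ℝ, 0 ≤ C ∧
    ∀ (ι : Type*) [Fintype ι] (a : EuclideanSpace ℝ ι),
    ∫ z, (‖z + a‖ ^ 2 - (‖a‖ ^ 2 + Fintype.card ι)) ^ 2 ∂(gauss (EuclideanSpace ℝ ι))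
      ≤ C * (‖a‖ ^ 2 + Fintype.card ι) := by
  set M : ℝ := ∫ y : ℝ, (y ^ 2 - 1) ^ 2 ∂(ProbabilityTheory.gaussianReal 0 1) with hM
  have hM0 : 0 ≤ M := integral_nonneg fun y => sq_nonneg _
  refine ⟨8 + 2 * M, by positivity, fun ι _ a => ?_⟩
  set γ := ProbabilityTheory.gaussianReal 0 1 with hγ
  let X : ι → ℝ → ℝ := fun i y => (y + a i) ^ 2
  have hL : ∀ i, MemLp (X i) 2 γ := by
    intro i
    have h := (memLp_two_iff_integrable_sq (μ := γ)
      (f := fun y : ℝ => (y + a i) ^ 2 - (a i ^ 2 + 1)) (by fun_prop)).2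
      (integrable_shift_sq_sub_sq (a i))
    have := h.add (memLp_const (a i ^ 2 + 1))
    refine this.ae_eq (ae_of_all _ fun y => ?_)
    simp [X]
  have hv := ProbabilityTheory.variance_sum_pi (μ := fun _ : ι => γ) hL
  have hvar : ∀ i, ProbabilityTheory.variance (X i) γ ≤ 8 * a i ^ 2 + 2 * M := by
    intro i
    rw [← ProbabilityTheory.variance_sub_const (by fun_prop) (a i ^ 2 + 1)]
    refine (ProbabilityTheory.variance_le_expectation_sq (by fun_prop)).trans ?_
    have hb : ∀ y : ℝ, ((y + a i) ^ 2 - (a i ^ 2 + 1)) ^ 2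
        ≤ 8 * a i ^ 2 * y ^ 2 + 2 * (y ^ 2 - 1) ^ 2 := by
      intro y; nlinarith [sq_nonneg ((y ^ 2 - 1) - 2 * a i * y)]
    have j1 := (integrable_pow_gaussianReal_std 2).const_mul (8 * a i ^ 2)
    have j2 : Integrable (fun y : ℝ => 2 * (y ^ 2 - 1) ^ 2) γ := by
      have := (integrable_shift_sq_sub_sq 0).const_mul 2
      simpa using this
    calc _ = ∫ y, ((y + a i) ^ 2 - (a i ^ 2 + 1)) ^ 2 ∂γ := by simp [X]
      _ ≤ ∫ y, (8 * a i ^ 2 * y ^ 2 + 2 * (y ^ 2 - 1) ^ 2) ∂γ :=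
        integral_mono (integrable_shift_sq_sub_sq _) (j1.add j2) hb
      _ = _ := by
        rw [integral_add j1 j2, integral_const_mul, integral_const_mul,
          integral_sq_gaussianReal_std]; ring
  have hmean := integral_norm_add_sq_gauss a
  have e : ∫ z, (‖z + a‖ ^ 2 - (‖a‖ ^ 2 + Fintype.card ι)) ^ 2 ∂(gauss (EuclideanSpace ℝ ι))
      = ProbabilityTheory.variance (∑ i, fun x : ι → ℝ => X i (x i))
          (Measure.pi fun _ : ι => γ) := by
    have hs : ∀ x : ι → ℝ, ‖WithLp.toLp 2 x + a‖ ^ 2 = (∑ i, fun x : ι → ℝ => X i (x i)) x := by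
      intro x
      simp [EuclideanSpace.norm_sq_eq, X]
    rw [ProbabilityTheory.variance_eq_integral]
    · rw [integral_gauss_eq_pi] at hmean ⊢
      simp only [hs] at hmean ⊢
      rw [hmean]
    · refine (Finset.aemeasurable_sum _ fun i _ => ?_)
      exact (by fun_prop : Measurable fun x : ι → ℝ => (x i + a i) ^ 2).aemeasurable
  rw [e, hv]
  calc _ ≤ ∑ i, (8 * a i ^ 2 + 2 * M) := Finset.sum_le_sum fun i _ => hvar i
    _ = 8 * ‖a‖ ^ 2 + 2 * M * Fintype.card ι := by
      simp [EuclideanSpace.norm_sq_eq, Finset.sum_add_distrib, Finset.mul_sum]; ring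
    _ ≤ _ := by nlinarith [sq_nonneg ‖a‖, (Nat.cast_nonneg (Fintype.card ι) : (0 : ℝ) ≤ _)]

/-- The expected norm of a shifted standard Gaussian vector, up to a universal additive constant. -/
theorem exists_le_integral_norm_add_gauss : ∃ C : ℝ, 0 ≤ C ∧
    ∀ (ι : Type*) [Fintype ι] (a : EuclideanSpace ℝ ι),
    √(‖a‖ ^ 2 + Fintype.card ι) - C ≤ ∫ z, ‖z + a‖ ∂(gauss (EuclideanSpace ℝ ι)) := by
  obtain ⟨C, hC, h⟩ := exists_integral_norm_sq_sub_sq_le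
  refine ⟨C, hC, fun ι _ a => ?_⟩
  rcases isEmpty_or_nonempty ι with hι | hι
  · have hz : ∀ z : EuclideanSpace ℝ ι, ‖z‖ = 0 := fun z => by
      rw [Subsingleton.elim z 0, norm_zero]
    simp [hz, hC]
  have hcard : (1 : ℝ) ≤ Fintype.card ι := by exact_mod_cast Fintype.card_pos
  set N : ℝ := ‖a‖ ^ 2 + Fintype.card ι with hN
  have hN1 : 1 ≤ N := by rw [hN]; nlinarith [sq_nonneg ‖a‖]
  have hs0 : 0 < √N := by positivity
  have hpt : ∀ z : EuclideanSpace ℝ ι, √N + (‖z + a‖ ^ 2 - N) / (2 * √N)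
      - (‖z + a‖ ^ 2 - N) ^ 2 / (2 * N * √N) ≤ ‖z + a‖ := by
    intro z
    set x := ‖z + a‖
    have hx : 0 ≤ x := norm_nonneg _
    set r := √N
    have hr : N = r ^ 2 := (Real.sq_sqrt (by linarith)).symm
    rw [hr]
    have : x - (r + (x ^ 2 - r ^ 2) / (2 * r) - (x ^ 2 - r ^ 2) ^ 2 / (2 * r ^ 2 * r))
        = x * (x - r) ^ 2 * (x + 2 * r) / (2 * r ^ 3) := by
      field_simp; ring
    have h2 : 0 ≤ x * (x - r) ^ 2 * (x + 2 * r) / (2 * r ^ 3) := by positivity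
    linarith
  have hi1 : Integrable (fun z : EuclideanSpace ℝ ι => ‖z + a‖) (gauss _) := by
    refine (integrable_norm_gauss.add (integrable_const ‖a‖)).mono' (by fun_prop)
      (ae_of_all _ fun z => ?_)
    simpa using norm_add_le z a
  have hi2 : ∀ k : ℕ, Integrable (fun z : EuclideanSpace ℝ ι => ‖z + a‖ ^ k) (gauss _) := by
    intro k
    refine ((integrable_exp_mul_norm_gauss 1).const_mul
      (k.factorial * exp ‖a‖)).mono' (by fun_prop) (ae_of_all _ fun z => ?_)
    rw [norm_of_nonneg (by positivity), mul_assoc, ← exp_add]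
    have := pow_div_factorial_le_exp ‖z + a‖ (norm_nonneg _) k
    rw [div_le_iff₀ (by positivity), mul_comm] at this
    refine this.trans ?_
    gcongr
    linarith [norm_add_le z a]
  have hi3 : Integrable (fun z : EuclideanSpace ℝ ι => (‖z + a‖ ^ 2 - N) ^ 2) (gauss _) := by
    refine (((hi2 4).sub ((hi2 2).const_mul (2 * N))).add (integrable_const (N ^ 2))).congr
      (ae_of_all _ fun z => ?_)
    simp only [Pi.add_apply, Pi.sub_apply]; ring
  have hi4 : Integrable (fun z : EuclideanSpace ℝ ι => ‖z + a‖ ^ 2 - N) (gauss _) :=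
    (hi2 2).sub (integrable_const _)
  have hi5 : Integrable (fun z : EuclideanSpace ℝ ι => √N + (‖z + a‖ ^ 2 - N) / (2 * √N))
    (gauss _) := (integrable_const _).add (hi4.div_const _)
  have hI := integral_mono (hi5.sub (hi3.div_const (2 * N * √N))) hi1 hpt
  have hmean : ∫ z, (‖z + a‖ ^ 2 - N) ∂(gauss (EuclideanSpace ℝ ι)) = 0 := by
    rw [integral_sub (hi2 2) (integrable_const _), integral_norm_add_sq_gauss]
    simp [hN]
  simp only [Pi.sub_apply] at hI
  rw [integral_sub hi5 (hi3.div_const _), integral_add (integrable_const _) (hi4.div_const _),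
    integral_div, integral_div, hmean] at hI
  have hs1 : 1 ≤ √N := Real.one_le_sqrt.2 hN1
  have hb : (∫ z, (‖z + a‖ ^ 2 - N) ^ 2 ∂(gauss (EuclideanSpace ℝ ι))) / (2 * N * √N) ≤ C := by
    rw [div_le_iff₀ (by positivity)]
    refine (h ι a).trans ?_
    rw [← hN]
    have : 0 ≤ C * N := by positivity
    nlinarith
  simp at hI
  linarith

theorem integral_norm_gauss_le :
    ∫ z, ‖z‖ ∂(gauss (EuclideanSpace ℝ ι)) ≤ √(Fintype.card ι) := by
  have h := integral_norm_add_sq_gauss (0 : EuclideanSpace ℝ ι)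
  simp at h
  have h2 : 0 ≤ ∫ z, (‖z‖ - ∫ w, ‖w‖ ∂(gauss (EuclideanSpace ℝ ι))) ^ 2
      ∂(gauss (EuclideanSpace ℝ ι)) := integral_nonneg fun z => sq_nonneg _
  set c := ∫ w, ‖w‖ ∂(gauss (EuclideanSpace ℝ ι)) with hc
  have e : ∀ z : EuclideanSpace ℝ ι, (‖z‖ - c) ^ 2 = (‖z‖ ^ 2 - 2 * c * ‖z‖) + c ^ 2 :=
    fun z => by ring
  simp only [e] at h2
  have i1 : Integrable (fun z => ‖z‖ ^ 2 - 2 * c * ‖z‖) (gauss (EuclideanSpace ℝ ι)) :=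
    (integrable_norm_pow_gauss 2).sub (integrable_norm_gauss.const_mul _)
  rw [integral_add i1 (integrable_const _), integral_sub (integrable_norm_pow_gauss 2)
    (integrable_norm_gauss.const_mul _), integral_const_mul, ← hc, h] at h2
  apply Real.le_sqrt_of_sq_le
  simp at h2
  nlinarith

end Eucl

/-- Gibbs' inequality. -/
theorem integral_log_nonpos {Ω : Type*} [MeasurableSpace Ω] (P : Measure Ω)
    [IsProbabilityMeasure P] (r : Ω → ℝ) (hr : ∀ ω, 0 < r ω) (hm : Measurable r)
    (h1 : ∫⁻ ω, ENNReal.ofReal (r ω) ∂P ≤ 1) (hi : Integrable (fun ω => log (r ω)) P) :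
    ∫ ω, log (r ω) ∂P ≤ 0 := by
  have hri : Integrable r P := by
    refine ⟨hm.aestronglyMeasurable, ?_⟩
    rw [hasFiniteIntegral_iff_ofReal (ae_of_all _ fun ω => (hr ω).le)]
    exact h1.trans_lt ENNReal.one_lt_top
  have h2 : ∫ ω, r ω ∂P ≤ 1 := by
    rw [integral_eq_lintegral_of_nonneg_ae (ae_of_all _ fun ω => (hr ω).le)
      hm.aestronglyMeasurable]
    exact ENNReal.toReal_le_of_le_ofReal zero_le_one (by simpa using h1)
  calc ∫ ω, log (r ω) ∂P ≤ ∫ ω, (r ω - 1) ∂P :=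
        integral_mono hi (hri.sub (integrable_const _)) fun ω => log_le_sub_one_of_pos (hr ω)
    _ = ∫ ω, r ω ∂P - 1 := by rw [integral_sub hri (integrable_const _)]; simp
    _ ≤ 0 := by linarith

section Channel

variable {E : Type*}
  [NormedAddCommGroup E] [InnerProductSpace ℝ E] [FiniteDimensional ℝ E] [MeasurableSpace E]
  [BorelSpace E] {Ω : Type*} [MeasurableSpace Ω]

/-- Likelihood ratio of the Gaussian channel `s φ(X) + Z` against pure noise. -/
def lik (μ : Measure Ω) (φ : Ω → E) (s : ℝ) (z : E) : ℝ :=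
  ∫ x, exp (s * ⟪φ x, z⟫ - s ^ 2 / 2) ∂μ

/-- Free entropy of the Gaussian channel `s φ(X) + Z`. -/
def freeEnt (μ : Measure Ω) (φ : Ω → E) (s : ℝ) : ℝ :=
  ∫ x, ∫ z, log (lik μ φ s (z + s • φ x)) ∂(gauss E) ∂μ

variable (μ : Measure Ω) [IsProbabilityMeasure μ] (φ : Ω → E) (hφ : Measurable φ)
  (hφ1 : ∀ x, ‖φ x‖ = 1)

include hφ hφ1

omit [FiniteDimensional ℝ E] [MeasurableSpace E] [BorelSpace E] [MeasurableSpace Ω] hφ in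
theorem abs_mul_inner_le (s : ℝ) (x : Ω) (z : E) : |s * ⟪φ x, z⟫| ≤ |s| * ‖z‖ := by
  rw [abs_mul]
  have := abs_real_inner_le_norm (φ x) z
  rw [hφ1, one_mul] at this
  gcongr

omit [FiniteDimensional ℝ E] [MeasurableSpace E] [BorelSpace E] [MeasurableSpace Ω] hφ in
theorem exp_lik_bounds (s : ℝ) (x : Ω) (z : E) :
    exp (-(|s| * ‖z‖ + s ^ 2 / 2)) ≤ exp (s * ⟪φ x, z⟫ - s ^ 2 / 2) ∧
    exp (s * ⟪φ x, z⟫ - s ^ 2 / 2) ≤ exp (|s| * ‖z‖ + s ^ 2 / 2) := by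
  have h := abs_le.1 (abs_mul_inner_le φ hφ1 s x z)
  constructor <;> gcongr <;> nlinarith [sq_nonneg s]

theorem integrable_exp_lik (s : ℝ) (z : E) :
    Integrable (fun x => exp (s * ⟪φ x, z⟫ - s ^ 2 / 2)) μ := by
  refine (integrable_const (exp (|s| * ‖z‖ + s ^ 2 / 2))).mono' (by fun_prop)
    (ae_of_all _ fun x => ?_)
  rw [norm_of_nonneg (exp_pos _).le]
  exact (exp_lik_bounds φ hφ1 s x z).2

theorem lik_bounds (s : ℝ) (z : E) :
    exp (-(|s| * ‖z‖ + s ^ 2 / 2)) ≤ lik μ φ s z ∧ lik μ φ s z ≤ exp (|s| * ‖z‖ + s ^ 2 / 2) := by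
  have hi := integrable_exp_lik μ φ hφ hφ1 s z
  constructor
  · have := integral_mono (integrable_const (μ := μ) _) hi
      fun x => (exp_lik_bounds φ hφ1 s x z).1
    simpa [lik] using this
  · have := integral_mono hi (integrable_const (μ := μ) _)
      fun x => (exp_lik_bounds φ hφ1 s x z).2
    simpa [lik] using this

theorem lik_pos (s : ℝ) (z : E) : 0 < lik μ φ s z :=
  (exp_pos _).trans_le (lik_bounds μ φ hφ hφ1 s z).1

theorem abs_log_lik_le (s : ℝ) (z : E) : |log (lik μ φ s z)| ≤ |s| * ‖z‖ + s ^ 2 / 2 := by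
  obtain ⟨h1, h2⟩ := lik_bounds μ φ hφ hφ1 s z
  have h0 := lik_pos μ φ hφ hφ1 s z
  rw [abs_le]
  exact ⟨(le_log_iff_exp_le h0).2 h1, (log_le_iff_le_exp h0).2 h2⟩

theorem ofReal_lik (s : ℝ) (z : E) : ENNReal.ofReal (lik μ φ s z)
    = ∫⁻ x, ENNReal.ofReal (exp (s * ⟪φ x, z⟫ - s ^ 2 / 2)) ∂μ :=
  ofReal_integral_eq_lintegral_ofReal (integrable_exp_lik μ φ hφ hφ1 s z)
    (ae_of_all _ fun _ => (exp_pos _).le)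

omit hφ1 in
theorem measurable_lik (s : ℝ) : Measurable (lik μ φ s) := by
  have : StronglyMeasurable (fun p : E × Ω => exp (s * ⟪φ p.2, p.1⟫ - s ^ 2 / 2)) :=
    (by fun_prop : Measurable _).stronglyMeasurable
  exact this.integral_prod_right.measurable

/-- Change of measure for the channel output. -/
theorem lintegral_channel (s : ℝ) (f : E → ENNReal) (hf : Measurable f) :
    ∫⁻ x, ∫⁻ z, f (z + s • φ x) ∂(gauss E) ∂μ
      = ∫⁻ z, ENNReal.ofReal (lik μ φ s z) * f z ∂(gauss E) := by
  have : ∀ x, ∫⁻ z, f (z + s • φ x) ∂(gauss E)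
      = ∫⁻ z, ENNReal.ofReal (exp (s * ⟪φ x, z⟫ - s ^ 2 / 2)) * f z ∂(gauss E) := by
    intro x
    rw [lintegral_gauss_shift f hf]
    simp [inner_smul_left, norm_smul, hφ1]
  simp only [this]
  rw [lintegral_lintegral_swap (by fun_prop)]
  congr 1
  ext z
  rw [lintegral_mul_const _ (by fun_prop), ofReal_lik μ φ hφ hφ1]

theorem lintegral_lik (s : ℝ) : ∫⁻ z, ENNReal.ofReal (lik μ φ s z) ∂(gauss E) = 1 := by
  have := lintegral_channel μ φ hφ hφ1 s (fun _ => 1) measurable_const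
  simpa using this.symm

omit hφ1 in
theorem measurable_log_lik (s : ℝ) :
    Measurable (fun p : Ω × E => log (lik μ φ s (p.2 + s • φ p.1))) :=
  measurable_log.comp ((measurable_lik μ φ hφ s).comp (by fun_prop))

omit hφ hφ1 in
theorem integrable_of_le_norm (f : Ω × E → ℝ) (hf : Measurable f) (a b : ℝ)
    (h : ∀ p, |f p| ≤ a * ‖p.2‖ + b) : Integrable f (μ.prod (gauss E)) := by
  have h1 : Integrable (fun p : Ω × E => ‖p.2‖) (μ.prod (gauss E)) :=
    integrable_norm_gauss.comp_snd μ
  exact ((h1.const_mul a).add (integrable_const b)).mono' hf.aestronglyMeasurable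
    (ae_of_all _ h)

theorem integrable_log_lik (s : ℝ) :
    Integrable (fun p : Ω × E => log (lik μ φ s (p.2 + s • φ p.1))) (μ.prod (gauss E)) := by
  refine integrable_of_le_norm μ _ (measurable_log_lik μ φ hφ s) |s|
    (|s| * |s| + s ^ 2 / 2) fun p => ?_
  refine (abs_log_lik_le μ φ hφ hφ1 s _).trans ?_
  have := norm_add_le p.2 (s • φ p.1)
  rw [norm_smul, hφ1, mul_one, norm_eq_abs] at this
  nlinarith [mul_le_mul_of_nonneg_left this (abs_nonneg s)]

theorem freeEnt_eq_prod (s : ℝ) :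
    freeEnt μ φ s = ∫ p, log (lik μ φ s (p.2 + s • φ p.1)) ∂(μ.prod (gauss E)) :=
  (integral_prod _ (integrable_log_lik μ φ hφ hφ1 s)).symm

omit hφ hφ1 in
theorem integral_inner_gauss (a : E) : ∫ z, ⟪a, z⟫ ∂(gauss E) = 0 := by
  have := integral_inner_mul_gauss a (fun _ => 1) (fun _ => 0) continuous_const continuous_const
    1 0 (by simp) (by simp) (fun z => hasDerivAt_const _ _)
  simpa using this

omit hφ hφ1 in
theorem integrable_inner_gauss (a : E) : Integrable (fun z => ⟪a, z⟫) (gauss E) :=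
  (integrable_norm_gauss.const_mul ‖a‖).mono' (by fun_prop)
    (ae_of_all _ fun z => abs_real_inner_le_norm a z)

/-- Variational upper bound on the free entropy. -/
theorem freeEnt_le (s : ℝ) (t : Ω × E → ℝ) (ht : Measurable t) (T : ℝ) (hT : ∀ p, |t p| ≤ T) :
    freeEnt μ φ s ≤ s ^ 2 / 2 - ∫ x, ∫ z, t (x, z + s • φ x) ∂(gauss E) ∂μ
      + ∫ x, ∫ z, log (∫ x', exp (t (x', z + s • φ x)) ∂μ) ∂(gauss E) ∂μ := by
  set τ : E → ℝ := fun z => ∫ x', exp (t (x', z)) ∂μ with hτ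
  have hτi : ∀ z, Integrable (fun x' => exp (t (x', z))) μ := fun z =>
    (integrable_const (exp T)).mono'
      (by fun_prop : Measurable fun x' => exp (t (x', z))).aestronglyMeasurable (ae_of_all _ fun x => by
      rw [norm_of_nonneg (exp_pos _).le]
      exact exp_le_exp.2 (abs_le.1 (hT _)).2)
  have hτ1 : ∀ z, exp (-T) ≤ τ z := fun z => by
    have := integral_mono (integrable_const (μ := μ) (exp (-T))) (hτi z)
      fun x => exp_le_exp.2 (abs_le.1 (hT (x, z))).1
    simpa using this
  have hτ2 : ∀ z, τ z ≤ exp T := fun z => by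
    have := integral_mono (hτi z) (integrable_const (μ := μ) (exp T))
      fun x => exp_le_exp.2 (abs_le.1 (hT (x, z))).2
    simpa using this
  have hτ0 : ∀ z, 0 < τ z := fun z => (exp_pos _).trans_le (hτ1 z)
  have hτm : Measurable τ := by
    have : StronglyMeasurable (fun p : E × Ω => exp (t (p.2, p.1))) :=
      (by fun_prop : Measurable _).stronglyMeasurable
    exact this.integral_prod_right.measurable
  have hlτ : ∀ z, |log (τ z)| ≤ T := fun z =>
    abs_le.2 ⟨(le_log_iff_exp_le (hτ0 z)).2 (hτ1 z), (log_le_iff_le_exp (hτ0 z)).2 (hτ2 z)⟩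
  have hLm := measurable_lik μ φ hφ s
  set r : Ω × E → ℝ := fun p => exp (t (p.1, p.2 + s • φ p.1)) * lik μ φ s (p.2 + s • φ p.1)
    / (τ (p.2 + s • φ p.1) * exp (s * ⟪φ p.1, p.2 + s • φ p.1⟫ - s ^ 2 / 2)) with hr
  have hlog : ∀ p, log (r p) = (t (p.1, p.2 + s • φ p.1) + log (lik μ φ s (p.2 + s • φ p.1)))
      - (log (τ (p.2 + s • φ p.1)) + (s * ⟪φ p.1, p.2⟫ + s ^ 2 / 2)) := by
    intro p
    have h0 := lik_pos μ φ hφ hφ1 s (p.2 + s • φ p.1)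
    rw [hr]
    simp only
    rw [log_div (by positivity) (mul_pos (hτ0 _) (exp_pos _)).ne', log_mul (exp_pos _).ne' h0.ne',
      log_mul (hτ0 _).ne' (exp_pos _).ne', log_exp, log_exp, inner_add_right, inner_smul_right,
      real_inner_self_eq_norm_sq, hφ1]
    ring
  have i1 : Integrable (fun p : Ω × E => t (p.1, p.2 + s • φ p.1)) (μ.prod (gauss E)) :=
    integrable_of_le_norm μ _ (by fun_prop) 0 T fun p => by simpa using hT _
  have i2 := integrable_log_lik μ φ hφ hφ1 s
  have i3 : Integrable (fun p : Ω × E => log (τ (p.2 + s • φ p.1))) (μ.prod (gauss E)) :=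
    integrable_of_le_norm μ _ (by fun_prop) 0 T fun p => by simpa using hlτ _
  have i4 : Integrable (fun p : Ω × E => s * ⟪φ p.1, p.2⟫ + s ^ 2 / 2) (μ.prod (gauss E)) :=
    integrable_of_le_norm μ _ (by fun_prop) |s| (s ^ 2 / 2) fun p => by
      refine (abs_add_le _ _).trans ?_
      rw [abs_of_nonneg (by positivity : 0 ≤ s ^ 2 / 2)]
      gcongr
      exact abs_mul_inner_le φ hφ1 s _ _
  have hG := integral_log_nonpos (μ.prod (gauss E)) r
    (fun p => div_pos (mul_pos (exp_pos _) (lik_pos μ φ hφ hφ1 _ _))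
      (mul_pos (hτ0 _) (exp_pos _)))
    (by fun_prop) ?_ ?_
  · have e : ∫ p, log (r p) ∂(μ.prod (gauss E)) = _ :=
      (integral_congr_ae (ae_of_all _ hlog)).trans
        (integral_sub (i1.add i2) (i3.add i4))
    rw [e, integral_add i1 i2, integral_add i3 i4,
      ← freeEnt_eq_prod μ φ hφ hφ1, integral_prod _ i1, integral_prod _ i3,
      integral_prod _ i4] at hG
    have : ∀ x, ∫ z, (s * ⟪φ x, z⟫ + s ^ 2 / 2) ∂(gauss E) = s ^ 2 / 2 := by
      intro x
      rw [integral_add ((integrable_inner_gauss _).const_mul _) (integrable_const _),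
        integral_const_mul, integral_inner_gauss]
      simp
    simp only [this] at hG
    simp at hG
    linarith
  · rw [lintegral_prod _ (by fun_prop)]
    have : ∀ x, ∫⁻ z, ENNReal.ofReal (r (x, z)) ∂(gauss E)
        = ∫⁻ z, ENNReal.ofReal (exp (t (x, z)) * lik μ φ s z / τ z) ∂(gauss E) := by
      intro x
      have := lintegral_gauss_shift (fun z => ENNReal.ofReal (exp (t (x, z)) * lik μ φ s z
        / (τ z * exp (s * ⟪φ x, z⟫ - s ^ 2 / 2)))) (by fun_prop) (s • φ x)
      simp only [hr]
      rw [this]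
      congr 1
      ext z
      rw [← ENNReal.ofReal_mul (exp_pos _).le]
      congr 1
      simp only [inner_smul_left, norm_smul, hφ1, RCLike.conj_to_real, mul_one, norm_eq_abs,
        sq_abs]
      have := (hτ0 z).ne'
      field_simp
    simp only [this]
    rw [lintegral_lintegral_swap (by fun_prop)]
    have : ∀ z, ∫⁻ x, ENNReal.ofReal (exp (t (x, z)) * lik μ φ s z / τ z) ∂μ
        = ENNReal.ofReal (lik μ φ s z) := by
      intro z
      rw [← ofReal_integral_eq_lintegral_ofReal]
      · congr 1
        simp only [mul_div_assoc]
        rw [integral_mul_const]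
        change τ z * _ = _
        have := (hτ0 z).ne'
        field_simp
      · simp only [mul_div_assoc]
        exact (hτi z).mul_const _
      · exact ae_of_all _ fun x => div_nonneg
          (mul_nonneg (exp_pos _).le (lik_pos μ φ hφ hφ1 _ _).le) (hτ0 z).le
    simp only [this]
    rw [lintegral_lik μ φ hφ hφ1]
  · simp only [hlog]
    exact (i1.add i2).sub (i3.add i4)

omit hφ hφ1 in
theorem lintegral_exp_inner_gauss (a : E) :
    ∫⁻ z, ENNReal.ofReal (exp (⟪a, z⟫ - ‖a‖ ^ 2 / 2)) ∂(gauss E) = 1 := by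
  have := lintegral_gauss_shift (fun _ => 1) measurable_const a
  simpa using this.symm

/-- Lower bound on the increment of the free entropy through the performance of an estimator. -/
theorem freeEnt_increment (s₁ s₂ δ c : ℝ) (hs₂ : 0 < s₂) (hs : s₂ ^ 2 = s₁ ^ 2 + δ ^ 2)
    (M : E → E) (hM : Measurable M) (hM1 : ∀ z, ‖M z‖ ≤ 1) :
    freeEnt μ φ s₁ + δ ^ 2 * (c * ∫ x, ∫ z, ⟪M (z + s₁ • φ x), φ x⟫ ∂(gauss E) ∂μ - c ^ 2 / 2)
      ≤ freeEnt μ φ s₂ := by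
  have hs₂' := hs₂.ne'
  have hL1m := measurable_lik μ φ hφ s₁
  have hL2m := measurable_lik μ φ hφ s₂
  set P := (μ.prod (gauss E)).prod (gauss E) with hP
  set K : E → E → E := fun z w => (s₁ / s₂) • z + (δ / s₂) • w with hK
  set f : E → E → ℝ := fun z w => lik μ φ s₁ z * exp (c * δ * ⟪M z, w⟫ - c ^ 2 * δ ^ 2 / 2)
    / lik μ φ s₂ (K z w) with hf
  have hfm : Measurable (fun q : E × E => f q.1 q.2) := by
    simp only [hf, hK]; fun_prop
  set r : (Ω × E) × E → ℝ := fun p => f (p.1.2 + s₁ • φ p.1.1) (p.2 + δ • φ p.1.1) with hr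
  have hKφ : ∀ x z w, K (z + s₁ • φ x) (w + δ • φ x) = K z w + s₂ • φ x := by
    intro x z w
    have h : s₂ • φ x = (s₁ / s₂ * s₁) • φ x + (δ / s₂ * δ) • φ x := by
      rw [← add_smul]
      congr 1
      field_simp; linarith
    simp only [hK, smul_add, smul_smul, h]
    abel
  have hlog : ∀ p, log (r p) = ((log (lik μ φ s₁ (p.1.2 + s₁ • φ p.1.1))
      + c * δ ^ 2 * ⟪M (p.1.2 + s₁ • φ p.1.1), φ p.1.1⟫)
      + (c * δ * ⟪M (p.1.2 + s₁ • φ p.1.1), p.2⟫ - c ^ 2 * δ ^ 2 / 2))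
      - log (lik μ φ s₂ (K p.1.2 p.2 + s₂ • φ p.1.1)) := by
    intro p
    have h1 := lik_pos μ φ hφ hφ1 s₁ (p.1.2 + s₁ • φ p.1.1)
    simp only [hr, hf]
    rw [log_div (mul_pos h1 (exp_pos _)).ne' (lik_pos μ φ hφ hφ1 _ _).ne', log_mul h1.ne'
      (exp_pos _).ne', log_exp, inner_add_right, inner_smul_right, hKφ]
    ring
  have hMm : Measurable (fun p : Ω × E => ⟪M (p.2 + s₁ • φ p.1), φ p.1⟫) := by fun_prop
  have hMb : ∀ z w, |⟪M z, w⟫| ≤ ‖w‖ := fun z w => by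
    have := abs_real_inner_le_norm (M z) w
    nlinarith [hM1 z, norm_nonneg w]
  have j1 := integrable_log_lik μ φ hφ hφ1 s₁
  have j2 : Integrable (fun p : Ω × E => ⟪M (p.2 + s₁ • φ p.1), φ p.1⟫) (μ.prod (gauss E)) :=
    integrable_of_le_norm μ _ hMm 0 1 fun p => by simpa [hφ1] using hMb (p.2 + s₁ • φ p.1) (φ p.1)
  have i12 : Integrable (fun p : Ω × E => log (lik μ φ s₁ (p.2 + s₁ • φ p.1))
      + c * δ ^ 2 * ⟪M (p.2 + s₁ • φ p.1), φ p.1⟫) (μ.prod (gauss E)) :=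
    j1.add (j2.const_mul _)
  have i12' : Integrable (fun p : (Ω × E) × E => log (lik μ φ s₁ (p.1.2 + s₁ • φ p.1.1))
      + c * δ ^ 2 * ⟪M (p.1.2 + s₁ • φ p.1.1), φ p.1.1⟫) P := i12.comp_fst _
  have i3 : Integrable (fun p : (Ω × E) × E =>
      c * δ * ⟪M (p.1.2 + s₁ • φ p.1.1), p.2⟫ - c ^ 2 * δ ^ 2 / 2) P := by
    refine integrable_of_le_norm (μ.prod (gauss E)) _ (by fun_prop) |c * δ| (c ^ 2 * δ ^ 2 / 2)
      fun p => (abs_sub _ _).trans ?_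
    rw [abs_mul, abs_of_nonneg (by positivity : 0 ≤ c ^ 2 * δ ^ 2 / 2)]
    gcongr
    exact hMb _ _
  have hKm : Measurable (fun q : E × E => K q.1 q.2) := by simp only [hK]; fun_prop
  have hmp : MeasurePreserving (fun q : E × E => K q.1 q.2) ((gauss E).prod (gauss E)) (gauss E) :=
    ⟨hKm, gauss_prod_map_combo (s₁ / s₂) (δ / s₂) (by field_simp; linarith)⟩
  have hmp2 : MeasurePreserving (fun p : (Ω × E) × E => (p.1.1, K p.1.2 p.2)) P
      (μ.prod (gauss E)) := by
    have a1 := measurePreserving_prodAssoc μ (gauss E) (gauss E)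
    exact ((MeasurePreserving.id μ).prod hmp).comp a1
  have i4 : Integrable (fun p : (Ω × E) × E => log (lik μ φ s₂ (K p.1.2 p.2 + s₂ • φ p.1.1))) P :=
    hmp2.integrable_comp_of_integrable (integrable_log_lik μ φ hφ hφ1 s₂)
  have e4 : ∫ p : (Ω × E) × E, log (lik μ φ s₂ (K p.1.2 p.2 + s₂ • φ p.1.1)) ∂P
      = freeEnt μ φ s₂ := by
    rw [freeEnt_eq_prod μ φ hφ hφ1, ← hmp2.map_eq, integral_map hmp2.measurable.aemeasurable
      (measurable_log_lik μ φ hφ s₂).aestronglyMeasurable]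
  have e3 : ∫ p : (Ω × E) × E, (c * δ * ⟪M (p.1.2 + s₁ • φ p.1.1), p.2⟫ - c ^ 2 * δ ^ 2 / 2) ∂P
      = - (c ^ 2 * δ ^ 2 / 2) := by
    rw [hP, integral_prod _ i3]
    have : ∀ q : Ω × E, ∫ w, (c * δ * ⟪M (q.2 + s₁ • φ q.1), w⟫ - c ^ 2 * δ ^ 2 / 2) ∂(gauss E)
        = - (c ^ 2 * δ ^ 2 / 2) := by
      intro q
      rw [integral_sub ((integrable_inner_gauss _).const_mul _) (integrable_const _),
        integral_const_mul, integral_inner_gauss]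
      simp
    simp [this]
  have e12 : ∫ p : (Ω × E) × E, (log (lik μ φ s₁ (p.1.2 + s₁ • φ p.1.1))
      + c * δ ^ 2 * ⟪M (p.1.2 + s₁ • φ p.1.1), φ p.1.1⟫) ∂P
      = freeEnt μ φ s₁ + c * δ ^ 2 * ∫ x, ∫ z, ⟪M (z + s₁ • φ x), φ x⟫ ∂(gauss E) ∂μ := by
    rw [hP, integral_prod _ i12']
    simp only [integral_const, probReal_univ, one_smul]
    rw [integral_add j1 (j2.const_mul _), integral_const_mul, freeEnt_eq_prod μ φ hφ hφ1,
      integral_prod _ j2]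
  have i5 : Integrable (fun p : (Ω × E) × E => ((log (lik μ φ s₁ (p.1.2 + s₁ • φ p.1.1))
      + c * δ ^ 2 * ⟪M (p.1.2 + s₁ • φ p.1.1), φ p.1.1⟫)
      + (c * δ * ⟪M (p.1.2 + s₁ • φ p.1.1), p.2⟫ - c ^ 2 * δ ^ 2 / 2))) P := i12'.add i3
  have hG := integral_log_nonpos P r (fun p => div_pos (mul_pos (lik_pos μ φ hφ hφ1 _ _)
      (exp_pos _)) (lik_pos μ φ hφ hφ1 _ _)) (by fun_prop) ?_ ?_
  · simp only [hlog] at hG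
    rw [integral_sub i5 i4, integral_add i12' i3, e12, e3, e4] at hG
    linarith
  · rw [hP, lintegral_prod _ (by fun_prop), lintegral_prod _ (by fun_prop)]
    have e1 : ∀ x z, ∫⁻ w, ENNReal.ofReal (r ((x, z), w)) ∂(gauss E)
        = ∫⁻ w, ENNReal.ofReal (exp (δ * ⟪φ x, w⟫ - δ ^ 2 / 2))
            * ENNReal.ofReal (f (z + s₁ • φ x) w) ∂(gauss E) := by
      intro x z
      have := lintegral_gauss_shift (fun w => ENNReal.ofReal (f (z + s₁ • φ x) w))
        (by fun_prop) (δ • φ x)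
      simp only [hr]
      rw [this]
      simp only [inner_smul_left, norm_smul, hφ1, RCLike.conj_to_real, mul_one, norm_eq_abs,
        sq_abs]
    have e2 : ∀ x, ∫⁻ z, ∫⁻ w, ENNReal.ofReal (exp (δ * ⟪φ x, w⟫ - δ ^ 2 / 2))
            * ENNReal.ofReal (f (z + s₁ • φ x) w) ∂(gauss E) ∂(gauss E)
        = ∫⁻ z, ∫⁻ w, ENNReal.ofReal (exp (s₂ * ⟪φ x, K z w⟫ - s₂ ^ 2 / 2))
            * ENNReal.ofReal (f z w) ∂(gauss E) ∂(gauss E) := by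
      intro x
      have := lintegral_gauss_shift (fun z => ∫⁻ w, ENNReal.ofReal (exp (δ * ⟪φ x, w⟫ - δ ^ 2 / 2))
            * ENNReal.ofReal (f z w) ∂(gauss E))
        (Measurable.lintegral_prod_right (by fun_prop)) (s₁ • φ x)
      rw [this]
      congr 1
      ext z
      rw [← lintegral_const_mul _ (by fun_prop)]
      congr 1
      ext w
      rw [← mul_assoc, ← ENNReal.ofReal_mul (exp_pos _).le, ← exp_add]
      congr 3
      simp only [inner_smul_left, norm_smul, hφ1, RCLike.conj_to_real, mul_one, norm_eq_abs,
        sq_abs, hK, inner_add_right, inner_smul_right, hs]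
      field_simp
      ring
    simp only [e1, e2]
    rw [lintegral_lintegral_swap
      (Measurable.lintegral_prod_right (by fun_prop)).aemeasurable]
    have e3 : ∀ z, ∫⁻ x, ∫⁻ w, ENNReal.ofReal (exp (s₂ * ⟪φ x, K z w⟫ - s₂ ^ 2 / 2))
            * ENNReal.ofReal (f z w) ∂(gauss E) ∂μ ≤ ENNReal.ofReal (lik μ φ s₁ z) := by
      intro z
      rw [lintegral_lintegral_swap (by fun_prop)]
      have : ∀ w, ∫⁻ x, ENNReal.ofReal (exp (s₂ * ⟪φ x, K z w⟫ - s₂ ^ 2 / 2))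
            * ENNReal.ofReal (f z w) ∂μ ≤ ENNReal.ofReal (lik μ φ s₁ z)
              * ENNReal.ofReal (exp (⟪(c * δ) • M z, w⟫ - ‖(c * δ) • M z‖ ^ 2 / 2)) := by
        intro w
        have hp := lik_pos μ φ hφ hφ1 s₂ (K z w)
        have hp1 := lik_pos μ φ hφ hφ1 s₁ z
        rw [lintegral_mul_const _ (by fun_prop), ← ofReal_lik μ φ hφ hφ1,
          ← ENNReal.ofReal_mul hp.le, ← ENNReal.ofReal_mul hp1.le]
        apply ENNReal.ofReal_le_ofReal
        simp only [hf]
        rw [mul_div_cancel₀ _ hp.ne']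
        gcongr
        · rw [inner_smul_left]; simp
        · rw [norm_smul, mul_pow, norm_eq_abs, sq_abs, mul_pow]
          have := pow_le_one₀ (n := 2) (norm_nonneg _) (hM1 z)
          exact mul_le_of_le_one_right (by positivity) this
      refine (lintegral_mono this).trans ?_
      rw [lintegral_const_mul _ (by fun_prop), lintegral_exp_inner_gauss, mul_one]
    exact (lintegral_mono e3).trans (lintegral_lik μ φ hφ hφ1 s₁).le
  · simp only [hlog]
    exact i5.sub i4

theorem freeEnt_mono (s₁ s₂ : ℝ) (h1 : 0 ≤ s₁) (h : s₁ ≤ s₂) : freeEnt μ φ s₁ ≤ freeEnt μ φ s₂ := by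
  rcases h.eq_or_lt with rfl | h'
  · rfl
  have := freeEnt_increment μ φ hφ hφ1 s₁ s₂ (√(s₂ ^ 2 - s₁ ^ 2)) 0 (h1.trans_lt h')
    (by rw [Real.sq_sqrt]; ring; nlinarith) (fun _ => 0) measurable_const (by simp)
  simpa using this

omit [BorelSpace E] hφ hφ1 in
theorem freeEnt_zero : freeEnt μ φ 0 = 0 := by simp [freeEnt, lik]

theorem freeEnt_nonneg (s : ℝ) (h : 0 ≤ s) : 0 ≤ freeEnt μ φ s :=
  (freeEnt_zero μ φ).ge.trans (freeEnt_mono μ φ hφ hφ1 0 s le_rfl h)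

end Channel

section Softmax

variable {ι : Type*} [Fintype ι] [Nonempty ι]

/-- The Gibbs weights of `x` at inverse temperature `β`. -/
def gibbs (β : ℝ) (x : ι → ℝ) (i : ι) : ℝ := exp (β * x i) / ∑ j, exp (β * x j)

/-- The soft maximum of `x` at inverse temperature `β`. -/
def softmax (β : ℝ) (x : ι → ℝ) : ℝ := log (∑ j, exp (β * x j)) / β

theorem sum_exp_pos (β : ℝ) (x : ι → ℝ) : 0 < ∑ j, exp (β * x j) :=
  Finset.sum_pos (fun _ _ => exp_pos _) Finset.univ_nonempty

theorem gibbs_nonneg (β : ℝ) (x : ι → ℝ) (i : ι) : 0 ≤ gibbs β x i :=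
  div_nonneg (exp_pos _).le (sum_exp_pos β x).le

theorem sum_gibbs (β : ℝ) (x : ι → ℝ) : ∑ i, gibbs β x i = 1 := by
  simp only [gibbs]
  rw [← Finset.sum_div, div_self (sum_exp_pos β x).ne']

theorem gibbs_le_one (β : ℝ) (x : ι → ℝ) (i : ι) : gibbs β x i ≤ 1 := by
  rw [← sum_gibbs β x]
  exact Finset.single_le_sum (fun j _ => gibbs_nonneg β x j) (Finset.mem_univ i)

theorem abs_gibbs_le_one (β : ℝ) (x : ι → ℝ) (i : ι) : |gibbs β x i| ≤ 1 := by
  rw [abs_of_nonneg (gibbs_nonneg β x i)]; exact gibbs_le_one β x i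

theorem continuous_gibbs (β : ℝ) (i : ι) : Continuous fun x : ι → ℝ => gibbs β x i :=
  Continuous.div (by fun_prop) (by fun_prop) fun x => (sum_exp_pos β x).ne'

theorem continuous_softmax (β : ℝ) : Continuous fun x : ι → ℝ => softmax β x :=
  (Continuous.log (by fun_prop) fun x => (sum_exp_pos β x).ne').div_const _

omit [Nonempty ι] in
theorem hasDerivAt_sum_exp (β : ℝ) (x : ℝ → ι → ℝ) (x' : ι → ℝ) (t : ℝ)
    (h : ∀ i, HasDerivAt (fun t => x t i) (x' i) t) :
    HasDerivAt (fun t => ∑ j, exp (β * x t j)) (∑ j, exp (β * x t j) * (β * x' j)) t :=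
  HasDerivAt.fun_sum fun j _ => ((h j).const_mul β).exp

theorem hasDerivAt_softmax (β : ℝ) (hβ : β ≠ 0) (x : ℝ → ι → ℝ) (x' : ι → ℝ) (t : ℝ)
    (h : ∀ i, HasDerivAt (fun t => x t i) (x' i) t) :
    HasDerivAt (fun t => softmax β (x t)) (∑ i, gibbs β (x t) i * x' i) t := by
  have h1 := ((hasDerivAt_sum_exp β x x' t h).log (sum_exp_pos β (x t)).ne').div_const β
  refine h1.congr_deriv ?_
  simp only [gibbs]
  rw [Finset.sum_div, Finset.sum_div]
  refine Finset.sum_congr rfl fun i _ => ?_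
  field_simp

theorem hasDerivAt_gibbs (β : ℝ) (x : ℝ → ι → ℝ) (x' : ι → ℝ) (t : ℝ)
    (h : ∀ i, HasDerivAt (fun t => x t i) (x' i) t) (i : ι) :
    HasDerivAt (fun t => gibbs β (x t) i)
      (β * gibbs β (x t) i * (x' i - ∑ j, gibbs β (x t) j * x' j)) t := by
  have h0 := (sum_exp_pos β (x t)).ne'
  have h1 := (((h i).const_mul β).exp).fun_div (hasDerivAt_sum_exp β x x' t h) h0
  refine h1.congr_deriv ?_
  have e : ∑ j, exp (β * x t j) * (β * x' j)
      = β * (∑ j, exp (β * x t j)) * ∑ j, gibbs β (x t) j * x' j := by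
    rw [Finset.mul_sum]
    refine Finset.sum_congr rfl fun j _ => ?_
    simp only [gibbs]
    field_simp
  rw [e]
  simp only [gibbs]
  field_simp

theorem le_softmax (β : ℝ) (hβ : 0 < β) (x : ι → ℝ) (i : ι) : x i ≤ softmax β x := by
  rw [softmax, le_div_iff₀ hβ, le_log_iff_exp_le (sum_exp_pos β x), mul_comm]
  exact Finset.single_le_sum (f := fun j => exp (β * x j)) (fun j _ => (exp_pos _).le)
    (Finset.mem_univ i)

theorem softmax_le (β : ℝ) (hβ : 0 < β) (x : ι → ℝ) (m : ℝ) (h : ∀ i, x i ≤ m) :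
    softmax β x ≤ m + log (Fintype.card ι) / β := by
  have hc : (0 : ℝ) < Fintype.card ι := by exact_mod_cast Fintype.card_pos
  rw [softmax, div_le_iff₀ hβ, add_mul, div_mul_cancel₀ _ hβ.ne',
    log_le_iff_le_exp (sum_exp_pos β x), exp_add, exp_log hc]
  calc ∑ j, exp (β * x j) ≤ ∑ _j : ι, exp (m * β) := Finset.sum_le_sum fun j _ => by
        rw [mul_comm]; gcongr; exact h j
    _ = _ := by simp [mul_comm]

theorem abs_softmax_le (β : ℝ) (hβ : 0 < β) (x : ι → ℝ) (m : ℝ) (h : ∀ i, |x i| ≤ m) :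
    |softmax β x| ≤ m + log (Fintype.card ι) / β := by
  have hc : (1 : ℝ) ≤ Fintype.card ι := by exact_mod_cast Fintype.card_pos
  have hl : 0 ≤ log (Fintype.card ι) / β := div_nonneg (log_nonneg hc) hβ.le
  refine abs_le.2 ⟨?_, softmax_le β hβ x m fun i => (abs_le.1 (h i)).2⟩
  obtain ⟨i⟩ := ‹Nonempty ι›
  linarith [le_softmax β hβ x i, (abs_le.1 (h i)).1]

end Softmax

section Comparison

variable {E : Type*}
  [NormedAddCommGroup E] [InnerProductSpace ℝ E] [FiniteDimensional ℝ E] [MeasurableSpace E]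
  [BorelSpace E] {ι : Type*} [Fintype ι] [Nonempty ι]

theorem hasDerivAt_integral_softmax (β : ℝ) (hβ : 0 < β) (v v' : ℝ → ι → E) (c : ι → ℝ) (R : ℝ)
    (hv : ∀ t i, HasDerivAt (fun t => v t i) (v' t i) t) (hR : ∀ t i, ‖v t i‖ ≤ R)
    (hR' : ∀ t i, ‖v' t i‖ ≤ R) (t : ℝ) :
    HasDerivAt (fun t => ∫ w, softmax β (fun i => ⟪v t i, w⟫ + c i) ∂(gauss E))
      (∑ i, ∫ w, β * gibbs β (fun i => ⟪v t i, w⟫ + c i) i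
        * (⟪v t i, v' t i⟫ - ∑ j, gibbs β (fun i => ⟪v t i, w⟫ + c i) j * ⟪v t j, v' t i⟫)
          ∂(gauss E)) t := by
  have hcont : ∀ t, Continuous fun w : E => fun i => ⟪v t i, w⟫ + c i := fun t => by fun_prop
  have h1 : HasDerivAt (fun t => ∫ w, softmax β (fun i => ⟪v t i, w⟫ + c i) ∂(gauss E))
      (∫ w, ∑ i, gibbs β (fun i => ⟪v t i, w⟫ + c i) i * ⟪v' t i, w⟫ ∂(gauss E)) t := by
    refine (hasDerivAt_integral_of_dominated_loc_of_deriv_le (s := Set.univ)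
      (F' := fun t w => ∑ i, gibbs β (fun i => ⟪v t i, w⟫ + c i) i * ⟪v' t i, w⟫)
      (bound := fun w => R * ‖w‖) univ_mem ?_ ?_ ?_ ?_ ?_ ?_).2
    · exact Eventually.of_forall fun t =>
        ((continuous_softmax β).comp (hcont t)).aestronglyMeasurable
    · obtain ⟨m, hm⟩ : ∃ m, ∀ i, |c i| ≤ m := ⟨∑ i, |c i|, fun i =>
        Finset.single_le_sum (f := fun i => |c i|) (fun _ _ => abs_nonneg _) (Finset.mem_univ i)⟩
      refine ((integrable_norm_gauss.const_mul R).add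
        (integrable_const (m + log (Fintype.card ι) / β))).mono'
        ((continuous_softmax β).comp (hcont t)).aestronglyMeasurable (ae_of_all _ fun w => ?_)
      have := abs_softmax_le β hβ (fun i => ⟪v t i, w⟫ + c i) (R * ‖w‖ + m) fun i => by
        refine (abs_add_le _ _).trans (add_le_add ?_ (hm i))
        exact (abs_real_inner_le_norm _ _).trans (by gcongr; exact hR t i)
      simp only [norm_eq_abs, Pi.add_apply]
      linarith
    · refine Continuous.aestronglyMeasurable ?_
      refine continuous_finsetSum _ fun i _ => ?_
      exact ((continuous_gibbs β i).comp (hcont t)).mul (by fun_prop)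
    · refine ae_of_all _ fun w t _ => ?_
      refine (norm_sum_le _ _).trans ?_
      calc ∑ i, ‖gibbs β (fun i => ⟪v t i, w⟫ + c i) i * ⟪v' t i, w⟫‖
          ≤ ∑ i, gibbs β (fun i => ⟪v t i, w⟫ + c i) i * (R * ‖w‖) := by
            refine Finset.sum_le_sum fun i _ => ?_
            rw [norm_mul, norm_of_nonneg (gibbs_nonneg _ _ _)]
            refine mul_le_mul_of_nonneg_left ?_ (gibbs_nonneg _ _ _)
            exact (abs_real_inner_le_norm _ _).trans (by gcongr; exact hR' t i)
        _ = R * ‖w‖ := by rw [← Finset.sum_mul, sum_gibbs, one_mul]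
    · exact integrable_norm_gauss.const_mul R
    · refine ae_of_all _ fun w t _ => ?_
      refine hasDerivAt_softmax β hβ.ne' (fun t i => ⟪v t i, w⟫ + c i) (fun i => ⟪v' t i, w⟫) t
        fun i => ?_
      have := ((hv t i).inner ℝ (hasDerivAt_const t w)).add_const (c i)
      simpa using this
  convert h1 using 1
  rw [integral_finsetSum]
  · refine Finset.sum_congr rfl fun i _ => ?_
    have := integral_inner_mul_gauss (v' t i)
      (fun w => gibbs β (fun i => ⟪v t i, w⟫ + c i) i)
      (fun w => β * gibbs β (fun i => ⟪v t i, w⟫ + c i) i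
        * (⟪v t i, v' t i⟫ - ∑ j, gibbs β (fun i => ⟪v t i, w⟫ + c i) j * ⟪v t j, v' t i⟫))
      ((continuous_gibbs β i).comp (hcont t)) ?_ 1
      (β * 1 * (|⟪v t i, v' t i⟫| + ∑ j, 1 * |⟪v t j, v' t i⟫|))
      (fun w => abs_gibbs_le_one _ _ _) ?_ ?_
    · rw [← this]
      simp only [mul_comm]
    · refine Continuous.mul (((continuous_gibbs β i).comp (hcont t)).const_mul β)
        (continuous_const.sub (continuous_finsetSum _ fun j _ => ?_))
      exact ((continuous_gibbs β j).comp (hcont t)).mul continuous_const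
    · intro w
      rw [abs_mul, abs_mul, abs_of_pos hβ]
      gcongr
      · exact abs_gibbs_le_one _ _ _
      · refine (abs_sub _ _).trans ?_
        gcongr
        refine (Finset.abs_sum_le_sum_abs _ _).trans (Finset.sum_le_sum fun j _ => ?_)
        rw [abs_mul]
        gcongr
        exact abs_gibbs_le_one _ _ _
    · intro w
      have := hasDerivAt_gibbs β (fun (s : ℝ) k => ⟪v t k, w + s • v' t i⟫ + c k)
        (fun j => ⟪v t j, v' t i⟫) 0 (fun j => ?_) i
      · simpa only [zero_smul, add_zero] using this
      · have h2 := ((hasDerivAt_const (0 : ℝ) (v t j)).inner ℝ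
          (((hasDerivAt_id (0 : ℝ)).smul_const (v' t i)).const_add w)).add_const (c j)
        simpa using h2
  · intro i _
    refine (integrable_norm_gauss.const_mul R).mono'
      (((continuous_gibbs β i).comp (hcont t)).mul (by fun_prop)).aestronglyMeasurable
      (ae_of_all _ fun w => ?_)
    rw [norm_mul, norm_eq_abs]
    calc |gibbs β (fun i => ⟪v t i, w⟫ + c i) i| * ‖⟪v' t i, w⟫‖ ≤ 1 * (R * ‖w‖) := by
          gcongr
          · exact abs_gibbs_le_one _ _ _
          · exact (abs_real_inner_le_norm _ _).trans (by gcongr; exact hR' t i)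
      _ = _ := one_mul _

/-- The maximum of finitely many reals. -/
def maxOf (x : ι → ℝ) : ℝ := Finset.univ.sup' Finset.univ_nonempty x

omit [Nonempty ι] in
theorem sum_gibbs_variance_nonneg (p : ι → ℝ) (hp : ∀ i, 0 ≤ p i) (h1 : ∑ i, p i = 1)
    (D : ι → ι → ℝ) (hD : ∀ i j, 0 ≤ D i i + D j j - D i j - D j i) :
    0 ≤ ∑ i, p i * (D i i - ∑ j, p j * D j i) := by
  have e1 : ∑ i, p i * D i i = ∑ i, ∑ j, p i * p j * D i i := by
    refine Finset.sum_congr rfl fun i _ => ?_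
    rw [← Finset.sum_mul, ← Finset.mul_sum, h1, mul_one]
  have e2 : ∑ i, p i * D i i = ∑ i, ∑ j, p i * p j * D j j := by
    rw [e1, Finset.sum_comm]
    simp only [mul_comm, mul_left_comm]
  have e3 : ∑ i, p i * ∑ j, p j * D j i = ∑ i, ∑ j, p i * p j * D j i := by
    simp only [Finset.mul_sum, mul_assoc]
  have e4 : ∑ i, p i * ∑ j, p j * D j i = ∑ i, ∑ j, p i * p j * D i j := by
    rw [e3, Finset.sum_comm]
    simp only [mul_comm, mul_left_comm]
  have : 0 ≤ ∑ i, ∑ j, p i * p j * (D i i + D j j - D i j - D j i) :=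
    Finset.sum_nonneg fun i _ => Finset.sum_nonneg fun j _ =>
      mul_nonneg (mul_nonneg (hp i) (hp j)) (hD i j)
  simp only [mul_sub, mul_add, Finset.sum_sub_distrib, Finset.sum_add_distrib] at this ⊢
  linarith

theorem le_maxOf (x : ι → ℝ) (i : ι) : x i ≤ maxOf x := Finset.le_sup' x (Finset.mem_univ i)

theorem maxOf_le (x : ι → ℝ) (m : ℝ) (h : ∀ i, x i ≤ m) : maxOf x ≤ m :=
  Finset.sup'_le _ _ fun i _ => h i

theorem continuous_maxOf : Continuous fun x : ι → ℝ => maxOf x :=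
  Continuous.finset_sup'_apply _ fun i _ => continuous_apply i

theorem integrable_maxOf (v : ι → E) (c : ι → ℝ) :
    Integrable (fun w => maxOf fun i => ⟪v i, w⟫ + c i) (gauss E) := by
  refine ((integrable_norm_gauss.const_mul (∑ i, ‖v i‖)).add
    (integrable_const (∑ i, |c i|))).mono'
    (continuous_maxOf.comp (by fun_prop :
      Continuous fun w : E => fun i => ⟪v i, w⟫ + c i)).aestronglyMeasurable (ae_of_all _ fun w => ?_)
  have hb : ∀ i, |⟪v i, w⟫ + c i| ≤ (∑ i, ‖v i‖) * ‖w‖ + ∑ i, |c i| := fun i => by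
    refine (abs_add_le _ _).trans (add_le_add ?_ (Finset.single_le_sum (f := fun i => |c i|)
      (fun _ _ => abs_nonneg _) (Finset.mem_univ i)))
    refine (abs_real_inner_le_norm _ _).trans ?_
    gcongr
    exact Finset.single_le_sum (f := fun i => ‖v i‖) (fun _ _ => norm_nonneg _) (Finset.mem_univ i)
  simp only [norm_eq_abs, Pi.add_apply]
  obtain ⟨i⟩ := ‹Nonempty ι›
  refine abs_le.2 ⟨?_, maxOf_le _ _ fun j => (abs_le.1 (hb j)).2⟩
  exact (abs_le.1 (hb i)).1.trans (le_maxOf (fun i => ⟪v i, w⟫ + c i) i)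

/-- The Sudakov–Fernique comparison inequality, with deterministic shifts, for two families in
mutually orthogonal position. -/
theorem integral_maxOf_le (a b : ι → E) (c : ι → ℝ) (h0 : ∀ i j, ⟪a i, b j⟫ = 0)
    (hd : ∀ i j, ‖a i - a j‖ ^ 2 ≤ ‖b i - b j‖ ^ 2) :
    ∫ w, maxOf (fun i => ⟪a i, w⟫ + c i) ∂(gauss E)
      ≤ ∫ w, maxOf (fun i => ⟪b i, w⟫ + c i) ∂(gauss E) := by
  have h0' : ∀ i j, ⟪b i, a j⟫ = 0 := fun i j => by rw [real_inner_comm]; exact h0 j i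
  set R := ∑ i, (‖a i‖ + ‖b i‖) with hRdef
  have hR : ∀ i, ‖a i‖ + ‖b i‖ ≤ R := fun i =>
    Finset.single_le_sum (f := fun i => ‖a i‖ + ‖b i‖) (fun _ _ => by positivity)
      (Finset.mem_univ i)
  have hn : ∀ (x y : ℝ) i, |x| ≤ 1 → |y| ≤ 1 → ‖x • a i + y • b i‖ ≤ R := fun x y i hx hy => by
    refine (norm_add_le _ _).trans (le_trans ?_ (hR i))
    rw [norm_smul, norm_smul]
    exact add_le_add (mul_le_of_le_one_left (norm_nonneg _) hx)
      (mul_le_of_le_one_left (norm_nonneg _) hy)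
  have hsoft : ∀ β : ℝ, 0 < β → ∫ w, softmax β (fun i => ⟪a i, w⟫ + c i) ∂(gauss E)
      ≤ ∫ w, softmax β (fun i => ⟪b i, w⟫ + c i) ∂(gauss E) := by
    intro β hβ
    have hder := hasDerivAt_integral_softmax (E := E) β hβ
      (fun t i => cos t • a i + sin t • b i) (fun t i => (-sin t) • a i + cos t • b i) c R
      (fun t i => ((hasDerivAt_cos t).smul_const (a i)).add ((hasDerivAt_sin t).smul_const (b i)))
      (fun t i => hn _ _ _ (abs_cos_le_one t) (abs_sin_le_one t))
      (fun t i => hn _ _ _ (by rw [abs_neg]; exact abs_sin_le_one t) (abs_cos_le_one t))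
    set Ψ : ℝ → ℝ := fun t =>
      ∫ w, softmax β (fun i => ⟪cos t • a i + sin t • b i, w⟫ + c i) ∂(gauss E) with hΨ
    have hmono : MonotoneOn Ψ (Set.Icc 0 (Real.pi / 2)) := by
      refine monotoneOn_of_deriv_nonneg (convex_Icc _ _)
        (fun t _ => (hder t).continuousAt.continuousWithinAt)
        (fun t _ => (hder t).differentiableAt.differentiableWithinAt) fun t ht => ?_
      rw [interior_Icc] at ht
      rw [(hder t).deriv, ← integral_finsetSum]
      · refine integral_nonneg fun w => ?_
        set p := gibbs β fun i => ⟪cos t • a i + sin t • b i, w⟫ + c i with hp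
        have hsc : 0 ≤ sin t * cos t := mul_nonneg
          (sin_nonneg_of_nonneg_of_le_pi ht.1.le (by linarith [ht.2, Real.pi_pos]))
          (cos_nonneg_of_neg_pi_div_two_le_of_le (by linarith [ht.1, Real.pi_pos]) ht.2.le)
        have := sum_gibbs_variance_nonneg p (gibbs_nonneg _ _) (sum_gibbs _ _)
          (fun j i => ⟪cos t • a j + sin t • b j, (-sin t) • a i + cos t • b i⟫) fun i j => by
            have e : ∀ j i, ⟪cos t • a j + sin t • b j, (-sin t) • a i + cos t • b i⟫
                = sin t * cos t * (⟪b j, b i⟫ - ⟪a j, a i⟫) := fun j i => by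
              simp only [inner_add_left, inner_add_right, real_inner_smul_left,
                real_inner_smul_right, h0, h0']
              ring
            simp only [e]
            have h2 := hd i j
            rw [norm_sub_sq_real, norm_sub_sq_real, ← real_inner_self_eq_norm_sq,
              ← real_inner_self_eq_norm_sq, ← real_inner_self_eq_norm_sq,
              ← real_inner_self_eq_norm_sq] at h2
            rw [real_inner_comm (b i) (b j), real_inner_comm (a i) (a j)]
            nlinarith [mul_nonneg hsc (sub_nonneg.2 h2)]
        simp only [Pi.zero_apply, mul_assoc]
        rw [← Finset.mul_sum]
        exact mul_nonneg hβ.le this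
      · intro i _
        refine Integrable.of_bound (C := β * 1 * (|⟪cos t • a i + sin t • b i,
          (-sin t) • a i + cos t • b i⟫| + ∑ j, 1 * |⟪cos t • a j + sin t • b j,
          (-sin t) • a i + cos t • b i⟫|)) ?_ (ae_of_all _ fun w => ?_)
        · have hcont : Continuous fun w : E => fun i => ⟪cos t • a i + sin t • b i, w⟫ + c i := by
            fun_prop
          refine Continuous.aestronglyMeasurable ?_
          refine Continuous.mul (((continuous_gibbs β i).comp hcont).const_mul β)
            (continuous_const.sub (continuous_finsetSum _ fun j _ => ?_))
          exact ((continuous_gibbs β j).comp hcont).mul continuous_const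
        · rw [norm_eq_abs, abs_mul, abs_mul, abs_of_pos hβ]
          gcongr
          · exact abs_gibbs_le_one _ _ _
          · refine (abs_sub _ _).trans ?_
            gcongr
            refine (Finset.abs_sum_le_sum_abs _ _).trans (Finset.sum_le_sum fun j _ => ?_)
            rw [abs_mul]
            gcongr
            exact abs_gibbs_le_one _ _ _
    have := hmono (Set.left_mem_Icc.2 (by positivity)) (Set.right_mem_Icc.2 (by positivity))
      (by positivity : (0 : ℝ) ≤ Real.pi / 2)
    simpa [hΨ] using this
  have hint : ∀ (β : ℝ) (v : ι → E), 0 < β →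
      Integrable (fun w => softmax β (fun i => ⟪v i, w⟫ + c i)) (gauss E) := fun β v hβ => by
    refine ((integrable_maxOf v c).norm.add (integrable_const (log (Fintype.card ι) / β))).mono'
      ((continuous_softmax β).comp (by fun_prop :
        Continuous fun w : E => fun i => ⟪v i, w⟫ + c i)).aestronglyMeasurable
      (ae_of_all _ fun w => ?_)
    have hc : (1 : ℝ) ≤ Fintype.card ι := by exact_mod_cast Fintype.card_pos
    have hl : 0 ≤ log (Fintype.card ι) / β := div_nonneg (log_nonneg hc) hβ.le
    have h1 := softmax_le β hβ (fun i => ⟪v i, w⟫ + c i) _ (le_maxOf _)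
    have h2 := maxOf_le _ _ (le_softmax β hβ (fun i => ⟪v i, w⟫ + c i))
    simp only [norm_eq_abs, Pi.add_apply]
    refine abs_le.2 ⟨?_, ?_⟩
    · linarith [neg_abs_le (maxOf fun i => ⟪v i, w⟫ + c i)]
    · linarith [le_abs_self (maxOf fun i => ⟪v i, w⟫ + c i)]
  have key : ∀ β : ℝ, 0 < β → ∫ w, maxOf (fun i => ⟪a i, w⟫ + c i) ∂(gauss E)
      ≤ ∫ w, maxOf (fun i => ⟪b i, w⟫ + c i) ∂(gauss E) + log (Fintype.card ι) / β := by
    intro β hβ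
    calc ∫ w, maxOf (fun i => ⟪a i, w⟫ + c i) ∂(gauss E)
        ≤ ∫ w, softmax β (fun i => ⟪a i, w⟫ + c i) ∂(gauss E) :=
          integral_mono (integrable_maxOf a c) (hint β a hβ) fun w =>
            maxOf_le _ _ (le_softmax β hβ _)
      _ ≤ _ := hsoft β hβ
      _ ≤ ∫ w, (maxOf (fun i => ⟪b i, w⟫ + c i) + log (Fintype.card ι) / β) ∂(gauss E) :=
          integral_mono (hint β b hβ) ((integrable_maxOf b c).add (integrable_const _)) fun w =>
            softmax_le β hβ _ _ (le_maxOf _)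
      _ = _ := by
          rw [integral_add (integrable_maxOf b c) (integrable_const _)]
          simp
  have hlim : Tendsto (fun β : ℝ => ∫ w, maxOf (fun i => ⟪b i, w⟫ + c i) ∂(gauss E)
      + log (Fintype.card ι) / β) atTop
      (nhds (∫ w, maxOf (fun i => ⟪b i, w⟫ + c i) ∂(gauss E) + 0)) :=
    tendsto_const_nhds.add (tendsto_const_nhds.div_atTop tendsto_id)
  rw [add_zero] at hlim
  exact ge_of_tendsto hlim ((eventually_gt_atTop 0).mono key)

end Comparison

section Coisometry

variable {E F : Type*}
  [NormedAddCommGroup E] [InnerProductSpace ℝ E] [FiniteDimensional ℝ E] [MeasurableSpace E]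
  [BorelSpace E]
  [NormedAddCommGroup F] [InnerProductSpace ℝ F] [FiniteDimensional ℝ F] [MeasurableSpace F]
  [BorelSpace F]

/-- A coisometry maps the standard Gaussian measure to the standard Gaussian measure. -/
theorem gauss_map_coisometry (A : F →L[ℝ] E) (A' : E → F) (hA : ∀ x t, ⟪A x, t⟫ = ⟪x, A' t⟫)
    (h : ∀ t, ‖A' t‖ = ‖t‖) : (gauss F).map A = gauss E := by
  have : IsProbabilityMeasure ((gauss F).map A) :=
    Measure.isProbabilityMeasure_map A.continuous.aemeasurable
  apply Measure.ext_of_charFun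
  ext t
  rw [charFun_map_gauss A A' hA, ProbabilityTheory.charFun_stdGaussian, h]

theorem gauss_map_inner (e : E) (he : ‖e‖ = 1) : (gauss E).map (fun z => ⟪e, z⟫) = gauss ℝ :=
  gauss_map_coisometry (innerSL ℝ e) (fun t : ℝ => t • e)
    (fun x t => by simp [inner_smul_right, real_inner_comm])
    (fun t => by rw [norm_smul, he, mul_one])

theorem integral_inner_sq_gauss (e : E) (he : ‖e‖ = 1) : ∫ z, ⟪e, z⟫ ^ 2 ∂(gauss E) = 1 := by
  rw [← integral_sq_gaussianReal_std, ← gauss_real, ← gauss_map_inner e he,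
    integral_map (by fun_prop) (by fun_prop)]

theorem integrable_inner_sq_gauss (e : E) : Integrable (fun z => ⟪e, z⟫ ^ 2) (gauss E) := by
  refine ((integrable_norm_pow_gauss 2).const_mul (‖e‖ ^ 2)).mono'
    (by fun_prop) (ae_of_all _ fun z => ?_)
  rw [norm_of_nonneg (sq_nonneg _), ← sq_abs, ← mul_pow]
  gcongr
  exact abs_real_inner_le_norm _ _

theorem integral_abs_inner_gauss_le (e : E) (he : ‖e‖ = 1) : ∫ z, |⟪e, z⟫| ∂(gauss E) ≤ 1 := by
  calc ∫ z, |⟪e, z⟫| ∂(gauss E) ≤ ∫ z, (1 / 2 + 1 / 2 * ⟪e, z⟫ ^ 2) ∂(gauss E) := by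
        refine integral_mono (integrable_inner_gauss e).abs
          ((integrable_const _).add ((integrable_inner_sq_gauss e).const_mul _)) fun z => ?_
        simp only
        rw [← sq_abs]
        nlinarith [sq_nonneg (|⟪e, z⟫| - 1)]
    _ = 1 := by
        rw [integral_add (integrable_const _) ((integrable_inner_sq_gauss e).const_mul _),
          integral_const_mul, integral_inner_sq_gauss e he]
        norm_num

variable {ι : Type*} [Fintype ι] [Nonempty ι]

/-- The Sudakov–Fernique comparison inequality, with deterministic shifts. -/
theorem integral_maxOf_le_integral_maxOf (a : ι → E) (b : ι → F) (c : ι → ℝ)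
    (hd : ∀ i j, ‖a i - a j‖ ^ 2 ≤ ‖b i - b j‖ ^ 2) :
    ∫ w, maxOf (fun i => ⟪a i, w⟫ + c i) ∂(gauss E)
      ≤ ∫ w, maxOf (fun i => ⟪b i, w⟫ + c i) ∂(gauss F) := by
  have h := integral_maxOf_le (E := WithLp 2 (E × F)) (fun i => WithLp.toLp 2 (a i, 0))
    (fun i => WithLp.toLp 2 (0, b i)) c (fun i j => by simp)
    (fun i j => by
      have := hd i j
      rw [← WithLp.toLp_sub, ← WithLp.toLp_sub, WithLp.prod_norm_sq_eq_of_L2,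
        WithLp.prod_norm_sq_eq_of_L2]
      simpa using this)
  have hE : (gauss (WithLp 2 (E × F))).map (WithLp.fstL 2 ℝ E F) = gauss E :=
    gauss_map_coisometry _ (fun t => WithLp.toLp 2 (t, 0)) (fun x t => by simp)
      (fun t => by simp)
  have hF : (gauss (WithLp 2 (E × F))).map (WithLp.sndL 2 ℝ E F) = gauss F :=
    gauss_map_coisometry _ (fun t => WithLp.toLp 2 (0, t)) (fun x t => by simp)
      (fun t => by simp)
  rw [← hE, ← hF, integral_map, integral_map]
  · simpa using h
  · exact (ContinuousLinearMap.continuous _).aemeasurable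
  · exact (continuous_maxOf.comp (by fun_prop :
        Continuous fun w : F => fun i => ⟪b i, w⟫ + c i)).aestronglyMeasurable
  · exact (ContinuousLinearMap.continuous _).aemeasurable
  · exact (continuous_maxOf.comp (by fun_prop :
        Continuous fun w : E => fun i => ⟪a i, w⟫ + c i)).aestronglyMeasurable

end Coisometry

section Tensor

/-- Euclidean space. -/
abbrev Vec (p : ℕ) := EuclideanSpace ℝ (Fin p)

/-- Matrices with the Euclidean (Frobenius) norm. -/
abbrev Mat (p q : ℕ) := EuclideanSpace ℝ (Fin p × Fin q)

/-- The rank-one matrix `u vᵀ`. -/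
def tens {p q : ℕ} (u : Vec p) (v : Vec q) : Mat p q := WithLp.toLp 2 fun x => u x.1 * v x.2

variable {p q : ℕ}

theorem tens_apply (u : Vec p) (v : Vec q) (x : Fin p × Fin q) : tens u v x = u x.1 * v x.2 := rfl

theorem inner_tens (u u' : Vec p) (v v' : Vec q) :
    ⟪tens u v, tens u' v'⟫ = ⟪u, u'⟫ * ⟪v, v'⟫ := by
  simp only [PiLp.inner_apply, tens_apply, Fintype.sum_prod_type, Finset.sum_mul_sum]
  refine Finset.sum_congr rfl fun i _ => Finset.sum_congr rfl fun j _ => ?_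
  simp
  ring

theorem norm_tens (u : Vec p) (v : Vec q) : ‖tens u v‖ = ‖u‖ * ‖v‖ := by
  have h : ‖tens u v‖ ^ 2 = (‖u‖ * ‖v‖) ^ 2 := by
    rw [← real_inner_self_eq_norm_sq, inner_tens, real_inner_self_eq_norm_sq,
      real_inner_self_eq_norm_sq, mul_pow]
  exact (sq_eq_sq₀ (norm_nonneg _) (by positivity)).1 h

theorem tens_sub_left (u u' : Vec p) (v : Vec q) : tens (u - u') v = tens u v - tens u' v := by
  ext x; simp [tens_apply, sub_mul]

theorem tens_sub_right (u : Vec p) (v v' : Vec q) : tens u (v - v') = tens u v - tens u v' := by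
  ext x; simp [tens_apply, mul_sub]

theorem tens_smul_left (c : ℝ) (u : Vec p) (v : Vec q) : tens (c • u) v = c • tens u v := by
  ext x; simp [tens_apply, mul_assoc]

theorem tens_smul_right (c : ℝ) (u : Vec p) (v : Vec q) : tens u (c • v) = c • tens u v := by
  ext x; simp [tens_apply, mul_left_comm]

theorem continuous_tens : Continuous fun x : Vec p × Vec q => tens x.1 x.2 := by
  unfold tens
  fun_prop

/-- A linear functional on unit vectors is controlled by the overlap with a given direction. -/
theorem inner_le_of_norm_one {E : Type*} [NormedAddCommGroup E] [InnerProductSpace ℝ E]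
    (U u g : E) (hU : ‖U‖ = 1) (hu : ‖u‖ = 1) (t : ℝ) (ht : 0 < t) :
    ⟪u, g⟫ ≤ |⟪U, g⟫| + (‖g‖ ^ 2 / t + t * (1 - ⟪U, u⟫ ^ 2)) / 2 := by
  set x := ⟪U, u⟫ with hx
  have hx1 : |x| ≤ 1 := by
    have := abs_real_inner_le_norm U u
    rwa [hU, hu, one_mul] at this
  have hn : ‖u - x • U‖ ^ 2 = 1 - x ^ 2 := by
    rw [norm_sub_sq_real, norm_smul, hU, hu, inner_smul_right, real_inner_comm U u, ← hx]
    simp; ring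
  have h1 : ⟪u, g⟫ = x * ⟪U, g⟫ + ⟪u - x • U, g⟫ := by
    rw [inner_sub_left, real_inner_smul_left]; ring
  have h2 : x * ⟪U, g⟫ ≤ |⟪U, g⟫| := by
    refine (le_abs_self _).trans ?_
    rw [abs_mul]
    exact mul_le_of_le_one_left (abs_nonneg _) hx1
  have h3 : ⟪u - x • U, g⟫ ≤ (‖g‖ ^ 2 / t + t * (1 - x ^ 2)) / 2 := by
    refine (real_inner_le_norm _ _).trans ?_
    rw [← hn, le_div_iff₀ two_pos, ← sub_nonneg]
    have : ‖g‖ ^ 2 / t + t * ‖u - x • U‖ ^ 2 - ‖u - x • U‖ * ‖g‖ * 2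
        = (‖g‖ - t * ‖u - x • U‖) ^ 2 / t := by
      field_simp; ring
    rw [this]; positivity
  linarith

theorem integral_dominating_le {d : ℕ} (U : Vec d) (hU : ‖U‖ = 1) (t : ℝ) :
    Integrable (fun g => |⟪U, g⟫| + ‖g‖ ^ 2 / t / 2 + t / 2) (gauss (Vec d)) ∧
      ∫ g, (|⟪U, g⟫| + ‖g‖ ^ 2 / t / 2 + t / 2) ∂(gauss (Vec d)) ≤ 1 + d / t / 2 + t / 2 := by
  have hsq : ∫ g, ‖g‖ ^ 2 ∂(gauss (Vec d)) = d := by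
    have := integral_norm_add_sq_gauss (0 : Vec d)
    simpa using this
  have i1 : Integrable (fun g : Vec d => ‖g‖ ^ 2 / t / 2) (gauss (Vec d)) :=
    ((integrable_norm_pow_gauss 2).div_const _).div_const _
  have i2 : Integrable (fun g : Vec d => |⟪U, g⟫| + ‖g‖ ^ 2 / t / 2) (gauss (Vec d)) :=
    (integrable_inner_gauss U).abs.add i1
  refine ⟨i2.add (integrable_const _), ?_⟩
  rw [integral_add i2 (integrable_const _), integral_add (integrable_inner_gauss U).abs i1,
    integral_div, integral_div, hsq]
  have := integral_abs_inner_gauss_le U hU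
  simp; linarith

variable {ι : Type*} [Fintype ι] [Nonempty ι]

/-- Upper bound for the largest value of the spiked bilinear form over finitely many pairs of unit
vectors. -/
theorem integral_maxOf_spiked_le (U : Vec p) (V : Vec q) (hU : ‖U‖ = 1) (hV : ‖V‖ = 1)
    (u : ι → Vec p) (v : ι → Vec q) (hu : ∀ i, ‖u i‖ = 1) (hv : ∀ i, ‖v i‖ = 1)
    (s : ℝ) (hs : 0 < s) :
    ∫ z, maxOf (fun i => ⟪tens (u i) (v i), z + s • tens U V⟫) ∂(gauss (Mat p q))
      ≤ √((p + s ^ 2) * (q + s ^ 2)) / s + 2 := by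
  have h1 := integral_maxOf_le_integral_maxOf (fun i => tens (u i) (v i))
    (fun i => WithLp.toLp 2 (u i, v i)) (fun i => s * (⟪U, u i⟫ * ⟪V, v i⟫)) (fun i j => by
      have hu' : ⟪u i, u j⟫ ≤ 1 := by
        have := real_inner_le_norm (u i) (u j); rwa [hu, hu, one_mul] at this
      have hv' : ⟪v i, v j⟫ ≤ 1 := by
        have := real_inner_le_norm (v i) (v j); rwa [hv, hv, one_mul] at this
      rw [WithLp.prod_norm_sq_eq_of_L2]
      change _ ≤ ‖u i - u j‖ ^ 2 + ‖v i - v j‖ ^ 2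
      rw [norm_sub_sq_real, norm_sub_sq_real (u i), norm_sub_sq_real (v i), inner_tens, norm_tens,
        norm_tens, hu, hu, hv, hv]
      nlinarith [mul_nonneg (sub_nonneg.2 hu') (sub_nonneg.2 hv')])
  have e1 : ∀ z : Mat p q, (fun i => ⟪tens (u i) (v i), z + s • tens U V⟫)
      = fun i => ⟪tens (u i) (v i), z⟫ + s * (⟪U, u i⟫ * ⟪V, v i⟫) := fun z => by
    funext i
    rw [inner_add_right, inner_smul_right, inner_tens, real_inner_comm U, real_inner_comm V]
  simp only [e1]
  refine h1.trans ?_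
  have hE : (gauss (WithLp 2 (Vec p × Vec q))).map (WithLp.fstL 2 ℝ (Vec p) (Vec q))
      = gauss (Vec p) :=
    gauss_map_coisometry _ (fun t => WithLp.toLp 2 (t, 0)) (fun x t => by simp)
      (fun t => by simp)
  have hF : (gauss (WithLp 2 (Vec p × Vec q))).map (WithLp.sndL 2 ℝ (Vec p) (Vec q))
      = gauss (Vec q) :=
    gauss_map_coisometry _ (fun t => WithLp.toLp 2 (0, t)) (fun x t => by simp)
      (fun t => by simp)
  set m : ℝ := √((p + s ^ 2) / (q + s ^ 2)) with hm
  have hm0 : 0 < m := sqrt_pos.2 (by positivity)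
  set f : Vec p → ℝ := fun g => |⟪U, g⟫| + ‖g‖ ^ 2 / (s * m) / 2 + s * m / 2 with hf
  set f' : Vec q → ℝ := fun g => |⟪V, g⟫| + ‖g‖ ^ 2 / (s / m) / 2 + s / m / 2 with hf'
  obtain ⟨hfi, hI⟩ := integral_dominating_le U hU (s * m)
  obtain ⟨hfi', hI'⟩ := integral_dominating_le V hV (s / m)
  have hfi2 : Integrable (fun w => f (WithLp.fstL 2 ℝ (Vec p) (Vec q) w))
      (gauss (WithLp 2 (Vec p × Vec q))) := by
    rw [← hE] at hfi
    exact hfi.comp_aemeasurable (ContinuousLinearMap.continuous _).aemeasurable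
  have hfi2' : Integrable (fun w => f' (WithLp.sndL 2 ℝ (Vec p) (Vec q) w))
      (gauss (WithLp 2 (Vec p × Vec q))) := by
    rw [← hF] at hfi'
    exact hfi'.comp_aemeasurable (ContinuousLinearMap.continuous _).aemeasurable
  have hpt : ∀ w : WithLp 2 (Vec p × Vec q),
      maxOf (fun i => ⟪WithLp.toLp 2 (u i, v i), w⟫ + s * (⟪U, u i⟫ * ⟪V, v i⟫))
        ≤ f (WithLp.fstL 2 ℝ (Vec p) (Vec q) w) + f' (WithLp.sndL 2 ℝ (Vec p) (Vec q) w) := by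
    intro w
    refine maxOf_le _ _ fun i => ?_
    have a1 := inner_le_of_norm_one U (u i) w.fst hU (hu i) (s * m) (by positivity)
    have a2 := inner_le_of_norm_one V (v i) w.snd hV (hv i) (s / m) (by positivity)
    have a3 : s * (⟪U, u i⟫ * ⟪V, v i⟫) ≤ s * m * ⟪U, u i⟫ ^ 2 / 2 + s / m * ⟪V, v i⟫ ^ 2 / 2 := by
      rw [← sub_nonneg]
      have : s * m * ⟪U, u i⟫ ^ 2 / 2 + s / m * ⟪V, v i⟫ ^ 2 / 2 - s * (⟪U, u i⟫ * ⟪V, v i⟫)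
          = s / m / 2 * (m * ⟪U, u i⟫ - ⟪V, v i⟫) ^ 2 := by
        field_simp; ring
      rw [this]; positivity
    have a4 : ⟪WithLp.toLp 2 (u i, v i), w⟫ = ⟪u i, w.fst⟫ + ⟪v i, w.snd⟫ :=
      WithLp.prod_inner_apply _ _
    simp only [hf, hf', WithLp.fstL_apply, WithLp.sndL_apply]
    linarith
  calc _ ≤ ∫ w, (f (WithLp.fstL 2 ℝ (Vec p) (Vec q) w) + f' (WithLp.sndL 2 ℝ (Vec p) (Vec q) w))
          ∂(gauss (WithLp 2 (Vec p × Vec q))) :=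
        integral_mono (integrable_maxOf _ _) (hfi2.add hfi2') hpt
    _ = ∫ g, f g ∂(gauss (Vec p)) + ∫ g, f' g ∂(gauss (Vec q)) := by
        rw [integral_add hfi2 hfi2', ← hE, ← hF, integral_map, integral_map]
        · exact (ContinuousLinearMap.continuous _).aemeasurable
        · rw [hF]; exact hfi'.aestronglyMeasurable
        · exact (ContinuousLinearMap.continuous _).aemeasurable
        · rw [hE]; exact hfi.aestronglyMeasurable
    _ ≤ _ := add_le_add hI hI'
    _ = √((p + s ^ 2) * (q + s ^ 2)) / s + 2 := by
        have hP : (0 : ℝ) < p + s ^ 2 := by positivity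
        have hQ : (0 : ℝ) < q + s ^ 2 := by positivity
        have hm' : m = √(p + s ^ 2) / √(q + s ^ 2) := sqrt_div hP.le _
        have k1 := sq_sqrt hP.le
        have k2 := sq_sqrt hQ.le
        have k3 := sqrt_pos.2 hP
        have k4 := sqrt_pos.2 hQ
        rw [sqrt_mul hP.le, hm']
        set a := √(p + s ^ 2)
        set b := √(q + s ^ 2)
        have k5 : (p : ℝ) = a ^ 2 - s ^ 2 := by linarith
        have k6 : (q : ℝ) = b ^ 2 - s ^ 2 := by linarith
        rw [k5, k6]
        field_simp
        ring

end Tensor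

section Bil

variable {p q : ℕ}

theorem tens_zero_left (v : Vec q) : tens (0 : Vec p) v = 0 := by
  ext x; simp [tens_apply]

/-- The supremum of `⟨z, u ⊗ v⟩ + ⟨b, v⟩` over the product of the unit balls. -/
def bil (z : Mat p q) (b : Vec q) : ℝ :=
  ⨆ x : {x : Vec p × Vec q // ‖x.1‖ ≤ 1 ∧ ‖x.2‖ ≤ 1}, (⟪z, tens x.1.1 x.1.2⟫ + ⟪b, x.1.2⟫)

instance : Nonempty {x : Vec p × Vec q // ‖x.1‖ ≤ 1 ∧ ‖x.2‖ ≤ 1} :=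
  ⟨⟨(0, 0), by simp⟩⟩

theorem inner_tens_le (z : Mat p q) (u : Vec p) (v : Vec q) (hu : ‖u‖ ≤ 1) (hv : ‖v‖ ≤ 1) :
    ⟪z, tens u v⟫ ≤ ‖z‖ := by
  refine (real_inner_le_norm _ _).trans ?_
  rw [norm_tens]
  exact mul_le_of_le_one_right (norm_nonneg _) (mul_le_one₀ hu (norm_nonneg _) hv)

theorem inner_le_norm_of_le_one {E : Type*} [NormedAddCommGroup E] [InnerProductSpace ℝ E]
    (b v : E) (hv : ‖v‖ ≤ 1) : ⟪b, v⟫ ≤ ‖b‖ :=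
  (real_inner_le_norm _ _).trans (mul_le_of_le_one_right (norm_nonneg _) hv)

theorem bddAbove_bil (z : Mat p q) (b : Vec q) : BddAbove (Set.range
    fun x : {x : Vec p × Vec q // ‖x.1‖ ≤ 1 ∧ ‖x.2‖ ≤ 1} =>
      ⟪z, tens x.1.1 x.1.2⟫ + ⟪b, x.1.2⟫) := by
  refine ⟨‖z‖ + ‖b‖, ?_⟩
  rintro _ ⟨⟨⟨u, v⟩, hu, hv⟩, rfl⟩
  exact add_le_add (inner_tens_le z u v hu hv) (inner_le_norm_of_le_one b v hv)

theorem le_bil (z : Mat p q) (b : Vec q) (u : Vec p) (v : Vec q) (hu : ‖u‖ ≤ 1) (hv : ‖v‖ ≤ 1) :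
    ⟪z, tens u v⟫ + ⟪b, v⟫ ≤ bil z b :=
  le_ciSup (bddAbove_bil z b) ⟨(u, v), hu, hv⟩

theorem bil_le (z : Mat p q) (b : Vec q) (m : ℝ)
    (h : ∀ u v, ‖u‖ ≤ 1 → ‖v‖ ≤ 1 → ⟪z, tens u v⟫ + ⟪b, v⟫ ≤ m) : bil z b ≤ m :=
  ciSup_le fun x => h _ _ x.2.1 x.2.2

theorem bil_nonneg (z : Mat p q) (b : Vec q) : 0 ≤ bil z b := by
  simpa [tens_zero_left] using le_bil z b 0 0 (by simp) (by simp)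

theorem abs_bil_le (z : Mat p q) (b : Vec q) : |bil z b| ≤ ‖z‖ + ‖b‖ := by
  rw [abs_of_nonneg (bil_nonneg z b)]
  exact bil_le z b _ fun u v hu hv =>
    add_le_add (inner_tens_le z u v hu hv) (inner_le_norm_of_le_one b v hv)

theorem norm_le_bil (z : Mat p q) (b : Vec q) : ‖b‖ ≤ bil z b := by
  rcases eq_or_ne b 0 with rfl | hb
  · simpa using bil_nonneg z 0
  have hb' : ‖b‖ ≠ 0 := norm_ne_zero_iff.2 hb
  have h1 : ‖(‖b‖⁻¹ • b : Vec q)‖ ≤ 1 := by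
    rw [norm_smul, norm_inv, norm_norm, inv_mul_cancel₀ hb']
  have := le_bil z b 0 (‖b‖⁻¹ • b) (by simp) h1
  have e : ⟪z, tens (0 : Vec p) (‖b‖⁻¹ • b)⟫ = 0 := by
    rw [tens_zero_left, inner_zero_right]
  rw [e, inner_smul_right, real_inner_self_eq_norm_sq] at this
  field_simp at this
  linarith

theorem bil_le_add (z z' : Mat p q) (b b' : Vec q) : bil z b ≤ bil z' b' + ‖z - z'‖ + ‖b - b'‖ := by
  refine bil_le z b _ fun u v hu hv => ?_
  have h1 := le_bil z' b' u v hu hv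
  have h2 := inner_tens_le (z - z') u v hu hv
  have h3 := inner_le_norm_of_le_one (b - b') v hv
  rw [inner_sub_left] at h2 h3
  linarith

theorem continuous_bil : Continuous fun x : Mat p q × Vec q => bil x.1 x.2 := by
  refine (LipschitzWith.of_le_add_mul 2 (f := fun x : Mat p q × Vec q => bil x.1 x.2)
    fun x y => ?_).continuous
  have h1 := bil_le_add x.1 y.1 x.2 y.2
  have h2 : ‖x.1 - y.1‖ ≤ dist x y := by rw [← dist_eq_norm]; exact le_max_left _ _
  have h3 : ‖x.2 - y.2‖ ≤ dist x y := by rw [← dist_eq_norm]; exact le_max_right _ _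
  simp only [NNReal.coe_ofNat]
  linarith

theorem continuous_bil_comp {X : Type*} [TopologicalSpace X] {f : X → Mat p q} {g : X → Vec q}
    (hf : Continuous f) (hg : Continuous g) : Continuous fun y => bil (f y) (g y) :=
  continuous_bil.comp (hf.prodMk hg)

end Bil

section Decomposition

variable {p q : ℕ}

/-- Decomposition of a Gaussian matrix along a unit vector of its row space. -/
theorem exists_gauss_decomposition (e : Vec (q + 1)) (he : ‖e‖ = 1) :
    ∃ (A : Vec p →L[ℝ] Mat p (q + 1)) (B : Mat q p →L[ℝ] Mat p (q + 1))
      (f : ℝ → Vec q → Vec (q + 1)),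
      ((gauss (Vec p)).prod (gauss (Mat q p))).map (fun x => A x.1 + B x.2)
        = gauss (Mat p (q + 1)) ∧
      (∀ x w, ‖f x w‖ ^ 2 = x ^ 2 + ‖w‖ ^ 2) ∧ (∀ x w, ⟪e, f x w⟫ = x) ∧
      (∀ a u x w, ⟪A a, tens u (f x w)⟫ = x * ⟪a, u⟫) ∧
      (∀ z u x w, ⟪B z, tens u (f x w)⟫ = ⟪z, tens w u⟫) := by
  have hon : Orthonormal ℝ (({0} : Set (Fin (q + 1))).domRestrict fun _ => e) := by
    refine ⟨fun i => he, fun i j hij => ?_⟩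
    exact absurd (Subsingleton.elim i j) hij
  obtain ⟨bs, hbs⟩ := hon.exists_orthonormalBasis_extension_of_card_eq (by simp)
  have hb0 : bs 0 = e := hbs 0 rfl
  set A' : Mat p (q + 1) → Vec p := fun t => WithLp.toLp 2 fun i => ∑ j, t (i, j) * e j with hA'
  set B' : Mat p (q + 1) → Mat q p := fun t =>
    WithLp.toLp 2 fun x => ∑ j, t (x.2, j) * bs x.1.succ j with hB'
  let A : Vec p →L[ℝ] Mat p (q + 1) := LinearMap.toContinuousLinearMap
    { toFun := fun a => tens a e
      map_add' := fun a b => by ext x; simp [tens_apply, add_mul]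
      map_smul' := fun c a => tens_smul_left c a e }
  let B : Mat q p →L[ℝ] Mat p (q + 1) := LinearMap.toContinuousLinearMap
    { toFun := fun z => WithLp.toLp 2 fun x => ∑ k : Fin q, z (k, x.1) * bs k.succ x.2
      map_add' := fun a b => by ext x; simp [add_mul, Finset.sum_add_distrib]
      map_smul' := fun c a => by ext x; simp [Finset.mul_sum, mul_assoc] }
  have hA : ∀ a t, ⟪A a, t⟫ = ⟪a, A' t⟫ := fun a t => by
    change ⟪tens a e, t⟫ = _
    simp only [PiLp.inner_apply, tens_apply, hA', Fintype.sum_prod_type, RCLike.inner_apply,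
      conj_trivial, Finset.sum_mul]
    refine Finset.sum_congr rfl fun i _ => Finset.sum_congr rfl fun j _ => by ring
  have hB : ∀ z t, ⟪B z, t⟫ = ⟪z, B' t⟫ := fun z t => by
    have hBa : ∀ x, B z x = ∑ k : Fin q, z (k, x.1) * bs k.succ x.2 := fun x => rfl
    simp only [PiLp.inner_apply, hBa, hB', Fintype.sum_prod_type, RCLike.inner_apply,
      conj_trivial, Finset.mul_sum, Finset.sum_mul]
    have e1 : ∀ i : Fin p, ∑ j : Fin (q + 1), ∑ k : Fin q, t (i, j) * (z (k, i) * bs k.succ j)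
        = ∑ k : Fin q, ∑ j : Fin (q + 1), t (i, j) * (z (k, i) * bs k.succ j) :=
      fun i => Finset.sum_comm
    simp only [e1]
    rw [Finset.sum_comm]
    refine Finset.sum_congr rfl fun i _ => Finset.sum_congr rfl fun j _ =>
      Finset.sum_congr rfl fun k _ => by ring
  have hnorm : ∀ t, ‖A' t‖ ^ 2 + ‖B' t‖ ^ 2 = ‖t‖ ^ 2 := fun t => by
    have row : ∀ i : Fin p, (∑ j, t (i, j) * e j) ^ 2
        + ∑ k : Fin q, (∑ j, t (i, j) * bs k.succ j) ^ 2 = ∑ j, t (i, j) ^ 2 := fun i => by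
      have h := bs.sum_sq_norm_inner_right (WithLp.toLp 2 fun j => t (i, j))
      rw [Fin.sum_univ_succ, hb0, EuclideanSpace.norm_sq_eq] at h
      simpa [PiLp.inner_apply] using h
    simp only [EuclideanSpace.norm_sq_eq, hA', hB', Fintype.sum_prod_type, norm_eq_abs, sq_abs]
    rw [Finset.sum_comm (s := (Finset.univ : Finset (Fin q))), ← Finset.sum_add_distrib]
    exact Finset.sum_congr rfl fun i _ => row i
  let f : ℝ → Vec q → Vec (q + 1) := fun x w =>
    bs.repr.symm (WithLp.toLp 2 (Fin.cons x (fun k => w k)))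
  have hf : ∀ x w k, ⟪bs k, f x w⟫ = (Fin.cons x (fun k => w k) : Fin (q + 1) → ℝ) k := fun x w k => by
    rw [← bs.repr_apply_apply]
    simp [f]
  have hA't : ∀ u x w, A' (tens u (f x w)) = x • u := fun u x w => by
    have h := hf x w 0
    rw [hb0, Fin.cons_zero] at h
    ext i
    simp only [hA', tens_apply, PiLp.smul_apply, smul_eq_mul]
    have h' : x * u i = ⟪e, f x w⟫ * u i := by rw [h]
    rw [h', PiLp.inner_apply, Finset.sum_mul]
    refine Finset.sum_congr rfl fun j _ => by simp; ring
  have hB't : ∀ u x w, B' (tens u (f x w)) = tens w u := fun u x w => by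
    ext ⟨k, i⟩
    have h := hf x w k.succ
    rw [Fin.cons_succ] at h
    simp only [hB', tens_apply]
    rw [← h, PiLp.inner_apply, Finset.sum_mul]
    refine Finset.sum_congr rfl fun j _ => by simp; ring
  refine ⟨A, B, f, gauss_prod_map_add A B A' B' hA hB hnorm, fun x w => ?_, fun x w => ?_,
    fun a u x w => ?_, fun z u x w => ?_⟩
  · simp only [f]
    rw [LinearIsometryEquiv.norm_map, EuclideanSpace.norm_sq_eq, Fin.sum_univ_succ,
      EuclideanSpace.norm_sq_eq]
    simp
  · have h := hf x w 0
    rwa [hb0, Fin.cons_zero] at h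
  · rw [hA, hA't, inner_smul_right]
  · rw [hB, hB't]

theorem integrable_norm_fst_add_norm_snd (c₀ c₁ c₂ : ℝ) :
    Integrable (fun x : Vec p × Mat q p => c₀ + c₁ * ‖x.1‖ + c₂ * ‖x.2‖)
      ((gauss (Vec p)).prod (gauss (Mat q p))) :=
  ((integrable_const c₀).add ((integrable_norm_gauss.comp_fst _).const_mul c₁)).add
    ((integrable_norm_gauss.comp_snd _).const_mul c₂)

theorem bil_add_le (A : Vec p →L[ℝ] Mat p (q + 1)) (B : Mat q p →L[ℝ] Mat p (q + 1))
    (f : ℝ → Vec q → Vec (q + 1)) (e : Vec (q + 1))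
    (hf1 : ∀ x w, ‖f x w‖ ^ 2 = x ^ 2 + ‖w‖ ^ 2) (hf2 : ∀ x w, ⟪e, f x w⟫ = x)
    (hf3 : ∀ a u x w, ⟪A a, tens u (f x w)⟫ = x * ⟪a, u⟫)
    (hf4 : ∀ z u x w, ⟪B z, tens u (f x w)⟫ = ⟪z, tens w u⟫)
    (U : Vec p) (κ β x r : ℝ) (hxr : x ^ 2 + r ^ 2 ≤ 1) (y : Vec p × Mat q p) :
    β * x + bil ((r * κ) • y.2) (x • (κ • y.1 + U))
      ≤ bil (κ • (A y.1 + B y.2) + tens U e) (β • e) := by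
  rw [← le_sub_iff_add_le']
  refine bil_le _ _ _ fun w u hw hu => ?_
  have hn : ‖f x (r • w)‖ ≤ 1 := by
    rw [← sq_le_one_iff₀ (norm_nonneg _), hf1, norm_smul, mul_pow, norm_eq_abs, sq_abs]
    have : ‖w‖ ^ 2 ≤ 1 := pow_le_one₀ (norm_nonneg _) hw
    nlinarith [mul_nonneg (sq_nonneg r) (sub_nonneg.2 this)]
  have h := le_bil (κ • (A y.1 + B y.2) + tens U e) (β • e) u (f x (r • w)) hu hn
  rw [inner_add_left, real_inner_smul_left, inner_add_left, hf3, hf4, inner_tens, hf2,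
    real_inner_smul_left, hf2, tens_smul_left, inner_smul_right] at h
  rw [real_inner_smul_left, real_inner_smul_left, inner_add_left, real_inner_smul_left]
  linarith

/-- Restricting the supremum to a circle through a unit vector `e` of the row space leaves the same
kind of problem for the part of the matrix orthogonal to `e`. -/
theorem bil_step (e : Vec (q + 1)) (he : ‖e‖ = 1) (U : Vec p) (κ β x r : ℝ)
    (hxr : x ^ 2 + r ^ 2 ≤ 1) :
    Integrable (fun a => ∫ z, bil ((r * κ) • z) (x • (κ • a + U)) ∂(gauss (Mat q p)))
      (gauss (Vec p)) ∧
    β * x + ∫ a, ∫ z, bil ((r * κ) • z) (x • (κ • a + U)) ∂(gauss (Mat q p)) ∂(gauss (Vec p))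
      ≤ ∫ z, bil (κ • z + tens U e) (β • e) ∂(gauss (Mat p (q + 1))) := by
  obtain ⟨A, B, f, hlaw, hf1, hf2, hf3, hf4⟩ := exists_gauss_decomposition (p := p) e he
  have hc1 : Continuous fun y : Vec p × Mat q p => bil ((r * κ) • y.2) (x • (κ • y.1 + U)) :=
    continuous_bil_comp (by fun_prop) (by fun_prop)
  have hc2 : Continuous fun z : Mat p (q + 1) => bil (κ • z + tens U e) (β • e) :=
    continuous_bil_comp (by fun_prop) (by fun_prop)
  have hi1 : Integrable (fun y : Vec p × Mat q p => bil ((r * κ) • y.2) (x • (κ • y.1 + U))) ((gauss (Vec p)).prod (gauss (Mat q p))) := by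
    refine (integrable_norm_fst_add_norm_snd (|x| * ‖U‖) (|x| * |κ|) |r * κ|).mono'
      hc1.aestronglyMeasurable (ae_of_all _ fun y => ?_)
    refine (abs_bil_le _ _).trans ?_
    have h1 : ‖κ • y.1 + U‖ ≤ |κ| * ‖y.1‖ + ‖U‖ := by
      refine (norm_add_le _ _).trans ?_
      rw [norm_smul, norm_eq_abs]
    rw [norm_smul, norm_smul, norm_eq_abs, norm_eq_abs]
    nlinarith [mul_le_mul_of_nonneg_left h1 (abs_nonneg x)]
  have hi2 : Integrable (fun z : Mat p (q + 1) => bil (κ • z + tens U e) (β • e))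
      (gauss (Mat p (q + 1))) := by
    refine ((integrable_norm_gauss.const_mul |κ|).add
      (integrable_const (‖tens U e‖ + ‖β • e‖))).mono'
      hc2.aestronglyMeasurable (ae_of_all _ fun z => ?_)
    refine (abs_bil_le _ _).trans ?_
    have h1 : ‖κ • z + tens U e‖ ≤ |κ| * ‖z‖ + ‖tens U e‖ := by
      refine (norm_add_le _ _).trans ?_
      rw [norm_smul, norm_eq_abs]
    simp only [Pi.add_apply]
    linarith
  have hAB : Measurable fun y : Vec p × Mat q p => A y.1 + B y.2 := by fun_prop
  refine ⟨hi1.integral_prod_left, ?_⟩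
  rw [← integral_prod _ hi1, ← hlaw, integral_map hAB.aemeasurable hc2.aestronglyMeasurable]
  have hi3 : Integrable (fun y : Vec p × Mat q p => bil (κ • (A y.1 + B y.2) + tens U e) (β • e)) ((gauss (Vec p)).prod (gauss (Mat q p))) := by
    rw [← hlaw] at hi2
    exact hi2.comp_measurable hAB
  have hi4 : Integrable (fun y : Vec p × Mat q p =>
      β * x + bil ((r * κ) • y.2) (x • (κ • y.1 + U))) ((gauss (Vec p)).prod (gauss (Mat q p))) := (integrable_const _).add hi1
  have : β * x + ∫ y, bil ((r * κ) • y.2) (x • (κ • y.1 + U)) ∂((gauss (Vec p)).prod (gauss (Mat q p)))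
      = ∫ y, (β * x + bil ((r * κ) • y.2) (x • (κ • y.1 + U))) ∂((gauss (Vec p)).prod (gauss (Mat q p))) := by
    rw [integral_add (integrable_const _) hi1]; simp
  rw [this]
  exact integral_mono hi4 hi3 fun y => bil_add_le A B f e hf1 hf2 hf3 hf4 U κ β x r hxr y

end Decomposition

section Krylov

/-- Lower bounds produced by iterating `bil_step`. -/
def krylov (ω : ℝ) : ℕ → ℕ → ℕ → ℝ
  | 0, _, _ => 0
  | _ + 1, _, 0 => 0
  | K + 1, p, q + 1 => (1 - ω ^ 2) * (∫ a, ‖a‖ ∂(gauss (Vec p))) + ω * krylov ω K q p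

theorem krylov_le_integral_bil (ω : ℝ) (h0 : 0 ≤ ω) (h1 : ω ≤ 1) (K : ℕ) :
    ∀ (p q : ℕ) (κ : ℝ) (_ : 0 ≤ κ) (b : Vec q),
      ‖b‖ * √(1 - ω ^ 2) + κ * krylov ω K p q ≤ ∫ z, bil (κ • z) b ∂(gauss (Mat p q)) := by
  have hω : 0 ≤ 1 - ω ^ 2 := by nlinarith
  have hbase : ∀ (p q : ℕ) (κ : ℝ) (b : Vec q),
      ‖b‖ * √(1 - ω ^ 2) ≤ ∫ z, bil (κ • z) b ∂(gauss (Mat p q)) := fun p q κ b => by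
    have hs : √(1 - ω ^ 2) ≤ 1 := sqrt_le_one.2 (by nlinarith)
    calc ‖b‖ * √(1 - ω ^ 2) ≤ ‖b‖ := mul_le_of_le_one_right (norm_nonneg _) hs
      _ = ∫ z, ‖b‖ ∂(gauss (Mat p q)) := by simp
      _ ≤ _ := by
          refine integral_mono (integrable_const _) ?_ fun z => norm_le_bil _ _
          refine ((integrable_norm_gauss.const_mul |κ|).add (integrable_const ‖b‖)).mono'
            (continuous_bil_comp (by fun_prop) (by fun_prop)).aestronglyMeasurable
            (ae_of_all _ fun z => ?_)
          refine (abs_bil_le _ _).trans ?_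
          simp [norm_smul]
  induction K with
  | zero => intro p q κ _ b; simpa [krylov] using hbase p q κ b
  | succ K ih =>
    intro p q κ hκ b
    cases q with
    | zero => simpa [krylov] using hbase p 0 κ b
    | succ q =>
      obtain ⟨e, he, hbe⟩ : ∃ e : Vec (q + 1), ‖e‖ = 1 ∧ b = ‖b‖ • e := by
        rcases eq_or_ne b 0 with rfl | hb
        · exact ⟨EuclideanSpace.single 0 1, by simp, by simp⟩
        · have hb' : ‖b‖ ≠ 0 := norm_ne_zero_iff.2 hb
          refine ⟨‖b‖⁻¹ • b, ?_, ?_⟩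
          · rw [norm_smul, norm_inv, norm_norm, inv_mul_cancel₀ hb']
          · rw [smul_smul, mul_inv_cancel₀ hb', one_smul]
      have hsq := sq_sqrt hω
      obtain ⟨hi, hstep⟩ := bil_step (p := p) e he 0 κ ‖b‖ (√(1 - ω ^ 2)) ω
        (by rw [hsq]; linarith)
      simp only [tens_zero_left, add_zero, ← hbe] at hstep hi
      refine le_trans ?_ hstep
      rw [add_le_add_iff_left]
      have hin : Integrable (fun a : Vec p => κ * (1 - ω ^ 2) * ‖a‖ + ω * κ * krylov ω K q p)
        (gauss (Vec p)) := (integrable_norm_gauss.const_mul _).add (integrable_const _)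
      calc κ * krylov ω (K + 1) p (q + 1)
          = ∫ a : Vec p, (κ * (1 - ω ^ 2) * ‖a‖ + ω * κ * krylov ω K q p) ∂(gauss (Vec p)) := by
            rw [integral_add (integrable_norm_gauss.const_mul _) (integrable_const _),
              integral_const_mul]
            simp [krylov]; ring
        _ ≤ _ := by
            refine integral_mono hin hi fun a => ?_
            refine le_trans (le_of_eq ?_) (ih q p (ω * κ) (mul_nonneg h0 hκ) _)
            rw [norm_smul, norm_smul, norm_of_nonneg hκ, norm_of_nonneg (sqrt_nonneg _)]
            nth_rewrite 1 [← hsq]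
            ring

/-- Lower bound for the norm of a spiked Gaussian matrix. -/
theorem exists_le_integral_bil_spiked : ∃ C : ℝ, 0 ≤ C ∧ ∀ (ω x r s : ℝ) (_ : 0 ≤ ω) (_ : ω ≤ 1)
    (_ : 0 ≤ x) (_ : 0 ≤ r) (_ : x ^ 2 + r ^ 2 ≤ 1) (K p q : ℕ) (U : Vec p) (V : Vec (q + 1))
    (_ : ‖U‖ = 1) (_ : ‖V‖ = 1),
    x * √(1 - ω ^ 2) * (√(s ^ 2 + p) - C) + r * krylov ω K q p
      ≤ ∫ z, bil (z + s • tens U V) 0 ∂(gauss (Mat p (q + 1))) := by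
  obtain ⟨C, hC, hC'⟩ := exists_le_integral_norm_add_gauss
  refine ⟨C, hC, fun ω x r s h0 h1 hx hr hxr K p q U V hU hV => ?_⟩
  obtain ⟨hi, hstep⟩ := bil_step V hV (s • U) 1 0 x r hxr
  simp only [tens_smul_left, zero_smul, one_smul, mul_one, zero_mul, zero_add] at hstep hi
  refine le_trans ?_ hstep
  have hn : Integrable (fun a : Vec p => ‖a + s • U‖) (gauss (Vec p)) := by
    refine (integrable_norm_gauss.add (integrable_const ‖s • U‖)).mono' (by fun_prop)
      (ae_of_all _ fun a => ?_)
    rw [norm_norm]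
    exact norm_add_le _ _
  have hin : Integrable (fun a : Vec p => x * √(1 - ω ^ 2) * ‖a + s • U‖ + r * krylov ω K q p)
    (gauss (Vec p)) := (hn.const_mul _).add (integrable_const _)
  calc x * √(1 - ω ^ 2) * (√(s ^ 2 + p) - C) + r * krylov ω K q p
      ≤ x * √(1 - ω ^ 2) * (∫ a : Vec p, ‖a + s • U‖ ∂(gauss (Vec p))) + r * krylov ω K q p := by
        gcongr
        have := hC' (Fin p) (s • U)
        simpa [norm_smul, hU] using this
    _ = ∫ a : Vec p, (x * √(1 - ω ^ 2) * ‖a + s • U‖ + r * krylov ω K q p) ∂(gauss (Vec p)) := by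
        rw [integral_add (hn.const_mul _) (integrable_const _), integral_const_mul]
        simp
    _ ≤ _ := by
        refine integral_mono hin hi fun a => ?_
        refine le_trans (le_of_eq ?_) (krylov_le_integral_bil ω h0 h1 K q p r hr _)
        rw [norm_smul, norm_of_nonneg hx]
        ring

end Krylov

section Limits

/-- The limit of `krylov` after rescaling. -/
def krylovLim (ω : ℝ) : ℕ → ℝ → ℝ → ℝ
  | 0, _, _ => 0
  | K + 1, a, b => (1 - ω ^ 2) * √a + ω * krylovLim ω K b a

theorem le_krylovLim (ω : ℝ) (h0 : 0 ≤ ω) (h1 : ω ≤ 1) (K : ℕ) : ∀ a b : ℝ,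
    √a + ω * √b - ω ^ K * (√a + √b) ≤ krylovLim ω K a b := by
  induction K with
  | zero =>
    intro a b
    simp only [krylovLim, pow_zero, one_mul]
    nlinarith [sqrt_nonneg a, sqrt_nonneg b]
  | succ K ih =>
    intro a b
    have := mul_le_mul_of_nonneg_left (ih b a) h0
    simp only [krylovLim, pow_succ]
    linarith

theorem tendsto_natCast_sqrt_atTop : Tendsto (fun n : ℕ => √(n : ℝ)) atTop atTop :=
  tendsto_sqrt_atTop.comp tendsto_natCast_atTop_atTop

theorem tendsto_sqrt_div_sqrt {p : ℕ → ℝ} {a : ℝ}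
    (hp : Tendsto (fun n : ℕ => p n / n) atTop (nhds a)) :
    Tendsto (fun n : ℕ => √(p n) / √(n : ℝ)) atTop (nhds √a) := by
  refine ((continuous_sqrt.tendsto a).comp hp).congr fun n => ?_
  simp [sqrt_div' _ (Nat.cast_nonneg n)]

theorem tendsto_integral_norm_gauss {p : ℕ → ℕ} {a : ℝ}
    (hp : Tendsto (fun n => (p n : ℝ) / n) atTop (nhds a)) :
    Tendsto (fun n : ℕ => (∫ x, ‖x‖ ∂(gauss (Vec (p n)))) / √(n : ℝ)) atTop (nhds √a) := by
  obtain ⟨C, hC, hC'⟩ := exists_le_integral_norm_add_gauss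
  have h1 := tendsto_sqrt_div_sqrt hp
  have h2 : Tendsto (fun n : ℕ => √(p n : ℝ) / √(n : ℝ) - C / √(n : ℝ)) atTop (nhds √a) := by
    simpa using h1.sub (tendsto_const_nhds.div_atTop tendsto_natCast_sqrt_atTop)
  refine tendsto_of_tendsto_of_tendsto_of_le_of_le h2 h1 (fun n => ?_) fun n => ?_
  · simp only [← sub_div]
    have := hC' (Fin (p n)) 0
    gcongr
    simpa using this
  · have := integral_norm_gauss_le (ι := Fin (p n))
    simp only
    gcongr
    simpa using this

theorem tendsto_pred_div {q : ℕ → ℕ} {b : ℝ} (hb : 0 < b)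
    (hq : Tendsto (fun n => (q n : ℝ) / n) atTop (nhds b)) :
    (∀ᶠ n in atTop, 1 ≤ q n) ∧ Tendsto (fun n => ((q n - 1 : ℕ) : ℝ) / n) atTop (nhds b) := by
  have h1 : ∀ᶠ n in atTop, 1 ≤ q n := by
    filter_upwards [hq.eventually (lt_mem_nhds hb)] with n hn
    rcases Nat.eq_zero_or_pos (q n) with h | h
    · simp [h] at hn
    · exact h
  refine ⟨h1, ?_⟩
  have h2 : Tendsto (fun n : ℕ => (q n : ℝ) / n - 1 / n) atTop (nhds b) := by
    simpa using hq.sub tendsto_one_div_atTop_nhds_zero_nat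
  refine h2.congr' ?_
  filter_upwards [h1] with n hn
  rw [Nat.cast_sub hn, sub_div, Nat.cast_one]

theorem tendsto_krylov (ω : ℝ) (K : ℕ) : ∀ (p q : ℕ → ℕ) (a b : ℝ) (_ : 0 < a) (_ : 0 < b)
    (_ : Tendsto (fun n => (p n : ℝ) / n) atTop (nhds a))
    (_ : Tendsto (fun n => (q n : ℝ) / n) atTop (nhds b)),
    Tendsto (fun n : ℕ => krylov ω K (p n) (q n) / √(n : ℝ)) atTop (nhds (krylovLim ω K a b)) := by
  induction K with
  | zero => intro p q a b _ _ _ _; simp [krylov, krylovLim]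
  | succ K ih =>
    intro p q a b ha hb hp hq
    obtain ⟨h1, h2⟩ := tendsto_pred_div hb hq
    have h3 := ((tendsto_integral_norm_gauss hp).const_mul (1 - ω ^ 2)).add
      ((ih (fun n => q n - 1) p b a hb ha h2 hp).const_mul ω)
    refine h3.congr' ?_
    filter_upwards [h1] with n hn
    obtain ⟨m, hm⟩ : ∃ m, q n = m + 1 := ⟨q n - 1, by omega⟩
    simp only [hm, krylov, Nat.add_sub_cancel]
    ring

/-- The asymptotic norm of a spiked matrix. -/
def spikedNorm (a b θ : ℝ) : ℝ := √((a + θ) * (b + θ) / θ)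

theorem eventually_le_integral_bil {p q : ℕ → ℕ} {a b : ℝ} (ha : 0 < a) (hb : 0 < b)
    (hp : Tendsto (fun n => (p n : ℝ) / n) atTop (nhds a))
    (hq : Tendsto (fun n => (q n : ℝ) / n) atTop (nhds b)) (θ : ℝ) (hθ : 0 < θ)
    (hab : a * b < θ ^ 2) (ε : ℝ) (hε : 0 < ε) :
    ∀ᶠ n : ℕ in atTop, ∀ (U : Vec (p n)) (V : Vec (q n)), ‖U‖ = 1 → ‖V‖ = 1 →
      (spikedNorm a b θ - ε) * √(n : ℝ)
        ≤ ∫ z, bil (z + √(n * θ) • tens U V) 0 ∂(gauss (Mat (p n) (q n))) := by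
  obtain ⟨C, hC, hC'⟩ := exists_le_integral_bil_spiked
  set ω := √(a * b) / θ with hω
  have hω0 : 0 ≤ ω := by positivity
  have hω1 : ω < 1 := by
    rw [hω, div_lt_one hθ]
    exact (sqrt_lt' hθ).2 hab
  have hω2 : 0 < 1 - ω ^ 2 := by nlinarith
  set X := √(1 - ω ^ 2) * √(θ + a) with hX
  set Y := √b + ω * √a with hY
  have hX0 : 0 < X := mul_pos (sqrt_pos.2 hω2) (sqrt_pos.2 (by linarith))
  have hY0 : 0 ≤ Y := by positivity
  set N := √(X ^ 2 + Y ^ 2) with hN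
  have hN0 : 0 < N := sqrt_pos.2 (by positivity)
  have hNsq : N ^ 2 = X ^ 2 + Y ^ 2 := sq_sqrt (by positivity)
  have hNs : N = spikedNorm a b θ := by
    rw [hN, spikedNorm]
    congr 1
    have e1 : √(a * b) = √a * √b := sqrt_mul ha.le b
    have e2 := sq_sqrt ha.le
    have e3 := sq_sqrt hb.le
    rw [hX, mul_pow, sq_sqrt hω2.le, sq_sqrt (by linarith), hY, hω, e1]
    set α := √a
    set β := √b
    rw [← e2, ← e3]
    field_simp
    ring
  have hxr : (X / N) ^ 2 + (Y / N) ^ 2 ≤ 1 := by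
    rw [div_pow, div_pow, ← add_div, ← hNsq, div_self (by positivity)]
  obtain ⟨K, hK⟩ : ∃ K : ℕ, Y / N * (ω ^ K * (√b + √a)) < ε / 2 := by
    have : Tendsto (fun K : ℕ => Y / N * (ω ^ K * (√b + √a))) atTop
        (nhds (Y / N * (0 * (√b + √a)))) :=
      ((tendsto_pow_atTop_nhds_zero_of_lt_one hω0 hω1).mul_const _).const_mul _
    rw [zero_mul, mul_zero] at this
    exact (this.eventually (gt_mem_nhds (half_pos hε))).exists
  obtain ⟨h1, h2⟩ := tendsto_pred_div hb hq
  have hkr := tendsto_krylov ω K (fun n => q n - 1) p b a hb ha h2 hp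
  have hp' : Tendsto (fun n : ℕ => (n * θ + p n) / n) atTop (nhds (θ + a)) := by
    have := hp.const_add θ
    refine this.congr' ?_
    filter_upwards [eventually_gt_atTop 0] with n hn
    have : (n : ℝ) ≠ 0 := by positivity
    field_simp
  have hlim : Tendsto (fun n : ℕ => X / N * √(1 - ω ^ 2) * (√(n * θ + p n) / √(n : ℝ) - C / √(n : ℝ))
      + Y / N * (krylov ω K (q n - 1) (p n) / √(n : ℝ))) atTop
      (nhds (X / N * √(1 - ω ^ 2) * (√(θ + a) - 0) + Y / N * krylovLim ω K b a)) :=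
    (((tendsto_sqrt_div_sqrt hp').sub
      (tendsto_const_nhds.div_atTop tendsto_natCast_sqrt_atTop)).const_mul _).add
      (hkr.const_mul _)
  have hlow : spikedNorm a b θ - ε
      < X / N * √(1 - ω ^ 2) * (√(θ + a) - 0) + Y / N * krylovLim ω K b a := by
    have h3 := mul_le_mul_of_nonneg_left (le_krylovLim ω hω0 hω1.le K b a)
      (show 0 ≤ Y / N by positivity)
    have h4 : X / N * √(1 - ω ^ 2) * (√(θ + a) - 0) + Y / N * Y = N := by
      have : X / N * √(1 - ω ^ 2) * (√(θ + a) - 0) = X / N * X := by rw [hX]; ring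
      rw [this]
      field_simp
      linarith
    rw [mul_sub] at h3
    rw [← hNs]
    have h5 : Y / N * (√b + ω * √a) = Y / N * Y := rfl
    linarith
  filter_upwards [hlim.eventually (lt_mem_nhds hlow), h1, eventually_gt_atTop 0] with n hn hn1 hn0
  have hs : 0 < √(n : ℝ) := sqrt_pos.2 (by positivity)
  obtain ⟨m, hm⟩ : ∃ m, q n = m + 1 := ⟨q n - 1, by omega⟩
  rw [hm] at hn ⊢
  intro U V hU hV
  refine le_trans ?_ (hC' ω (X / N) (Y / N) (√(n * θ)) hω0 hω1.le (by positivity) (by positivity)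
    hxr K (p n) m U V hU hV)
  rw [← le_div_iff₀ hs]
  refine hn.le.trans (le_of_eq ?_)
  rw [sq_sqrt (by positivity), Nat.add_sub_cancel]
  field_simp

end Limits

section Overlap

variable {p q : ℕ}

theorem exists_net (hp : 1 ≤ p) (hq : 1 ≤ q) (η : ℝ) (hη : 0 < η) :
    ∃ T : Finset (Vec p × Vec q), T.Nonempty ∧ (∀ x ∈ T, ‖x.1‖ = 1 ∧ ‖x.2‖ = 1) ∧
      ∀ (u : Vec p) (v : Vec q), ‖u‖ = 1 → ‖v‖ = 1 → ∃ x ∈ T, ‖u - x.1‖ ≤ η ∧ ‖v - x.2‖ ≤ η := by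
  have hc : IsCompact (Metric.sphere (0 : Vec p) 1 ×ˢ Metric.sphere (0 : Vec q) 1) :=
    (isCompact_sphere _ _).prod (isCompact_sphere _ _)
  obtain ⟨t, ht, htf, hcov⟩ := hc.finite_cover_balls hη
  have hcov' : ∀ (u : Vec p) (v : Vec q), ‖u‖ = 1 → ‖v‖ = 1 →
      ∃ x ∈ htf.toFinset, ‖u - x.1‖ ≤ η ∧ ‖v - x.2‖ ≤ η := fun u v hu hv => by
    have := hcov (show (u, v) ∈ _ from ⟨by simpa using hu, by simpa using hv⟩)
    simp only [Set.mem_iUnion, exists_prop] at this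
    obtain ⟨x, hx, hd⟩ := this
    refine ⟨x, htf.mem_toFinset.2 hx, ?_, ?_⟩
    · rw [← dist_eq_norm]; exact (le_max_left _ _).trans (Metric.mem_ball.1 hd).le
    · rw [← dist_eq_norm]; exact (le_max_right _ _).trans (Metric.mem_ball.1 hd).le
  refine ⟨htf.toFinset, ?_, fun x hx => ?_, hcov'⟩
  · obtain ⟨x, hx, _⟩ := hcov' (EuclideanSpace.single ⟨0, hp⟩ 1) (EuclideanSpace.single ⟨0, hq⟩ 1)
      (by simp) (by simp)
    exact ⟨x, hx⟩
  · have := ht (htf.mem_toFinset.1 hx)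
    exact ⟨by simpa using this.1, by simpa using this.2⟩

theorem exists_measurable_argmax {κ E : Type*} [MeasurableSpace κ] [NormedAddCommGroup E]
    [InnerProductSpace ℝ E] [MeasurableSpace E] [BorelSpace E] [SecondCountableTopology E]
    (g : κ → E) (hg : Measurable g) (T : Finset κ) (hT : T.Nonempty) :
    ∃ M : E → κ, Measurable M ∧ ∀ z, M z ∈ T ∧ ∀ t ∈ T, ⟪g t, z⟫ ≤ ⟪g (M z), z⟫ := by
  classical
  induction hT using Finset.Nonempty.cons_induction with
  | singleton a => exact ⟨fun _ => a, measurable_const, fun z => ⟨by simp, by simp⟩⟩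
  | cons a s ha hs ih =>
    obtain ⟨M, hM, hM'⟩ := ih
    refine ⟨fun z => if ⟪g (M z), z⟫ < ⟪g a, z⟫ then a else M z, ?_, fun z => ?_⟩
    · refine Measurable.ite (measurableSet_lt ?_ ?_) measurable_const hM
      · exact (hg.comp hM).inner measurable_id
      · exact measurable_const.inner measurable_id
    · simp only [Finset.mem_cons]
      split_ifs with h
      · exact ⟨Or.inl rfl, fun t ht => ht.elim (fun h => h ▸ le_rfl)
          fun h' => ((hM' z).2 t h').trans h.le⟩
      · exact ⟨Or.inr (hM' z).1, fun t ht => ht.elim (fun h' => h' ▸ not_lt.1 h) ((hM' z).2 t)⟩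

theorem exists_nearly_optimal (hp : 1 ≤ p) (hq : 1 ≤ q) (η : ℝ) (hη : 0 < η) :
    ∃ (u : Mat p q → Vec p) (v : Mat p q → Vec q) (M : Mat p q → Mat p q),
      Measurable u ∧ Measurable v ∧ (∀ z, ‖u z‖ = 1) ∧ (∀ z, ‖v z‖ = 1) ∧
      (∀ z, M z = tens (u z) (v z)) ∧ Measurable M ∧ (∀ z, ‖M z‖ = 1) ∧
      (∀ z z', ⟪M z', z⟫ ≤ ⟪M z, z⟫) ∧ (∀ z, bil z 0 ≤ ⟪M z, z⟫ + η * ‖z‖) ∧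
      ∀ (U : Vec p) (V : Vec q) (s : ℝ), ‖U‖ = 1 → ‖V‖ = 1 → 0 < s →
        ∫ z, ⟪M (z + s • tens U V), z + s • tens U V⟫ ∂(gauss (Mat p q))
          ≤ √((p + s ^ 2) * (q + s ^ 2)) / s + 2 := by
  classical
  obtain ⟨T, hT, hT1, hT2⟩ := exists_net hp hq (η / 2) (half_pos hη)
  have htens : Measurable fun x : Vec p × Vec q => tens x.1 x.2 :=
    (continuous_tens (p := p) (q := q)).measurable
  obtain ⟨W, hW, hM'⟩ := exists_measurable_argmax _ htens T hT
  set M : Mat p q → Mat p q := fun z => tens (W z).1 (W z).2 with hMdef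
  have hmem : ∀ z, ∃ x ∈ T, tens x.1 x.2 = M z := fun z => ⟨W z, (hM' z).1, rfl⟩
  have hle : ∀ z, ∀ x ∈ T, ⟪tens x.1 x.2, z⟫ ≤ ⟪M z, z⟫ := fun z => (hM' z).2
  refine ⟨fun z => (W z).1, fun z => (W z).2, M, hW.fst, hW.snd, fun z => (hT1 _ (hM' z).1).1,
    fun z => (hT1 _ (hM' z).1).2, fun z => rfl, htens.comp hW, fun z => ?_,
    fun z z' => hle _ _ (hM' z').1, fun z => ?_,
    fun U V s hU hV hs => ?_⟩
  · obtain ⟨x, hx, hx'⟩ := hmem z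
    rw [← hx', norm_tens, (hT1 x hx).1, (hT1 x hx).2, one_mul]
  · have hunit : ∀ (u : Vec p) (v : Vec q), ‖u‖ = 1 → ‖v‖ = 1 →
        ⟪z, tens u v⟫ ≤ ⟪M z, z⟫ + η * ‖z‖ := fun u v hu hv => by
      obtain ⟨x, hx, h1, h2⟩ := hT2 u v hu hv
      have e : tens u v = tens x.1 x.2 + (tens (u - x.1) v + tens x.1 (v - x.2)) := by
        rw [tens_sub_left, tens_sub_right]; abel
      have hn : ‖tens (u - x.1) v + tens x.1 (v - x.2)‖ ≤ η := by
        refine (norm_add_le _ _).trans ?_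
        rw [norm_tens, norm_tens, hv, (hT1 x hx).1]
        linarith
      rw [e, inner_add_right]
      have h3 := hle z x hx
      rw [real_inner_comm] at h3
      have h4 := (real_inner_le_norm z (tens (u - x.1) v + tens x.1 (v - x.2))).trans
        (mul_le_mul_of_nonneg_left hn (norm_nonneg z))
      linarith
    have hnn : 0 ≤ ⟪M z, z⟫ + η * ‖z‖ := by
      have h1 := hunit (EuclideanSpace.single ⟨0, hp⟩ 1) (EuclideanSpace.single ⟨0, hq⟩ 1)
        (by simp) (by simp)
      have h2 := hunit (-EuclideanSpace.single ⟨0, hp⟩ 1) (EuclideanSpace.single ⟨0, hq⟩ 1)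
        (by simp) (by simp)
      rw [← neg_one_smul ℝ (EuclideanSpace.single _ _), tens_smul_left, inner_smul_right] at h2
      linarith
    refine bil_le _ _ _ fun u v hu hv => ?_
    rw [inner_zero_left, add_zero]
    rcases eq_or_ne u 0 with rfl | hu0
    · simpa [tens_zero_left] using hnn
    rcases eq_or_ne v 0 with rfl | hv0
    · have : tens u (0 : Vec q) = 0 := by ext x; simp [tens_apply]
      simpa [this] using hnn
    have hu0' := norm_ne_zero_iff.2 hu0
    have hv0' := norm_ne_zero_iff.2 hv0
    have h1 := hunit (‖u‖⁻¹ • u) (‖v‖⁻¹ • v)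
      (by rw [norm_smul, norm_inv, norm_norm, inv_mul_cancel₀ hu0'])
      (by rw [norm_smul, norm_inv, norm_norm, inv_mul_cancel₀ hv0'])
    have e : tens u v = (‖u‖ * ‖v‖) • tens (‖u‖⁻¹ • u) (‖v‖⁻¹ • v) := by
      rw [tens_smul_left, tens_smul_right, smul_smul, smul_smul]
      field_simp
      simp
    rw [e, inner_smul_right]
    calc ‖u‖ * ‖v‖ * ⟪z, tens (‖u‖⁻¹ • u) (‖v‖⁻¹ • v)⟫
        ≤ ‖u‖ * ‖v‖ * (⟪M z, z⟫ + η * ‖z‖) := by gcongr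
      _ ≤ 1 * (⟪M z, z⟫ + η * ‖z‖) := by
          gcongr
          exact mul_le_one₀ hu (norm_nonneg _) hv
      _ = _ := one_mul _
  · have : Nonempty T := hT.to_subtype
    have h := integral_maxOf_spiked_le U V hU hV (fun x : T => x.1.1) (fun x : T => x.1.2)
      (fun x => (hT1 x.1 x.2).1) (fun x => (hT1 x.1 x.2).2) s hs
    refine le_trans (le_of_eq (integral_congr_ae (ae_of_all _ fun z => ?_))) h
    refine le_antisymm ?_ (maxOf_le _ _ fun x => hle _ x.1 x.2)
    obtain ⟨x, hx, hx'⟩ := hmem (z + s • tens U V)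
    simp only [← hx']
    exact le_maxOf (fun x : T => ⟪tens x.1.1 x.1.2, z + s • tens U V⟫) ⟨x, hx⟩

theorem integrable_inner_of_norm_one (M : Mat p q → Mat p q) (hM : Measurable M)
    (h1 : ∀ z, ‖M z‖ = 1) (a b : Mat p q) :
    Integrable (fun z => ⟪M (z + a), z + b⟫) (gauss (Mat p q)) := by
  refine (integrable_norm_gauss.add (integrable_const ‖b‖)).mono'
    (((hM.comp (measurable_id.add_const a)).inner
      (measurable_id.add_const b)).aestronglyMeasurable) (ae_of_all _ fun z => ?_)
  refine (norm_inner_le_norm _ _).trans ?_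
  rw [h1, one_mul]
  exact norm_add_le _ _

/-- A finite-size lower bound for the overlap of a nearly optimal rank-one direction. -/
theorem exists_le_overlap (hp : 1 ≤ p) (hq : 1 ≤ q) (s : ℝ) (hs : 0 < s) :
    ∃ (u : Mat p q → Vec p) (v : Mat p q → Vec q),
      Measurable u ∧ Measurable v ∧ (∀ z, ‖u z‖ = 1) ∧ (∀ z, ‖v z‖ = 1) ∧
      ∀ (U : Vec p) (V : Vec q) (s' : ℝ), ‖U‖ = 1 → ‖V‖ = 1 → 0 < s' → s' < s →
        ∫ z, bil (z + s • tens U V) 0 ∂(gauss (Mat p q)) - √((p + s' ^ 2) * (q + s' ^ 2)) / s' - 3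
          ≤ (s - s') * ∫ z, ⟪tens (u (z + s • tens U V)) (v (z + s • tens U V)), tens U V⟫
              ∂(gauss (Mat p q)) := by
  obtain ⟨u, v, M, hu, hv, hu1, hv1, hMe, hM, hM1, hM2, hM3, hM4⟩ := exists_nearly_optimal hp hq (1 / (√((p * q : ℕ) : ℝ) + s))
    (by positivity)
  refine ⟨u, v, hu, hv, hu1, hv1, fun U V s' hU hV hs' hss => ?_⟩
  simp only [← hMe]
  set φ := tens U V with hφ
  have hφ1 : ‖φ‖ = 1 := by rw [hφ, norm_tens, hU, hV, one_mul]
  have i1 := integrable_inner_of_norm_one M hM hM1 (s • φ) (s • φ)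
  have i2 := integrable_inner_of_norm_one M hM hM1 (s' • φ) (s' • φ)
  have i3 : Integrable (fun z => ⟪M (z + s • φ), φ⟫) (gauss (Mat p q)) := by
    refine (integrable_const (1 : ℝ)).mono' (((hM.comp (measurable_id.add_const _)).inner
      measurable_const).aestronglyMeasurable) (ae_of_all _ fun z => ?_)
    refine (norm_inner_le_norm _ _).trans ?_
    rw [hM1, hφ1, one_mul]
  have i4 : Integrable (fun z : Mat p q => ‖z + s • φ‖) (gauss (Mat p q)) := by
    refine (integrable_norm_gauss.add (integrable_const ‖s • φ‖)).mono' (by fun_prop)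
      (ae_of_all _ fun a => ?_)
    rw [norm_norm]
    exact norm_add_le _ _
  have i5 : Integrable (fun z : Mat p q => bil (z + s • φ) 0) (gauss (Mat p q)) := by
    refine i4.mono' (continuous_bil_comp (by fun_prop) (by fun_prop)).aestronglyMeasurable
      (ae_of_all _ fun z => ?_)
    simpa using abs_bil_le (z + s • φ) 0
  have b1 : ∫ z : Mat p q, ‖z + s • φ‖ ∂(gauss (Mat p q)) ≤ √((p * q : ℕ) : ℝ) + s := by
    calc ∫ z : Mat p q, ‖z + s • φ‖ ∂(gauss (Mat p q))
        ≤ ∫ z : Mat p q, (‖z‖ + s) ∂(gauss (Mat p q)) := by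
          refine integral_mono i4 (integrable_norm_gauss.add (integrable_const s)) fun z => ?_
          refine (norm_add_le _ _).trans ?_
          rw [norm_smul, hφ1, mul_one, norm_of_nonneg hs.le]
      _ ≤ _ := by
          rw [integral_add integrable_norm_gauss (integrable_const s)]
          have := integral_norm_gauss_le (ι := Fin p × Fin q)
          simp at this ⊢
          exact this
  have b2 : ∫ z, bil (z + s • φ) 0 ∂(gauss (Mat p q))
      ≤ ∫ z, ⟪M (z + s • φ), z + s • φ⟫ ∂(gauss (Mat p q)) + 1 := by
    calc ∫ z, bil (z + s • φ) 0 ∂(gauss (Mat p q))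
        ≤ ∫ z, (⟪M (z + s • φ), z + s • φ⟫ + 1 / (√((p * q : ℕ) : ℝ) + s) * ‖z + s • φ‖)
            ∂(gauss (Mat p q)) := integral_mono i5 (i1.add (i4.const_mul _)) fun z => hM3 _
      _ = ∫ z, ⟪M (z + s • φ), z + s • φ⟫ ∂(gauss (Mat p q)) + 1 / (√((p * q : ℕ) : ℝ) + s)
            * ∫ z : Mat p q, ‖z + s • φ‖ ∂(gauss (Mat p q)) := by
          rw [integral_add i1 (i4.const_mul _), integral_const_mul]
      _ ≤ _ := by
          gcongr
          rw [one_div_mul_eq_div]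
          exact div_le_one_of_le₀ b1 (by positivity)
  have b3 : ∫ z, ⟪M (z + s • φ), z + s • φ⟫ ∂(gauss (Mat p q))
      - (s - s') * ∫ z, ⟪M (z + s • φ), φ⟫ ∂(gauss (Mat p q))
      ≤ ∫ z, ⟪M (z + s' • φ), z + s' • φ⟫ ∂(gauss (Mat p q)) := by
    rw [← integral_const_mul, ← integral_sub i1 (i3.const_mul _)]
    refine integral_mono (i1.sub (i3.const_mul _)) i2 fun z => ?_
    refine le_trans (le_of_eq ?_) (hM2 (z + s' • φ) (z + s • φ))
    have : z + s' • φ = (z + s • φ) - (s - s') • φ := by rw [sub_smul]; abel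
    simp only
    conv_rhs => rw [this, inner_sub_right, inner_smul_right]
  have b4 := hM4 U V s' hU hV hs'
  linarith

end Overlap

/-- The limiting overlap `⟨û ⊗ v̂, U ⊗ V⟩` of the top singular pair with the spike. -/
def overlap (a b θ : ℝ) : ℝ := (θ ^ 2 - a * b) / (θ * √((a + θ) * (b + θ)))

theorem hasDerivAt_spikedNorm_sq {a b : ℝ} (ha : 0 < a) (hb : 0 < b) {x : ℝ} (hx : 0 < x) :
    HasDerivAt (fun x => √((a + x ^ 2) * (b + x ^ 2)) / x) (overlap a b (x ^ 2)) x := by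
  have hpos : 0 < (a + x ^ 2) * (b + x ^ 2) := by positivity
  have h1 : HasDerivAt (fun x : ℝ => (a + x ^ 2) * (b + x ^ 2))
      (2 * x * (b + x ^ 2) + (a + x ^ 2) * (2 * x)) x := by
    have h2 : HasDerivAt (fun x : ℝ => a + x ^ 2) (2 * x) x := by
      simpa using (hasDerivAt_pow 2 x).const_add a
    have h3 : HasDerivAt (fun x : ℝ => b + x ^ 2) (2 * x) x := by
      simpa using (hasDerivAt_pow 2 x).const_add b
    exact h2.mul h3
  refine ((h1.sqrt hpos.ne').fun_div (hasDerivAt_id x) hx.ne').congr_deriv ?_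
  have hs := Real.sq_sqrt hpos.le
  have hs0 := Real.sqrt_pos.2 hpos
  simp only [overlap, id]
  set r := √((a + x ^ 2) * (b + x ^ 2))
  field_simp
  rw [hs]
  ring

theorem eventually_le_overlap {p q : ℕ → ℕ} {a b : ℝ} (ha : 0 < a) (hb : 0 < b)
    (hp : Tendsto (fun n => (p n : ℝ) / n) atTop (nhds a))
    (hq : Tendsto (fun n => (q n : ℝ) / n) atTop (nhds b)) (θ : ℝ) (hθ : 0 < θ)
    (hab : a * b < θ ^ 2) (ε : ℝ) (hε : 0 < ε) :
    ∀ᶠ n : ℕ in atTop, ∃ (u : Mat (p n) (q n) → Vec (p n)) (v : Mat (p n) (q n) → Vec (q n)),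
      Measurable u ∧ Measurable v ∧ (∀ z, ‖u z‖ = 1) ∧ (∀ z, ‖v z‖ = 1) ∧
      ∀ (U : Vec (p n)) (V : Vec (q n)), ‖U‖ = 1 → ‖V‖ = 1 →
        overlap a b θ - ε ≤ ∫ z, ⟪tens (u (z + √(n * θ) • tens U V))
          (v (z + √(n * θ) • tens U V)), tens U V⟫ ∂(gauss (Mat (p n) (q n))) := by
  set x := √θ with hxdef
  have hx : 0 < x := sqrt_pos.2 hθ
  have hxx : x ^ 2 = θ := sq_sqrt hθ.le
  set g : ℝ → ℝ := fun x => √((a + x ^ 2) * (b + x ^ 2)) / x with hg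
  have hd := hasDerivAt_spikedNorm_sq ha hb hx
  rw [hxx] at hd
  have hsl := (hasDerivAt_iff_tendsto_slope.1 hd).mono_left
    (nhdsWithin_mono x (fun y (hy : y < x) => hy.ne) : nhdsWithin x (Set.Iio x) ≤ _)
  obtain ⟨y, ⟨hy1, hy0⟩, hyx⟩ := ((hsl.eventually
    (lt_mem_nhds (show overlap a b θ - ε / 2 < overlap a b θ by linarith))).and
    (nhdsWithin_le_nhds (lt_mem_nhds hx)) |>.and self_mem_nhdsWithin).exists
  have hyx : y < x := hyx
  rw [slope_comm, slope_def_field, lt_div_iff₀ (by linarith)] at hy1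
  set δ := ε * (x - y) / 6 with hδ
  have hδ0 : 0 < δ := by have := sub_pos.2 hyx; positivity
  have hlim : Tendsto (fun n : ℕ => √(((p n : ℝ) / n + y ^ 2) * ((q n : ℝ) / n + y ^ 2)) / y) atTop
      (nhds (g y)) :=
    ((continuous_sqrt.tendsto _).comp ((hp.add_const _).mul (hq.add_const _))).div_const y
  filter_upwards [eventually_le_integral_bil ha hb hp hq θ hθ hab δ hδ0,
    hlim.eventually (gt_mem_nhds (show g y < g y + δ by linarith)), (tendsto_pred_div ha hp).1,
    (tendsto_pred_div hb hq).1, tendsto_natCast_sqrt_atTop.eventually_ge_atTop (3 / δ),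
    eventually_ge_atTop 1] with n h1 h2 h3 h4 h5 h6
  have hn : (0 : ℝ) < n := by exact_mod_cast h6
  have hsn : 0 < √(n : ℝ) := sqrt_pos.2 hn
  have e1 : √(n * θ) = √(n : ℝ) * x := sqrt_mul hn.le θ
  obtain ⟨u, v, hu, hv, hu1, hv1, huv⟩ := exists_le_overlap h3 h4 (√(n * θ)) (by positivity)
  refine ⟨u, v, hu, hv, hu1, hv1, fun U V hU hV => ?_⟩
  have h7 := huv U V (√(n : ℝ) * y) hU hV (by positivity)
    (by rw [e1]; exact mul_lt_mul_of_pos_left hyx hsn)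
  have h8 := h1 U V hU hV
  have e2 : √((p n + (√(n : ℝ) * y) ^ 2) * (q n + (√(n : ℝ) * y) ^ 2)) / (√(n : ℝ) * y)
      = √(n : ℝ) * (√(((p n : ℝ) / n + y ^ 2) * ((q n : ℝ) / n + y ^ 2)) / y) := by
    have : (p n + (√(n : ℝ) * y) ^ 2) * (q n + (√(n : ℝ) * y) ^ 2)
        = (n : ℝ) ^ 2 * (((p n : ℝ) / n + y ^ 2) * ((q n : ℝ) / n + y ^ 2)) := by
      rw [mul_pow, sq_sqrt hn.le]; field_simp
    rw [this, sqrt_mul (by positivity), sqrt_sq hn.le]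
    field_simp
    rw [sq_sqrt hn.le]
  have e3 : spikedNorm a b θ = g x := by
    simp only [spikedNorm, hg, hxx]
    rw [sqrt_div (by positivity)]
  rw [e2, e1, ← mul_sub] at h7
  rw [e1] at h8 ⊢
  set I := ∫ z, ⟪tens (u (z + (√(n : ℝ) * x) • tens U V)) (v (z + (√(n : ℝ) * x) • tens U V)),
    tens U V⟫ ∂(gauss (Mat (p n) (q n)))
  rw [div_le_iff₀ hδ0] at h5
  rw [e3] at h8
  have h9 : √(n : ℝ) * (g x - g y - 3 * δ) ≤ √(n : ℝ) * ((x - y) * I) := by nlinarith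
  have h10 := le_of_mul_le_mul_left h9 hsn
  have h11 : (x - y) * (overlap a b θ - ε) ≤ (x - y) * I := by
    refine le_trans ?_ h10
    rw [hδ]; linarith
  exact le_of_mul_le_mul_left h11 (sub_pos.2 hyx)

theorem integral_exp_mul_sq_gaussianReal (κ : ℝ) (hκ : κ < 1) :
    ∫ x, exp (κ * x ^ 2 / 2) ∂(ProbabilityTheory.gaussianReal 0 1) = (√(1 - κ))⁻¹ := by
  rw [ProbabilityTheory.integral_gaussianReal_eq_integral_smul one_ne_zero]
  have h : ∀ x : ℝ, ProbabilityTheory.gaussianPDFReal 0 1 x • exp (κ * x ^ 2 / 2)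
      = (√(2 * Real.pi))⁻¹ * exp (-((1 - κ) / 2) * x ^ 2) := fun x => by
    rw [ProbabilityTheory.gaussianPDFReal, smul_eq_mul, mul_assoc, ← exp_add]
    simp only [NNReal.coe_one, mul_one]
    congr 2
    ring
  have h1 : 0 < 1 - κ := by linarith
  simp only [h]
  rw [integral_const_mul, integral_gaussian, ← sqrt_inv, ← sqrt_mul (by positivity), ← sqrt_inv]
  congr 1
  field_simp

theorem exists_isometry_of_norm_eq {E : Type*} [NormedAddCommGroup E] [InnerProductSpace ℝ E]
    [FiniteDimensional ℝ E] {v w : E} (h : ‖v‖ = ‖w‖) : ∃ f : E ≃ₗᵢ[ℝ] E, f v = w :=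
  ⟨(ℝ ∙ (v - w))ᗮ.reflection, Submodule.reflection_sub h⟩

theorem integral_exp_quadratic_gauss {k : ℕ} (b c : ℝ) (hc : 0 < 1 + c) (hbc : 0 < 1 + c - b)
    (e : Vec (k + 1)) (he : ‖e‖ = 1) :
    ∫ g, exp (-c * ‖g‖ ^ 2 / 2 + b * ⟪g, e⟫ ^ 2 / 2) ∂(gauss (Vec (k + 1)))
      = (√(1 + c - b))⁻¹ * (√(1 + c))⁻¹ ^ k := by
  set e0 : Vec (k + 1) := EuclideanSpace.single 0 1 with he0
  obtain ⟨f, hf⟩ := exists_isometry_of_norm_eq (show ‖e0‖ = ‖e‖ by rw [he, he0]; simp)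
  rw [← gauss_map_isometry f,
    integral_map f.continuous.measurable.aemeasurable (by fun_prop)]
  have h1 : ∀ g : Vec (k + 1), exp (-c * ‖f g‖ ^ 2 / 2 + b * ⟪f g, e⟫ ^ 2 / 2)
      = exp (-c * ‖g‖ ^ 2 / 2 + b * g 0 ^ 2 / 2) := fun g => by
    rw [← hf, f.norm_map, f.inner_map_map, he0, EuclideanSpace.inner_single_right]
    simp
  simp only [h1]
  rw [integral_gauss_eq_pi]
  have h2 : ∀ x : Fin (k + 1) → ℝ, exp (-c * ‖WithLp.toLp 2 x‖ ^ 2 / 2 + b * x 0 ^ 2 / 2)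
      = ∏ i, exp ((if i = 0 then b - c else -c) * x i ^ 2 / 2) := fun x => by
    rw [← exp_sum, EuclideanSpace.norm_sq_eq, Fin.sum_univ_succ, Fin.sum_univ_succ]
    simp only [if_true, Fin.succ_ne_zero, if_false, norm_eq_abs, sq_abs]
    rw [mul_add, Finset.mul_sum, add_div, Finset.sum_div]
    congr 1
    ring
  simp only [h2]
  rw [integral_fintype_prod_eq_prod (fun (i : Fin (k + 1)) (y : ℝ) =>
    exp ((if i = 0 then b - c else -c) * y ^ 2 / 2)), Fin.prod_univ_succ]
  simp only [if_true, Fin.succ_ne_zero, if_false]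
  rw [integral_exp_mul_sq_gaussianReal _ (by linarith),
    integral_exp_mul_sq_gaussianReal _ (by linarith), Finset.prod_const, Finset.card_univ,
    Fintype.card_fin]
  congr 3
  · ring
  · ring_nf

theorem integrable_exp_sq_gauss {k : ℕ} (κ : ℝ) (hκ : κ < 1) :
    Integrable (fun g => exp (κ * ‖g‖ ^ 2 / 2)) (gauss (Vec (k + 1))) := by
  refine Integrable.of_integral_ne_zero ?_
  have h := integral_exp_quadratic_gauss 0 (-κ) (by linarith) (by linarith)
    (EuclideanSpace.single (0 : Fin (k + 1)) 1) (by simp)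
  have h1 : 0 < √(1 + -κ) := sqrt_pos.2 (by linarith)
  simp only [neg_neg, zero_mul, zero_div, add_zero, sub_zero] at h
  rw [h]
  positivity

theorem exp_le_integral_exp_sq_gauss {k : ℕ} (κ : ℝ) (hκ : κ < 1) :
    exp (κ * (k + 1) / 2) ≤ ∫ g, exp (κ * ‖g‖ ^ 2 / 2) ∂(gauss (Vec (k + 1))) := by
  have i1 : Integrable (fun g : Vec (k + 1) => ‖g‖ ^ 2) (gauss (Vec (k + 1))) :=
    integrable_norm_pow_gauss 2
  have h1 : ∫ g, ‖g‖ ^ 2 ∂(gauss (Vec (k + 1))) = k + 1 := by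
    simpa using integral_norm_add_sq_gauss (0 : Vec (k + 1))
  set m := κ * (k + 1) / 2
  have i2 : Integrable (fun g : Vec (k + 1) => exp m * (κ / 2) * ‖g‖ ^ 2 + exp m * (1 - m))
      (gauss (Vec (k + 1))) := (i1.const_mul _).add (integrable_const _)
  have h2 : ∫ g, (exp m * (κ / 2) * ‖g‖ ^ 2 + exp m * (1 - m)) ∂(gauss (Vec (k + 1))) = exp m := by
    rw [integral_add (i1.const_mul _) (integrable_const _), integral_const_mul, h1]
    simp only [integral_const, probReal_univ, one_smul, m]
    ring
  rw [← h2]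
  refine integral_mono i2 (integrable_exp_sq_gauss κ hκ) fun g => ?_
  have h3 := add_one_le_exp (κ * ‖g‖ ^ 2 / 2 - m)
  have h4 : exp (κ * ‖g‖ ^ 2 / 2) = exp m * exp (κ * ‖g‖ ^ 2 / 2 - m) := by
    rw [← exp_add]; congr 1; ring
  simp only [h4]
  nlinarith [exp_pos m]

section Sphere

variable {k : ℕ} (S : Measure (Vec (k + 1))) [IsProbabilityMeasure S]
  (h1 : ∀ᵐ x ∂S, ‖x‖ = 1) (hS : ∀ f : Vec (k + 1) ≃ₗᵢ[ℝ] Vec (k + 1), S.map f = S)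

include hS in
omit [IsProbabilityMeasure S] in
theorem integral_inner_eq_of_norm_eq (F : ℝ → ℝ) (hF : Continuous F) {v w : Vec (k + 1)}
    (h : ‖v‖ = ‖w‖) : ∫ x, F ⟪v, x⟫ ∂S = ∫ x, F ⟪w, x⟫ ∂S := by
  obtain ⟨f, hf⟩ := exists_isometry_of_norm_eq h
  conv_rhs => rw [← hS f]
  rw [integral_map f.continuous.measurable.aemeasurable (by fun_prop)]
  simp only [← hf, f.inner_map_map]

include h1 hS in
/-- Quadratic exponential moments of a uniform direction, via Gaussian comparison. -/
theorem integral_exp_sq_inner_le (b η : ℝ) (hb : 0 ≤ b) (hη : 0 < η)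
    (e : Vec (k + 1)) (he : ‖e‖ = 1) :
    exp (-(b - 1 + η) * (k + 1) / 2) * ∫ x, exp (b * (k + 1) * ⟪e, x⟫ ^ 2 / 2) ∂S
      ≤ (√η)⁻¹ * (√(b + η))⁻¹ ^ k := by
  set c := b - 1 + η with hc
  have hint : ∀ G : Vec (k + 1) × Vec (k + 1) → ℝ, Continuous G →
      (∀ g x, ‖x‖ = 1 → G (g, x) ≤ (1 - η) * ‖g‖ ^ 2 / 2) →
      Integrable (fun y => exp (G y)) ((gauss (Vec (k + 1))).prod S) := fun G hG hG' => by
    have hd : Integrable (fun y : Vec (k + 1) × Vec (k + 1) => exp ((1 - η) * ‖y.1‖ ^ 2 / 2))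
        ((gauss (Vec (k + 1))).prod S) := (integrable_exp_sq_gauss _ (by linarith)).comp_fst S
    refine hd.mono' (by fun_prop) ?_
    have : ∀ᵐ y ∂((gauss (Vec (k + 1))).prod S), ‖y.2‖ = 1 :=
      (Measure.quasiMeasurePreserving_snd (μ := gauss (Vec (k + 1))) (ν := S)).ae h1
    filter_upwards [this] with y hy
    rw [norm_of_nonneg (exp_pos _).le]
    exact exp_le_exp.2 (hG' y.1 y.2 hy)
  have iF := hint (fun y => -c * ‖y.1‖ ^ 2 / 2 + b * ‖y.1‖ ^ 2 * ⟪e, y.2⟫ ^ 2 / 2) (by fun_prop)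
    fun g x hx => by
      have : ⟪e, x⟫ ^ 2 ≤ 1 := by
        rw [sq_le_one_iff_abs_le_one]
        simpa [he, hx] using abs_real_inner_le_norm e x
      have := mul_le_mul_of_nonneg_left this (show 0 ≤ b * ‖g‖ ^ 2 by positivity)
      simp only [hc]; linarith
  have iH := hint (fun y => -c * ‖y.1‖ ^ 2 / 2 + b * ⟪y.1, y.2⟫ ^ 2 / 2) (by fun_prop)
    fun g x hx => by
      have : ⟪g, x⟫ ^ 2 ≤ ‖g‖ ^ 2 := by
        rw [sq_le_sq, abs_norm]
        simpa [hx] using abs_real_inner_le_norm g x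
      have := mul_le_mul_of_nonneg_left this hb
      simp only [hc]; linarith
  calc exp (-c * (k + 1) / 2) * ∫ x, exp (b * (k + 1) * ⟪e, x⟫ ^ 2 / 2) ∂S
      = ∫ x, exp ((-c + b * ⟪e, x⟫ ^ 2) * (k + 1) / 2) ∂S := by
        rw [← integral_const_mul]
        refine integral_congr_ae (ae_of_all _ fun x => ?_)
        simp only [← exp_add]
        congr 1; ring
    _ ≤ ∫ x, ∫ g, exp (-c * ‖g‖ ^ 2 / 2 + b * ‖g‖ ^ 2 * ⟪e, x⟫ ^ 2 / 2)
          ∂(gauss (Vec (k + 1))) ∂S := by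
        refine integral_mono_of_nonneg (ae_of_all _ fun x => (exp_pos _).le)
          iF.integral_prod_right ?_
        filter_upwards [h1] with x hx
        have : ⟪e, x⟫ ^ 2 ≤ 1 := by
          rw [sq_le_one_iff_abs_le_one]
          simpa [he, hx] using abs_real_inner_le_norm e x
        have := mul_le_mul_of_nonneg_left this hb
        refine (exp_le_integral_exp_sq_gauss (-c + b * ⟪e, x⟫ ^ 2)
          (by simp only [hc]; linarith)).trans
          (le_of_eq (integral_congr_ae (ae_of_all _ fun g => ?_)))
        simp only
        congr 1; ring
    _ = ∫ g, ∫ x, exp (-c * ‖g‖ ^ 2 / 2 + b * ‖g‖ ^ 2 * ⟪e, x⟫ ^ 2 / 2) ∂S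
          ∂(gauss (Vec (k + 1))) := (integral_integral_swap iF).symm
    _ = ∫ g, ∫ x, exp (-c * ‖g‖ ^ 2 / 2 + b * ⟪g, x⟫ ^ 2 / 2) ∂S ∂(gauss (Vec (k + 1))) := by
        refine integral_congr_ae (ae_of_all _ fun g => ?_)
        have := integral_inner_eq_of_norm_eq S hS
          (fun y => exp (-c * ‖g‖ ^ 2 / 2 + b * y ^ 2 / 2)) (by fun_prop)
          (v := ‖g‖ • e) (w := g) (by rw [norm_smul, he, norm_norm, mul_one])
        simp only at this ⊢
        rw [← this]
        refine integral_congr_ae (ae_of_all _ fun x => ?_)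
        simp only [real_inner_smul_left]
        congr 1; ring
    _ = ∫ x, ∫ g, exp (-c * ‖g‖ ^ 2 / 2 + b * ⟪g, x⟫ ^ 2 / 2) ∂(gauss (Vec (k + 1))) ∂S :=
        integral_integral_swap iH
    _ = ∫ x, (√η)⁻¹ * (√(b + η))⁻¹ ^ k ∂S := by
        refine integral_congr_ae ?_
        filter_upwards [h1] with x hx
        rw [integral_exp_quadratic_gauss b c (by simp only [hc]; linarith)
          (by simp only [hc]; linarith) x hx]
        congr 3 <;> · simp only [hc]; ring_nf
    _ = _ := by simp

include h1 hS in
theorem log_integral_exp_sq_inner_le (T η : ℝ) (hT : 0 < T) (hη : 0 < η)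
    (e : Vec (k + 1)) (he : ‖e‖ = 1) :
    log (∫ x, exp (T * ⟪e, x⟫ ^ 2 / 2) ∂S)
      ≤ (T - (1 - η) * (k + 1)) / 2 - k / 2 * log (T / (k + 1) + η) - log η / 2 := by
  have hk : (0 : ℝ) < k + 1 := by positivity
  have h := integral_exp_sq_inner_le S h1 hS (T / (k + 1)) η (by positivity) hη e he
  rw [div_mul_cancel₀ _ hk.ne'] at h
  have hp : 0 < ∫ x, exp (T * ⟪e, x⟫ ^ 2 / 2) ∂S := by
    refine integral_exp_pos ?_
    refine (integrable_const (exp (T / 2))).mono' (by fun_prop) ?_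
    filter_upwards [h1] with x hx
    rw [norm_of_nonneg (exp_pos _).le]
    refine exp_le_exp.2 ?_
    have : ⟪e, x⟫ ^ 2 ≤ 1 := by
      rw [sq_le_one_iff_abs_le_one]
      simpa [he, hx] using abs_real_inner_le_norm e x
    nlinarith
  have hq : 0 < T / (k + 1) + η := by positivity
  have h2 := log_le_log (by positivity) h
  rw [log_mul (exp_pos _).ne' hp.ne', log_exp, log_mul (by positivity) (by positivity), log_pow,
    log_inv, log_inv, log_sqrt hη.le, log_sqrt hq.le] at h2
  have e1 : -(T / (k + 1) - 1 + η) * (k + 1) / 2 = -(T - (1 - η) * (k + 1)) / 2 := by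
    field_simp; ring
  rw [e1] at h2
  linarith

end Sphere

/-- The law of a uniform point of the unit sphere. -/
structure IsUniformDir {p : ℕ} (S : Measure (Vec p)) : Prop where
  prob : IsProbabilityMeasure S
  norm_eq : ∀ᵐ x ∂S, ‖x‖ = 1
  map_eq : ∀ f : Vec p ≃ₗᵢ[ℝ] Vec p, S.map f = S

/-- Bound on the logarithmic quadratic exponential moment of a uniform direction. -/
def momentBound (η p T : ℝ) : ℝ :=
  (T - (1 - η) * p) / 2 - (p - 1) / 2 * log (T / p + η) - log η / 2

theorem IsUniformDir.log_integral_exp_le {p : ℕ} (hp : 1 ≤ p) {S : Measure (Vec p)}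
    (hS : IsUniformDir S) (T η : ℝ) (hT : 0 < T) (hη : 0 < η) (e : Vec p) (he : ‖e‖ = 1) :
    log (∫ x, exp (T * ⟪e, x⟫ ^ 2 / 2) ∂S) ≤ momentBound η p T := by
  obtain ⟨k, rfl⟩ : ∃ k, p = k + 1 := ⟨p - 1, by omega⟩
  have := hS.prob
  refine (log_integral_exp_sq_inner_le S hS.norm_eq hS.map_eq T η hT hη e he).trans (le_of_eq ?_)
  simp [momentBound]

theorem IsUniformDir.one_le_integral_exp {p : ℕ} {S : Measure (Vec p)} (hS : IsUniformDir S)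
    (T : ℝ) (hT : 0 ≤ T) (e : Vec p) (he : ‖e‖ = 1) :
    Integrable (fun x => exp (T * ⟪e, x⟫ ^ 2 / 2)) S ∧ 1 ≤ ∫ x, exp (T * ⟪e, x⟫ ^ 2 / 2) ∂S := by
  have := hS.prob
  have hi : Integrable (fun x => exp (T * ⟪e, x⟫ ^ 2 / 2)) S := by
    refine (integrable_const (exp (T / 2))).mono' (by fun_prop) ?_
    filter_upwards [hS.norm_eq] with x hx
    rw [norm_of_nonneg (exp_pos _).le]
    refine exp_le_exp.2 ?_
    have : ⟪e, x⟫ ^ 2 ≤ 1 := by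
      rw [sq_le_one_iff_abs_le_one]
      simpa [he, hx] using abs_real_inner_le_norm e x
    nlinarith
  refine ⟨hi, ?_⟩
  calc (1 : ℝ) = ∫ _, 1 ∂S := by simp
    _ ≤ _ := integral_mono (integrable_const 1) hi fun x => one_le_exp (by positivity)

/-- Normalisation to a unit vector, with a fixed unit vector as value at zero. -/
def unitize {p : ℕ} (hp : 1 ≤ p) (x : Vec p) : Vec p :=
  if x = 0 then EuclideanSpace.single ⟨0, hp⟩ 1 else ‖x‖⁻¹ • x

theorem norm_unitize {p : ℕ} (hp : 1 ≤ p) (x : Vec p) : ‖unitize hp x‖ = 1 := by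
  unfold unitize
  split_ifs with h
  · simp
  · rw [norm_smul, norm_inv, norm_norm, inv_mul_cancel₀ (norm_ne_zero_iff.2 h)]

theorem measurable_unitize {p : ℕ} (hp : 1 ≤ p) : Measurable (unitize hp) :=
  Measurable.ite (measurableSet_singleton 0) measurable_const (by fun_prop)

theorem unitize_of_norm_eq_one {p : ℕ} (hp : 1 ≤ p) {x : Vec p} (hx : ‖x‖ = 1) :
    unitize hp x = x := by
  have : x ≠ 0 := fun h => by simp [h] at hx
  simp [unitize, this, hx]

/-- The rank-one direction of a pair. -/
def spikeDir {p q : ℕ} (hp : 1 ≤ p) (hq : 1 ≤ q) (x : Vec p × Vec q) : Mat p q :=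
  tens (unitize hp x.1) (unitize hq x.2)

theorem norm_spikeDir {p q : ℕ} (hp : 1 ≤ p) (hq : 1 ≤ q) (x : Vec p × Vec q) :
    ‖spikeDir hp hq x‖ = 1 := by
  rw [spikeDir, norm_tens, norm_unitize, norm_unitize, one_mul]

theorem measurable_spikeDir {p q : ℕ} (hp : 1 ≤ p) (hq : 1 ≤ q) :
    Measurable (spikeDir hp hq) :=
  continuous_tens.measurable.comp (((measurable_unitize hp).comp measurable_fst).prodMk
    ((measurable_unitize hq).comp measurable_snd))

theorem le_integral_overlap {E : Type*} [NormedAddCommGroup E] [InnerProductSpace ℝ E]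
    [FiniteDimensional ℝ E] [MeasurableSpace E] [BorelSpace E] {Ω : Type*} [MeasurableSpace Ω]
    (μ : Measure Ω) [IsProbabilityMeasure μ] (φ : Ω → E) (hφ : Measurable φ)
    (hφ1 : ∀ x, ‖φ x‖ = 1) (s : ℝ) (M : E → E) (hM : Measurable M) (hM1 : ∀ z, ‖M z‖ ≤ 1) (κ : ℝ)
    (h : ∀ x, κ ≤ ∫ z, ⟪M (z + s • φ x), φ x⟫ ∂(gauss E)) :
    κ ≤ ∫ x, ∫ z, ⟪M (z + s • φ x), φ x⟫ ∂(gauss E) ∂μ := by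
  have hb : ∀ x z, |⟪M z, φ x⟫| ≤ 1 := fun x z => by
    have := abs_real_inner_le_norm (M z) (φ x)
    rw [hφ1, mul_one] at this
    exact this.trans (hM1 z)
  have hi : Integrable (fun y : Ω × E => ⟪M (y.2 + s • φ y.1), φ y.1⟫) (μ.prod (gauss E)) := by
    refine (integrable_const (1 : ℝ)).mono' (Measurable.aestronglyMeasurable ?_)
      (ae_of_all _ fun y => hb _ _)
    exact (hM.comp (by fun_prop)).inner (by fun_prop)
  calc κ = ∫ _, κ ∂μ := by simp
    _ ≤ _ := integral_mono (integrable_const κ) hi.integral_prod_left h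

theorem integral_le_const {Ω : Type*} [MeasurableSpace Ω] (μ : Measure Ω) [IsProbabilityMeasure μ]
    (f : Ω → ℝ) (C : ℝ) (hC : 0 ≤ C) (h : ∀ x, f x ≤ C) : ∫ x, f x ∂μ ≤ C := by
  by_cases hf : Integrable f μ
  · simpa using integral_mono hf (integrable_const C) h
  · rwa [integral_undef hf]

/-- Upper bound on the free entropy from a pair of estimators with given overlap. -/
theorem freeEnt_spikeDir_le {p q : ℕ} (hp : 1 ≤ p) (hq : 1 ≤ q) {S : Measure (Vec p)}
    {S' : Measure (Vec q)} (hS : IsUniformDir S) (hS' : IsUniformDir S') (s η κ : ℝ) (hs : 0 < s)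
    (hη : 0 < η) (u : Mat p q → Vec p) (v : Mat p q → Vec q) (hu : Measurable u)
    (hv : Measurable v) (hu1 : ∀ z, ‖u z‖ = 1) (hv1 : ∀ z, ‖v z‖ = 1)
    (hκ : ∀ (U : Vec p) (V : Vec q), ‖U‖ = 1 → ‖V‖ = 1 →
      κ ≤ ∫ z, ⟪tens (u (z + s • tens U V)) (v (z + s • tens U V)), tens U V⟫ ∂(gauss (Mat p q))) :
    freeEnt (S.prod S') (spikeDir hp hq) s
      ≤ s ^ 2 / 2 - s ^ 2 * κ + (momentBound η p (s ^ 2) + momentBound η q (s ^ 2)) := by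
  have := hS.prob
  have := hS'.prob
  have hφ := measurable_spikeDir hp hq
  have hφ1 := norm_spikeDir hp hq
  set φ := spikeDir hp hq with hφdef
  set M : Mat p q → Mat p q := fun z => tens (u z) (v z) with hM
  have hMm : Measurable M := continuous_tens.measurable.comp (hu.prodMk hv)
  have hM1 : ∀ z, ‖M z‖ = 1 := fun z => by simp only [hM]; rw [norm_tens, hu1, hv1, one_mul]
  have hb : ∀ x z, |⟪M z, φ x⟫| ≤ 1 := fun x z => by
    have := abs_real_inner_le_norm (M z) (φ x)
    rwa [hφ1, hM1, mul_one] at this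
  have htm : Measurable fun y : (Vec p × Vec q) × Mat p q => s ^ 2 * ⟪M y.2, φ y.1⟫ :=
    ((hMm.comp measurable_snd).inner (hφ.comp measurable_fst)).const_mul _
  have h1 := freeEnt_le (S.prod S') φ hφ hφ1 s (fun y => s ^ 2 * ⟪M y.2, φ y.1⟫) htm (s ^ 2)
    fun y => by
      rw [abs_mul, abs_of_nonneg (sq_nonneg s)]
      exact mul_le_of_le_one_right (sq_nonneg s) (hb _ _)
  have h2 := le_integral_overlap (S.prod S') φ hφ hφ1 s M hMm (fun z => (hM1 z).le) κ fun x =>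
    hκ _ _ (norm_unitize hp x.1) (norm_unitize hq x.2)
  have hs2 : 0 < s ^ 2 := by positivity
  have h3 : ∀ z, log (∫ x', exp (s ^ 2 * ⟪M z, φ x'⟫) ∂(S.prod S'))
      ≤ momentBound η p (s ^ 2) + momentBound η q (s ^ 2) := fun z => by
    obtain ⟨i1, g1⟩ := hS.one_le_integral_exp _ hs2.le (u z) (hu1 z)
    obtain ⟨i2, g2⟩ := hS'.one_le_integral_exp _ hs2.le (v z) (hv1 z)
    have i3 : Integrable (fun x => exp (s ^ 2 * ⟪M z, φ x⟫)) (S.prod S') := by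
      refine (integrable_const (exp (s ^ 2))).mono'
        ((measurable_const.inner hφ).const_mul _).exp.aestronglyMeasurable
        (ae_of_all _ fun x => ?_)
      rw [norm_of_nonneg (exp_pos _).le]
      refine exp_le_exp.2 ?_
      nlinarith [(abs_le.1 (hb x z)).2]
    have h4 : ∫ x', exp (s ^ 2 * ⟪M z, φ x'⟫) ∂(S.prod S')
        ≤ (∫ x, exp (s ^ 2 * ⟪u z, x⟫ ^ 2 / 2) ∂S) * ∫ x, exp (s ^ 2 * ⟪v z, x⟫ ^ 2 / 2) ∂S' := by
      rw [← integral_prod_mul]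
      refine integral_mono_ae i3 (i1.mul_prod i2) ?_
      have a1 : ∀ᵐ y ∂(S.prod S'), ‖y.1‖ = 1 :=
        (Measure.quasiMeasurePreserving_fst (μ := S) (ν := S')).ae hS.norm_eq
      have a2 : ∀ᵐ y ∂(S.prod S'), ‖y.2‖ = 1 :=
        (Measure.quasiMeasurePreserving_snd (μ := S) (ν := S')).ae hS'.norm_eq
      filter_upwards [a1, a2] with y h5 h6
      rw [← exp_add]
      refine exp_le_exp.2 ?_
      rw [hφdef, spikeDir, unitize_of_norm_eq_one hp h5, unitize_of_norm_eq_one hq h6, hM,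
        inner_tens]
      nlinarith [mul_nonneg hs2.le (sq_nonneg (⟪u z, y.1⟫ - ⟪v z, y.2⟫))]
    have h5 := log_le_log (integral_exp_pos i3) h4
    rw [log_mul (by linarith) (by linarith)] at h5
    have h6 := hS.log_integral_exp_le hp _ η hs2 hη (u z) (hu1 z)
    have h7 := hS'.log_integral_exp_le hq _ η hs2 hη (v z) (hv1 z)
    linarith
  have h8 : 0 ≤ momentBound η p (s ^ 2) + momentBound η q (s ^ 2) := by
    have h6 := hS.log_integral_exp_le hp _ η hs2 hη (u 0) (hu1 0)
    have h7 := hS'.log_integral_exp_le hq _ η hs2 hη (v 0) (hv1 0)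
    have h9 := log_nonneg (hS.one_le_integral_exp _ hs2.le (u 0) (hu1 0)).2
    have h10 := log_nonneg (hS'.one_le_integral_exp _ hs2.le (v 0) (hv1 0)).2
    linarith
  have h9 : ∫ x, ∫ z, log (∫ x', exp (s ^ 2 * ⟪M (z + s • φ x), φ x'⟫) ∂(S.prod S'))
      ∂(gauss (Mat p q)) ∂(S.prod S') ≤ momentBound η p (s ^ 2) + momentBound η q (s ^ 2) :=
    integral_le_const _ _ _ h8 fun x => integral_le_const _ _ _ h8 fun z => h3 _
  simp only [integral_const_mul] at h1
  have := mul_le_mul_of_nonneg_left h2 hs2.le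
  linarith

theorem eventually_le_increment (G : ℕ → ℝ → ℝ) (f f' : ℝ → ℝ) (x y : ℝ) (hxy : x < y)
    (hd : ∀ z ∈ Set.Icc x y, HasDerivAt f (f' z) z) (hm : MonotoneOn f' (Set.Icc x y))
    (hG : ∀ z ∈ Set.Icc x y, ∀ ε : ℝ, 0 < ε →
      ∀ᶠ n in atTop, ∀ w, z ≤ w → (w - z) * (f' z - ε) ≤ G n w - G n z)
    (ε : ℝ) (hε : 0 < ε) : ∀ᶠ n in atTop, f y - f x - ε ≤ G n y - G n x := by
  have hx : x ∈ Set.Icc x y := ⟨le_rfl, hxy.le⟩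
  have hy : y ∈ Set.Icc x y := ⟨hxy.le, le_rfl⟩
  set D := (y - x) * (f' y - f' x) with hD
  have hD0 : 0 ≤ D := mul_nonneg (by linarith) (by linarith [hm hx hy hxy.le])
  obtain ⟨N, hN⟩ := exists_nat_gt (D / (ε / 2))
  have hN0 : (0 : ℝ) < N := lt_of_le_of_lt (by positivity) hN
  set h := (y - x) / N with hh
  have hh0 : 0 < h := div_pos (by linarith) hN0
  have hhN : h * N = y - x := by rw [hh]; field_simp
  set ε' := ε / (2 * (y - x)) with hε'
  have hε'0 : 0 < ε' := div_pos hε (by linarith)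
  have hmem : ∀ i : ℕ, i ≤ N → x + i * h ∈ Set.Icc x y := fun i hi => by
    have h1 : (i : ℝ) ≤ N := by exact_mod_cast hi
    refine ⟨by have : 0 ≤ (i : ℝ) * h := by positivity
               linarith, ?_⟩
    have := mul_le_mul_of_nonneg_right h1 hh0.le
    linarith
  have key : ∀ i : ℕ, i ≤ N → ∀ᶠ n in atTop,
      f (x + i * h) - f x - h * (f' (x + i * h) - f' x) - ε' * (i * h)
        ≤ G n (x + i * h) - G n x := by
    intro i
    induction i with
    | zero => intro _; simp
    | succ i ih =>
      intro hi
      have m1 := hmem i (by omega)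
      have m2 := hmem (i + 1) hi
      filter_upwards [ih (by omega), hG _ m1 ε' hε'0] with n h1 h2
      push_cast at m2 ⊢
      have e : x + (i + 1) * h = x + i * h + h := by ring
      rw [e] at m2 ⊢
      have h3 := h2 (x + i * h + h) (by linarith)
      obtain ⟨c, hc, hc'⟩ := exists_hasDerivAt_eq_slope f f' (show x + i * h < x + i * h + h by linarith)
        (fun z hz => (hd z ⟨m1.1.trans hz.1, hz.2.trans m2.2⟩).continuousAt.continuousWithinAt)
        (fun z hz => hd z ⟨m1.1.trans hz.1.le, hz.2.le.trans m2.2⟩)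
      have h4 := hm ⟨m1.1.trans hc.1.le, hc.2.le.trans m2.2⟩ m2 hc.2.le
      rw [add_sub_cancel_left, eq_div_iff hh0.ne'] at hc'
      rw [add_sub_cancel_left] at h3
      have h5 := mul_le_mul_of_nonneg_right h4 hh0.le
      linarith
  filter_upwards [key N le_rfl] with n hn
  have e1 : x + N * h = y := by linarith
  rw [e1] at hn
  have h1 : h * (f' y - f' x) ≤ ε / 2 := by
    rw [div_lt_iff₀ (by positivity)] at hN
    have : h * (f' y - f' x) = D / N := by rw [hh, hD]; ring
    rw [this, div_le_iff₀ hN0]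
    linarith
  have h2 : ε' * (N * h) = ε / 2 := by
    rw [mul_comm (N : ℝ), hhN, hε']
    have : y - x ≠ 0 := by linarith
    field_simp
  linarith

/-- The limiting free entropy above the transition `θ² = ab`. -/
def freeLimAux (a b θ : ℝ) : ℝ :=
  θ / 2 - a * b / (2 * θ) + a / 2 * (log a + log (θ + b) - log θ - log (θ + a))
    + b / 2 * (log b + log (θ + a) - log θ - log (θ + b))

/-- The limiting free entropy as a function of the signal strength. -/
def freeLim (a b θ : ℝ) : ℝ := freeLimAux a b (max θ √(a * b))

/-- The limit of `momentBound`. -/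
def momentLim (η a θ : ℝ) : ℝ := (θ - (1 - η) * a) / 2 - a / 2 * log (θ / a + η)

variable {a b : ℝ}

theorem overlap_sq (ha : 0 < a) (hb : 0 < b) {θ : ℝ} (hθ : 0 < θ) :
    overlap a b θ ^ 2 = (1 - a * b / θ ^ 2) ^ 2 * (θ / (θ + a) * (θ / (θ + b))) := by
  rw [overlap, div_pow, mul_pow, sq_sqrt (by positivity)]
  field_simp
  ring

theorem hasDerivAt_freeLimAux (ha : 0 < a) (hb : 0 < b) {θ : ℝ} (hθ : 0 < θ) :
    HasDerivAt (freeLimAux a b) (overlap a b θ ^ 2 / 2) θ := by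
  have hid := hasDerivAt_id θ
  have hA : HasDerivAt (fun x => log (x + a)) (1 / (θ + a)) θ :=
    (hid.add_const a).log (by simp only [id]; positivity)
  have hB : HasDerivAt (fun x => log (x + b)) (1 / (θ + b)) θ :=
    (hid.add_const b).log (by simp only [id]; positivity)
  have hL : HasDerivAt (fun x => log x) (1 / θ) θ := by
    simpa using hasDerivAt_log hθ.ne'
  have h1 : HasDerivAt (fun x : ℝ => x / 2) (1 / 2) θ := hid.div_const 2
  have h2 : HasDerivAt (fun x : ℝ => a * b / (2 * x)) (-(a * b * 2) / (2 * θ) ^ 2) θ := by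
    refine ((hasDerivAt_const θ (a * b)).fun_div (hid.const_mul 2) (by simp only [id]; positivity)).congr_deriv ?_
    simp
  have h3 : HasDerivAt (fun x => a / 2 * (log a + log (x + b) - log x - log (x + a)))
      (a / 2 * (1 / (θ + b) - 1 / θ - 1 / (θ + a))) θ :=
    (((hB.const_add _).fun_sub hL).fun_sub hA).const_mul _
  have h4 : HasDerivAt (fun x => b / 2 * (log b + log (x + a) - log x - log (x + b)))
      (b / 2 * (1 / (θ + a) - 1 / θ - 1 / (θ + b))) θ :=
    (((hA.const_add _).fun_sub hL).fun_sub hB).const_mul _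
  refine (((h1.fun_sub h2).fun_add h3).fun_add h4).congr_deriv ?_
  rw [overlap_sq ha hb hθ]
  field_simp
  ring

theorem overlap_nonneg {θ : ℝ} (hθ : 0 < θ) (h : a * b ≤ θ ^ 2) : 0 ≤ overlap a b θ :=
  div_nonneg (by linarith) (by positivity)

theorem le_overlap (ha : 0 < a) (hb : 0 < b) {θ : ℝ} (hθ : 0 < θ) (h : a * b ≤ θ ^ 2) :
    (θ ^ 2 - a * b) / (θ * (θ + (a + b) / 2)) ≤ overlap a b θ := by
  have h1 : √((a + θ) * (b + θ)) ≤ θ + (a + b) / 2 := by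
    rw [sqrt_le_left (by positivity)]
    nlinarith [sq_nonneg (a - b)]
  have h2 : 0 < √((a + θ) * (b + θ)) := sqrt_pos.2 (by positivity)
  unfold overlap
  have : 0 ≤ θ ^ 2 - a * b := by linarith
  gcongr

theorem overlap_le_one (ha : 0 < a) (hb : 0 < b) {θ : ℝ} (hθ : 0 < θ) : overlap a b θ ≤ 1 := by
  have h1 : θ ≤ √((a + θ) * (b + θ)) := by
    refine le_sqrt_of_sq_le ?_
    nlinarith [mul_pos ha hb, mul_pos ha hθ, mul_pos hb hθ]
  refine div_le_one_of_le₀ ?_ (by positivity)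
  nlinarith [mul_pos ha hb, mul_le_mul_of_nonneg_left h1 hθ.le]

theorem overlap_sq_mono (ha : 0 < a) (hb : 0 < b) {x y : ℝ} (hx : 0 < x) (h : a * b ≤ x ^ 2)
    (hxy : x ≤ y) : overlap a b x ^ 2 ≤ overlap a b y ^ 2 := by
  have hy : 0 < y := hx.trans_le hxy
  rw [overlap_sq ha hb hx, overlap_sq ha hb hy]
  have h1 : a * b / y ^ 2 ≤ a * b / x ^ 2 := by gcongr
  have h2 : 0 ≤ 1 - a * b / x ^ 2 := by
    rw [sub_nonneg, div_le_one (by positivity)]; exact h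
  have h3 : ∀ c : ℝ, 0 < c → x / (x + c) ≤ y / (y + c) := fun c hc => by
    rw [div_le_div_iff₀ (by positivity) (by positivity)]
    nlinarith
  have h4 := h3 a ha
  have h5 := h3 b hb
  gcongr

theorem freeLimAux_sqrt (ha : 0 < a) (hb : 0 < b) : freeLimAux a b √(a * b) = 0 := by
  have hc : 0 < √(a * b) := sqrt_pos.2 (by positivity)
  have hs : √(a * b) ^ 2 = a * b := sq_sqrt (by positivity)
  set c := √(a * b)
  unfold freeLimAux
  have h1 : log a + log (c + b) = log c + log (c + a) := by
    rw [← log_mul ha.ne' (by positivity), ← log_mul hc.ne' (by positivity)]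
    congr 1
    linarith
  have h2 : log b + log (c + a) = log c + log (c + b) := by
    rw [← log_mul hb.ne' (by positivity), ← log_mul hc.ne' (by positivity)]
    congr 1
    linarith
  rw [h1, h2, ← hs]
  field_simp
  ring

theorem continuous_freeLim (ha : 0 < a) (hb : 0 < b) : Continuous (freeLim a b) := by
  have hc : 0 < √(a * b) := sqrt_pos.2 (by positivity)
  refine continuous_iff_continuousAt.2 fun θ => ?_
  have h := (hasDerivAt_freeLimAux ha hb (lt_max_of_lt_right hc : 0 < max θ √(a * b))).continuousAt
  exact h.comp (f := fun θ => max θ √(a * b)) (by fun_prop)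

/-- The estimator bound is asymptotically sharp at large signal strength. -/
theorem estimator_bound_le (ha : 0 < a) (hb : 0 < b) {θ : ℝ} (hθ : 0 < θ) (h : a * b ≤ θ ^ 2) :
    θ / 2 - θ * overlap a b θ + (momentLim (1 / θ) a θ + momentLim (1 / θ) b θ)
      ≤ freeLimAux a b θ + ((a + b) / 2 + 3 * (a * b) / 2 + (a - b) ^ 2 / 2) / θ := by
  have h1 : θ - θ * overlap a b θ ≤ (a + b) / 2 + a * b / θ := by
    have h2 := mul_le_mul_of_nonneg_left (le_overlap ha hb hθ h) hθ.le
    have h3 : θ * ((θ ^ 2 - a * b) / (θ * (θ + (a + b) / 2)))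
        = θ - ((a + b) / 2 * θ + a * b) / (θ + (a + b) / 2) := by field_simp; ring
    have h4 : ((a + b) / 2 * θ + a * b) / (θ + (a + b) / 2) ≤ (a + b) / 2 + a * b / θ := by
      rw [div_le_iff₀ (by positivity)]
      have : ((a + b) / 2 + a * b / θ) * (θ + (a + b) / 2)
        = (a + b) / 2 * θ + a * b + ((a + b) ^ 2 / 4 + a * b / θ * ((a + b) / 2)) := by
        field_simp; ring
      rw [this]
      have : 0 ≤ (a + b) ^ 2 / 4 + a * b / θ * ((a + b) / 2) := by positivity
      linarith
    linarith
  have hlog : ∀ c : ℝ, 0 < c → log θ ≤ log (θ / c + 1 / θ) + log c := fun c hc => by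
    rw [← log_mul (by positivity) hc.ne']
    refine log_le_log hθ ?_
    have : (θ / c + 1 / θ) * c = θ + c / θ := by field_simp
    rw [this]
    have : 0 ≤ c / θ := by positivity
    linarith
  have hdiff : ∀ c d : ℝ, 0 < c → 0 < d → log (θ + d) - log (θ + c) ≤ (d - c) / (θ + c) :=
    fun c d hc hd => by
      rw [← log_div (by positivity) (by positivity)]
      refine (log_le_sub_one_of_pos (by positivity)).trans (le_of_eq ?_)
      field_simp; ring
  have hratio : (b - a) / 2 * (log (θ + b) - log (θ + a)) ≤ (a - b) ^ 2 / 2 / θ := by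
    rcases le_total a b with hab | hab
    · have := mul_le_mul_of_nonneg_left (hdiff a b ha hb) (show 0 ≤ (b - a) / 2 by linarith)
      refine this.trans ?_
      have e : (b - a) / 2 * ((b - a) / (θ + a)) = (a - b) ^ 2 / 2 / (θ + a) := by ring
      rw [e]
      gcongr
      linarith
    · have := mul_le_mul_of_nonneg_left (hdiff b a hb ha) (show 0 ≤ (a - b) / 2 by linarith)
      have e : (a - b) / 2 * ((a - b) / (θ + b)) = (a - b) ^ 2 / 2 / (θ + b) := by ring
      rw [e] at this
      have h5 : (a - b) ^ 2 / 2 / (θ + b) ≤ (a - b) ^ 2 / 2 / θ := by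
        gcongr
        linarith
      linarith
  have g1 := mul_le_mul_of_nonneg_left (hlog a ha) (half_pos ha).le
  have g2 := mul_le_mul_of_nonneg_left (hlog b hb) (half_pos hb).le
  have e1 : ((a + b) / 2 + 3 * (a * b) / 2 + (a - b) ^ 2 / 2) / θ
      = (a + b) / 2 * (1 / θ) + 3 / 2 * (a * b / θ) + (a - b) ^ 2 / 2 / θ := by ring
  have e2 : a * b / (2 * θ) = a * b / θ / 2 := by field_simp
  rw [e1]
  unfold momentLim freeLimAux
  rw [e2]
  linarith

/-- Identification of the limit from an incremental lower bound and an upper bound. -/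
theorem tendsto_freeLim_of_bounds (ha : 0 < a) (hb : 0 < b) (G : ℕ → ℝ → ℝ)
    (h0 : ∀ᶠ n in atTop, ∀ θ, 0 ≤ θ → 0 ≤ G n θ)
    (hmono : ∀ᶠ n in atTop, ∀ θ θ', 0 ≤ θ → θ ≤ θ' → G n θ ≤ G n θ')
    (hinc : ∀ θ, 0 < θ → a * b < θ ^ 2 → ∀ ε : ℝ, 0 < ε → ∀ᶠ n in atTop, ∀ θ', θ ≤ θ' →
      (θ' - θ) * (overlap a b θ ^ 2 / 2 - ε) ≤ G n θ' - G n θ)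
    (hup : ∀ θ, 0 < θ → a * b < θ ^ 2 → ∀ η : ℝ, 0 < η → ∀ ε : ℝ, 0 < ε → ∀ᶠ n in atTop,
      G n θ ≤ θ / 2 - θ * overlap a b θ + (momentLim η a θ + momentLim η b θ) + ε)
    (θ : ℝ) (hθ : 0 < θ) (t : ℕ → ℝ) (ht : Tendsto t atTop (nhds θ)) :
    Tendsto (fun n => G n (t n)) atTop (nhds (freeLim a b θ)) := by
  set c := √(a * b) with hc
  have hc0 : 0 < c := sqrt_pos.2 (by positivity)
  have hcs : c ^ 2 = a * b := sq_sqrt (by positivity)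
  have hgt : ∀ x, c < x → 0 < x ∧ a * b < x ^ 2 := fun x hx =>
    ⟨hc0.trans hx, by rw [← hcs]; exact pow_lt_pow_left₀ hx hc0.le two_ne_zero⟩
  have hF : ∀ x, c ≤ x → freeLim a b x = freeLimAux a b x := fun x hx => by
    rw [freeLim, max_eq_left hx]
  have hcont := continuous_freeLim ha hb
  have hincr : ∀ x y, c < x → x < y → ∀ ε : ℝ, 0 < ε →
      ∀ᶠ n in atTop, freeLim a b y - freeLim a b x - ε ≤ G n y - G n x := fun x y hx hxy ε hε => by
    rw [hF x hx.le, hF y (hx.trans hxy).le]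
    refine eventually_le_increment G (freeLimAux a b) (fun θ => overlap a b θ ^ 2 / 2) x y hxy
      (fun z hz => hasDerivAt_freeLimAux ha hb (hgt z (hx.trans_le hz.1)).1)
      (fun z hz w hw hzw => ?_) (fun z hz ε hε => ?_) ε hε
    · have := hgt z (hx.trans_le hz.1)
      have := overlap_sq_mono ha hb this.1 this.2.le hzw
      simp only
      linarith
    · have := hgt z (hx.trans_le hz.1)
      exact hinc z this.1 this.2 ε hε
  have hupper : ∀ x, c < x → ∀ ε : ℝ, 0 < ε → ∀ᶠ n in atTop, G n x ≤ freeLim a b x + ε :=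
    fun x hx ε hε => by
    set C := (a + b) / 2 + 3 * (a * b) / 2 + (a - b) ^ 2 / 2 with hC
    have hC0 : 0 < C := by positivity
    set y := max (x + 1) (C / (ε / 3)) with hy
    have hxy : x < y := lt_of_lt_of_le (by linarith) (le_max_left _ _)
    have hy0 := hgt y (hx.trans hxy)
    have hCy : C / y ≤ ε / 3 := by
      rw [div_le_iff₀ hy0.1]
      have := le_max_right (x + 1) (C / (ε / 3))
      rw [← hy, div_le_iff₀ (by positivity)] at this
      linarith
    filter_upwards [hup y hy0.1 hy0.2 (1 / y) (one_div_pos.2 hy0.1) (ε / 3) (by positivity),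
      hincr x y hx hxy (ε / 3) (by positivity)] with n h1 h2
    have h3 := estimator_bound_le ha hb hy0.1 hy0.2.le
    rw [hF y (hx.trans hxy).le] at h2
    linarith
  have hlower : ∀ x, c < x → ∀ ε : ℝ, 0 < ε → ∀ᶠ n in atTop, freeLim a b x - ε ≤ G n x :=
    fun x hx ε hε => by
    have h1 : freeLim a b c < ε / 2 := by
      rw [hF c le_rfl, freeLimAux_sqrt ha hb]; positivity
    have e1 : ∀ᶠ y in nhdsWithin c (Set.Ioi c), freeLim a b y < ε / 2 :=
      nhdsWithin_le_nhds ((hcont.tendsto c).eventually (gt_mem_nhds h1))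
    have e2 : ∀ᶠ y in nhdsWithin c (Set.Ioi c), y < x := nhdsWithin_le_nhds (gt_mem_nhds hx)
    obtain ⟨y, ⟨hy1, hy2⟩, hy3⟩ := ((e1.and e2).and self_mem_nhdsWithin).exists
    filter_upwards [h0, hincr y x hy3 hy2 (ε / 2) (by positivity)] with n h2 h3
    have := h2 y (hgt y hy3).1.le
    linarith
  rw [Metric.tendsto_nhds]
  intro ε hε
  have hU : ∀ᶠ n in atTop, G n (t n) < freeLim a b θ + ε := by
    set x := max θ c with hx
    have hx1 : freeLim a b x < freeLim a b θ + ε / 2 := by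
      have : freeLim a b x = freeLim a b θ := by rw [freeLim, freeLim, hx, max_assoc, max_self]
      linarith
    have e1 : ∀ᶠ y in nhdsWithin x (Set.Ioi x), freeLim a b y < freeLim a b θ + ε / 2 :=
      nhdsWithin_le_nhds ((hcont.tendsto x).eventually (gt_mem_nhds hx1))
    obtain ⟨y, hy1, hy3⟩ := (e1.and self_mem_nhdsWithin).exists
    have hy3 : x < y := hy3
    filter_upwards [hupper y ((le_max_right _ _).trans_lt hy3) (ε / 2) (by positivity), hmono,
      ht.eventually (gt_mem_nhds ((le_max_left _ _).trans_lt hy3)),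
      ht.eventually (lt_mem_nhds hθ)] with n h1 h2 h3 h4
    have := h2 (t n) y h4.le h3.le
    linarith
  have hL : ∀ᶠ n in atTop, freeLim a b θ - ε < G n (t n) := by
    rcases le_or_gt θ c with hθc | hθc
    · have : freeLim a b θ = 0 := by rw [freeLim, max_eq_right hθc, freeLimAux_sqrt ha hb]
      filter_upwards [h0, ht.eventually (lt_mem_nhds hθ)] with n h1 h2
      have := h1 (t n) h2.le
      linarith
    · have e1 : ∀ᶠ y in nhdsWithin θ (Set.Iio θ), freeLim a b θ - ε / 2 < freeLim a b y :=
        nhdsWithin_le_nhds ((hcont.tendsto θ).eventually (lt_mem_nhds (by linarith)))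
      have e2 : ∀ᶠ y in nhdsWithin θ (Set.Iio θ), c < y := nhdsWithin_le_nhds (lt_mem_nhds hθc)
      obtain ⟨y, ⟨hy1, hy2⟩, hy3⟩ := ((e1.and e2).and self_mem_nhdsWithin).exists
      have hy3 : y < θ := hy3
      filter_upwards [hlower y hy2 (ε / 2) (by positivity), hmono,
        ht.eventually (lt_mem_nhds hy3)] with n h1 h2 h3
      have := h2 y (t n) (hgt y hy2).1.le h3.le
      linarith
  filter_upwards [hU, hL] with n h1 h2
  rw [Real.dist_eq, abs_lt]
  constructor <;> linarith

/-- Free entropy per unit size at signal strength `θ`. -/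
def spikedFreeEnt {p q : ℕ} (S : Measure (Vec p)) (S' : Measure (Vec q)) (n : ℕ) (θ : ℝ) : ℝ :=
  if h : 1 ≤ p ∧ 1 ≤ q then freeEnt (S.prod S') (spikeDir h.1 h.2) √(n * θ) / n else 0

theorem tendsto_momentBound {p : ℕ → ℕ} {a : ℝ} (ha : 0 < a)
    (hp : Tendsto (fun n => (p n : ℝ) / n) atTop (nhds a)) (η θ : ℝ) (hη : 0 < η) (hθ : 0 < θ) :
    Tendsto (fun n : ℕ => momentBound η (p n) (n * θ) / n) atTop (nhds (momentLim η a θ)) := by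
  have h0 : Tendsto (fun n : ℕ => (n : ℝ)⁻¹) atTop (nhds 0) := tendsto_inv_atTop_nhds_zero_nat
  have h1 : Tendsto (fun n : ℕ => log (θ / ((p n : ℝ) / n) + η)) atTop (nhds (log (θ / a + η))) :=
    ((tendsto_const_nhds.div hp ha.ne').add_const η).log (by positivity)
  have h2 : Tendsto (fun n : ℕ => (θ - (1 - η) * ((p n : ℝ) / n)) / 2
      - ((p n : ℝ) / n - (n : ℝ)⁻¹) / 2 * log (θ / ((p n : ℝ) / n) + η)
      - log η / 2 * (n : ℝ)⁻¹) atTop (nhds (momentLim η a θ)) := by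
    have := (((tendsto_const_nhds (x := θ)).sub (hp.const_mul (1 - η))).div_const 2).sub
      (((hp.sub h0).div_const 2).mul h1) |>.sub (h0.const_mul (log η / 2))
    simpa [momentLim] using this
  refine h2.congr' ?_
  filter_upwards [eventually_ge_atTop 1] with n hn
  have hn' : (0 : ℝ) < n := by exact_mod_cast hn
  have e : θ / ((p n : ℝ) / n) = n * θ / p n := by rw [div_div_eq_mul_div, mul_comm]
  rw [momentBound, e]
  field_simp

theorem tendsto_spikedFreeEnt {p q : ℕ → ℕ} {a b : ℝ} (ha : 0 < a) (hb : 0 < b)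
    (hp : Tendsto (fun n => (p n : ℝ) / n) atTop (nhds a))
    (hq : Tendsto (fun n => (q n : ℝ) / n) atTop (nhds b))
    (S : (n : ℕ) → Measure (Vec (p n))) (S' : (n : ℕ) → Measure (Vec (q n)))
    (hS : ∀ᶠ n in atTop, IsUniformDir (S n)) (hS' : ∀ᶠ n in atTop, IsUniformDir (S' n))
    (θ : ℝ) (hθ : 0 < θ) (t : ℕ → ℝ) (ht : Tendsto t atTop (nhds θ)) :
    Tendsto (fun n => spikedFreeEnt (S n) (S' n) n (t n)) atTop (nhds (freeLim a b θ)) := by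
  have hp1 := (tendsto_pred_div ha hp).1
  have hq1 := (tendsto_pred_div hb hq).1
  refine tendsto_freeLim_of_bounds ha hb (fun n θ => spikedFreeEnt (S n) (S' n) n θ) ?_ ?_ ?_ ?_
    θ hθ t ht
  · filter_upwards [hp1, hq1, hS, hS'] with n h1 h2 h3 h4 θ _
    have := h3.prob
    have := h4.prob
    rw [spikedFreeEnt, dif_pos ⟨h1, h2⟩]
    exact div_nonneg (freeEnt_nonneg _ _ (measurable_spikeDir h1 h2) (norm_spikeDir h1 h2) _
      (sqrt_nonneg _)) (Nat.cast_nonneg n)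
  · filter_upwards [hp1, hq1, hS, hS'] with n h1 h2 h3 h4 θ θ' _ hle
    have := h3.prob
    have := h4.prob
    simp only [spikedFreeEnt, dif_pos (And.intro h1 h2)]
    have := freeEnt_mono ((S n).prod (S' n)) _ (measurable_spikeDir h1 h2) (norm_spikeDir h1 h2)
      (√(n * θ)) (√(n * θ')) (sqrt_nonneg _) (sqrt_le_sqrt (by gcongr))
    gcongr
  · intro θ hθ hab ε hε
    filter_upwards [hp1, hq1, hS, hS', eventually_le_overlap ha hb hp hq θ hθ hab ε hε,
      eventually_ge_atTop 1] with n h1 h2 h3 h4 h5 h6 θ' hle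
    have := h3.prob
    have := h4.prob
    have hn : (0 : ℝ) < n := by exact_mod_cast h6
    obtain ⟨u, v, hu, hv, hu1, hv1, huv⟩ := h5
    have hφ := measurable_spikeDir h1 h2
    have hφ1 := norm_spikeDir h1 h2
    set M : Mat (p n) (q n) → Mat (p n) (q n) := fun z => tens (u z) (v z) with hM
    have hMm : Measurable M := continuous_tens.measurable.comp (hu.prodMk hv)
    have hM1 : ∀ z, ‖M z‖ ≤ 1 := fun z => by simp only [hM]; rw [norm_tens, hu1, hv1, one_mul]
    set c := overlap a b θ with hc
    have hc0 : 0 ≤ c := overlap_nonneg hθ hab.le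
    have hc1 : c ≤ 1 := overlap_le_one ha hb hθ
    have h7 := le_integral_overlap ((S n).prod (S' n)) _ hφ hφ1 √(n * θ) M hMm hM1 (c - ε)
      fun x => huv _ _ (norm_unitize h1 x.1) (norm_unitize h2 x.2)
    have h8 := freeEnt_increment ((S n).prod (S' n)) _ hφ hφ1 √(n * θ) √(n * θ')
      √(n * (θ' - θ)) c (sqrt_pos.2 (mul_pos hn (hθ.trans_le hle)))
      (by rw [sq_sqrt (mul_nonneg hn.le (hθ.le.trans hle)), sq_sqrt (mul_nonneg hn.le hθ.le),
            sq_sqrt (mul_nonneg hn.le (sub_nonneg.2 hle))]; ring) M hMm hM1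
    rw [sq_sqrt (mul_nonneg hn.le (sub_nonneg.2 hle))] at h8
    simp only [spikedFreeEnt, dif_pos (And.intro h1 h2)]
    rw [← sub_div, le_div_iff₀ hn]
    have h9 : c ^ 2 / 2 - ε ≤ c * (∫ x, ∫ z, ⟪M (z + √(n * θ) • spikeDir h1 h2 x),
        spikeDir h1 h2 x⟫ ∂(gauss (Mat (p n) (q n))) ∂((S n).prod (S' n))) - c ^ 2 / 2 := by
      have := mul_le_mul_of_nonneg_left h7 hc0
      nlinarith
    have h10 := mul_le_mul_of_nonneg_left h9 (mul_nonneg hn.le (sub_nonneg.2 hle))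
    linarith
  · intro θ hθ hab η hη ε hε
    have hε' : 0 < ε / (3 * (θ + 1)) := by positivity
    have m1 := (tendsto_momentBound ha hp η θ hη hθ).eventually
      (gt_mem_nhds (show momentLim η a θ < momentLim η a θ + ε / 3 by linarith))
    have m2 := (tendsto_momentBound hb hq η θ hη hθ).eventually
      (gt_mem_nhds (show momentLim η b θ < momentLim η b θ + ε / 3 by linarith))
    filter_upwards [hp1, hq1, hS, hS', eventually_le_overlap ha hb hp hq θ hθ hab _ hε',
      eventually_ge_atTop 1, m1, m2] with n h1 h2 h3 h4 h5 h6 h7 h8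
    have hn : (0 : ℝ) < n := by exact_mod_cast h6
    obtain ⟨u, v, hu, hv, hu1, hv1, huv⟩ := h5
    have h9 := freeEnt_spikeDir_le h1 h2 h3 h4 √(n * θ) η _ (by positivity) hη u v hu hv hu1 hv1 huv
    rw [sq_sqrt (by positivity)] at h9
    rw [spikedFreeEnt, dif_pos ⟨h1, h2⟩, div_le_iff₀ hn]
    rw [div_lt_iff₀ hn] at h7 h8
    have h10 : θ * (ε / (3 * (θ + 1))) ≤ ε / 3 := by
      rw [mul_div_assoc', div_le_div_iff₀ (by positivity) (by positivity)]
      nlinarith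
    have h11 := mul_le_mul_of_nonneg_left h10 hn.le
    linarith

/-- The replica-symmetric potential in the overlap ratios `A = mᵤ / ρᵤ`, `B = mᵥ / ρᵥ`. -/
def ratioPotential (a b θ A B : ℝ) : ℝ :=
  θ / 2 * (1 - A) * (1 - B) + a / 2 * log (1 + θ * B / a) + b / 2 * log (1 + θ * A / b)

/-- The potential along `B = θ A / (b + θ A)`, in the variable `y = 1 / (b + θ A)`. -/
def reducedPotential (a b θ y : ℝ) : ℝ :=
  b / 2 * ((θ + b) * y - 1) + a / 2 * (log (a + θ - θ * b * y) - log a)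
    - b / 2 * (log y + log b)

theorem hasDerivAt_reducedPotential {a b θ y : ℝ} (ha : 0 < a) (hb : 0 < b) (hθ : 0 < θ)
    (hy : 0 < y) (hyb : b * y ≤ 1) :
    HasDerivAt (reducedPotential a b θ)
      (b / 2 * ((1 - b * y) * (θ * (θ + b) * y - (a + θ)) / (y * (a + θ - θ * b * y)))) y := by
  have hd : 0 < a + θ - θ * b * y := by nlinarith
  have h1 : HasDerivAt (fun y : ℝ => (θ + b) * y - 1) (θ + b) y := by
    simpa using ((hasDerivAt_id y).const_mul (θ + b)).sub_const 1
  have h2 : HasDerivAt (fun y : ℝ => a + θ - θ * b * y) (-(θ * b)) y := by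
    simpa using ((hasDerivAt_id y).const_mul (θ * b)).const_sub (a + θ)
  have h3 := (h2.log hd.ne').sub_const (log a)
  have h4 := (Real.hasDerivAt_log hy.ne').add_const (log b)
  refine (((h1.const_mul (b / 2)).fun_add (h3.const_mul (a / 2))).fun_sub
    (h4.const_mul (b / 2))).congr_deriv ?_
  obtain ⟨D, hD⟩ : ∃ D, D = a + θ - θ * b * y := ⟨_, rfl⟩
  rw [← hD] at hd ⊢
  field_simp
  rw [hD]
  ring

theorem reducedPotential_le {a b θ y₀ y : ℝ} (ha : 0 < a) (hb : 0 < b) (hθ : 0 < θ)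
    (hy₀ : 0 < y₀) (hy₀b : b * y₀ ≤ 1) (hy : 0 < y) (hyb : b * y ≤ 1)
    (hle : θ * (θ + b) * y₀ ≤ a + θ) (hge : b * y₀ = 1 ∨ a + θ ≤ θ * (θ + b) * y₀) :
    reducedPotential a b θ y₀ ≤ reducedPotential a b θ y := by
  have hpos : ∀ x, 0 < x → b * x ≤ 1 → 0 < x * (a + θ - θ * b * x) := fun x hx hxb =>
    mul_pos hx (by nlinarith)
  rcases le_total y y₀ with h | h
  · refine antitoneOn_of_deriv_nonpos (convex_Icc y y₀) ?_ ?_ ?_ (Set.left_mem_Icc.2 h)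
      (Set.right_mem_Icc.2 h) h
    · intro x hx
      exact (hasDerivAt_reducedPotential ha hb hθ (hy.trans_le hx.1)
        (by nlinarith [hx.2])).continuousAt.continuousWithinAt
    · intro x hx
      rw [interior_Icc] at hx
      exact (hasDerivAt_reducedPotential ha hb hθ (hy.trans hx.1)
        (by nlinarith [hx.2])).differentiableAt.differentiableWithinAt
    · intro x hx
      rw [interior_Icc] at hx
      have hx0 := hy.trans hx.1
      have hxb : b * x ≤ 1 := by nlinarith [hx.2]
      rw [(hasDerivAt_reducedPotential ha hb hθ hx0 hxb).deriv]
      refine mul_nonpos_of_nonneg_of_nonpos (by positivity)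
        (div_nonpos_of_nonpos_of_nonneg ?_ (hpos x hx0 hxb).le)
      refine mul_nonpos_of_nonneg_of_nonpos (by linarith) ?_
      have : θ * (θ + b) * x ≤ θ * (θ + b) * y₀ :=
        mul_le_mul_of_nonneg_left hx.2.le (by positivity)
      linarith
  · rcases hge with hge | hge
    · have : y = y₀ := le_antisymm (by nlinarith) h
      rw [this]
    refine monotoneOn_of_deriv_nonneg (convex_Icc y₀ y) ?_ ?_ ?_ (Set.left_mem_Icc.2 h)
      (Set.right_mem_Icc.2 h) h
    · intro x hx
      exact (hasDerivAt_reducedPotential ha hb hθ (hy₀.trans_le hx.1)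
        (by nlinarith [hx.2])).continuousAt.continuousWithinAt
    · intro x hx
      rw [interior_Icc] at hx
      exact (hasDerivAt_reducedPotential ha hb hθ (hy₀.trans hx.1)
        (by nlinarith [hx.2])).differentiableAt.differentiableWithinAt
    · intro x hx
      rw [interior_Icc] at hx
      have hx0 := hy₀.trans hx.1
      have hxb : b * x ≤ 1 := by nlinarith [hx.2]
      rw [(hasDerivAt_reducedPotential ha hb hθ hx0 hxb).deriv]
      refine mul_nonneg (by positivity) (div_nonneg ?_ (hpos x hx0 hxb).le)
      refine mul_nonneg (by linarith) ?_
      have : θ * (θ + b) * y₀ ≤ θ * (θ + b) * x :=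
        mul_le_mul_of_nonneg_left hx.1.le (by positivity)
      linarith

theorem ratioPotential_eq_reducedPotential {a b θ A : ℝ} (ha : 0 < a) (hb : 0 < b) (hθ : 0 < θ)
    (hA : 0 ≤ A) :
    ratioPotential a b θ A (θ * A / (b + θ * A)) = reducedPotential a b θ (1 / (b + θ * A)) := by
  have hw : 0 < b + θ * A := by positivity
  have e1 : 1 + θ * (θ * A / (b + θ * A)) / a = (a + θ - θ * b * (1 / (b + θ * A))) / a := by
    field_simp; ring
  have e2 : 1 + θ * A / b = (b + θ * A) / b := by field_simp
  have hd : 0 < a + θ - θ * b * (1 / (b + θ * A)) := by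
    have : b * (1 / (b + θ * A)) ≤ 1 := by
      rw [mul_one_div, div_le_one hw]; nlinarith [mul_nonneg hθ.le hA]
    nlinarith
  unfold ratioPotential reducedPotential
  rw [e1, e2, log_div hd.ne' ha.ne', log_div hw.ne' hb.ne', one_div, log_inv]
  have : θ / 2 * (1 - A) * (1 - θ * A / (b + θ * A))
      = b / 2 * ((θ + b) * (b + θ * A)⁻¹ - 1) := by field_simp; ring
  rw [this]
  ring

theorem ratioPotential_le {a b θ A₀ B₀ B : ℝ} (ha : 0 < a) (hθ : 0 < θ)
    (hA : (1 - A₀) * (a + θ * B₀) = a) (hB₀ : 0 ≤ B₀) (hB : 0 ≤ B) :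
    ratioPotential a b θ A₀ B ≤ ratioPotential a b θ A₀ B₀ := by
  have h0 : 0 < a + θ * B₀ := by positivity
  have h1 : 0 < a + θ * B := by positivity
  have hA' : 1 - A₀ = a / (a + θ * B₀) := by rw [eq_div_iff h0.ne', hA]
  have e : 1 + θ * B / a = (1 + θ * B₀ / a) * ((a + θ * B) / (a + θ * B₀)) := by field_simp
  have hl : log (1 + θ * B / a)
      ≤ log (1 + θ * B₀ / a) + ((a + θ * B) / (a + θ * B₀) - 1) := by
    rw [e, log_mul (by positivity) (by positivity)]
    gcongr
    exact log_le_sub_one_of_pos (by positivity)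
  have h2 := mul_le_mul_of_nonneg_left hl (by positivity : 0 ≤ a / 2)
  have h3 : θ / 2 * (1 - A₀) * (1 - B) + a / 2 * ((a + θ * B) / (a + θ * B₀) - 1)
      = θ / 2 * (1 - A₀) * (1 - B₀) := by
    rw [hA']; field_simp; ring
  unfold ratioPotential
  linarith

/-- A saddle point of the potential, with value `θ / 2 - freeLim a b θ`. -/
theorem exists_saddle {a b θ : ℝ} (ha : 0 < a) (hb : 0 < b) (hθ : 0 < θ) :
    ∃ A₀ B₀, 0 ≤ A₀ ∧ A₀ ≤ 1 ∧ 0 ≤ B₀ ∧ (1 - A₀) * (a + θ * B₀) = a ∧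
      B₀ = θ * A₀ / (b + θ * A₀) ∧
      θ * (θ + b) * (1 / (b + θ * A₀)) ≤ a + θ ∧
      (b * (1 / (b + θ * A₀)) = 1 ∨ a + θ ≤ θ * (θ + b) * (1 / (b + θ * A₀))) ∧
      ratioPotential a b θ A₀ B₀ = θ / 2 - freeLim a b θ := by
  rcases le_or_gt (θ ^ 2) (a * b) with h | h
  · have hs : θ ≤ √(a * b) := Real.le_sqrt_of_sq_le h
    refine ⟨0, 0, le_rfl, zero_le_one, le_rfl, by ring, by simp, ?_, Or.inl ?_, ?_⟩
    · simp only [mul_zero, add_zero]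
      rw [mul_one_div, div_le_iff₀ hb]
      nlinarith
    · field_simp; simp
    · rw [freeLim, max_eq_right hs, freeLimAux_sqrt ha hb]
      simp [ratioPotential]
  · have hs : √(a * b) ≤ θ := (Real.sqrt_le_left hθ.le).2 h.le
    have eA : b + θ * ((θ ^ 2 - a * b) / (θ * (θ + a))) = θ * (θ + b) / (θ + a) := by
      field_simp; ring
    have eB : a + θ * ((θ ^ 2 - a * b) / (θ * (θ + b))) = θ * (θ + a) / (θ + b) := by
      field_simp; ring
    refine ⟨(θ ^ 2 - a * b) / (θ * (θ + a)), (θ ^ 2 - a * b) / (θ * (θ + b)), ?_, ?_, ?_, ?_, ?_,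
      ?_, Or.inr ?_, ?_⟩
    · exact div_nonneg (by linarith) (by positivity)
    · rw [div_le_one (by positivity)]; nlinarith [mul_pos ha hb]
    · exact div_nonneg (by linarith) (by positivity)
    · rw [eB]; field_simp; ring
    · rw [eA]; field_simp
    · rw [eA]; field_simp; linarith
    · rw [eA]; field_simp; linarith
    · rw [freeLim, max_eq_left hs, ratioPotential, freeLimAux]
      have e1 : 1 + θ * ((θ ^ 2 - a * b) / (θ * (θ + b))) / a = θ * (θ + a) / (θ + b) / a := by
        rw [← eB]; field_simp
      have e2 : 1 + θ * ((θ ^ 2 - a * b) / (θ * (θ + a))) / b = θ * (θ + b) / (θ + a) / b := by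
        rw [← eA]; field_simp
      have e3 : θ / 2 * (1 - (θ ^ 2 - a * b) / (θ * (θ + a)))
          * (1 - (θ ^ 2 - a * b) / (θ * (θ + b))) = a * b / (2 * θ) := by
        field_simp; ring
      rw [e1, e2, e3, log_div (by positivity) ha.ne', log_div (by positivity) (by positivity),
        log_mul hθ.ne' (by positivity), log_div (by positivity) hb.ne',
        log_div (by positivity) (by positivity), log_mul hθ.ne' (by positivity)]
      ring

theorem sInf_sSup_image_eq {α β : Type*} {f : α → β → ℝ} {s : Set α} {t : Set β} {c : ℝ} {x₀ : α}
    (hx₀ : x₀ ∈ s) (hle : ∀ y ∈ t, f x₀ y ≤ c) (hge : ∀ x ∈ s, ∃ y ∈ t, c ≤ f x y)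
    (hbdd : ∀ x ∈ s, BddAbove (f x '' t)) :
    sInf ((fun x => sSup (f x '' t)) '' s) = c := by
  have hlow : ∀ x ∈ s, c ≤ sSup (f x '' t) := fun x hx => by
    obtain ⟨y, hy, h⟩ := hge x hx
    exact h.trans (le_csSup (hbdd x hx) ⟨y, hy, rfl⟩)
  obtain ⟨y₀, hy₀, -⟩ := hge x₀ hx₀
  refine IsLeast.csInf_eq ⟨⟨x₀, hx₀, le_antisymm ?_ (hlow x₀ hx₀)⟩, ?_⟩
  · exact csSup_le ⟨_, y₀, hy₀, rfl⟩ (by rintro _ ⟨y, hy, rfl⟩; exact hle y hy)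
  · rintro _ ⟨x, hx, rfl⟩
    exact hlow x hx

theorem rsPotential_eq_ratioPotential {lam a b ru rv : ℝ} (ha : 0 < a) (hb : 0 < b)
    (hru : 0 < ru) (hrv : 0 < rv) (mu mv : ℝ) :
    rsPotential lam a b ru rv mu mv
      = ratioPotential a b (lam * a * b * ru * rv) (mu / ru) (mv / rv) := by
  have e1 : 1 + lam * a * b * ru * rv * (mv / rv) / a = 1 + lam * b * ru * mv := by field_simp
  have e2 : 1 + lam * a * b * ru * rv * (mu / ru) / b = 1 + lam * a * rv * mu := by field_simp
  rw [rsPotential, ratioPotential, e1, e2]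
  field_simp

theorem rsInfSup_eq {lam a b ru rv : ℝ} (hlam : 0 < lam) (ha : 0 < a) (hb : 0 < b)
    (hru : 0 < ru) (hrv : 0 < rv) :
    rsInfSup lam a b ru rv
      = lam * a * b * ru * rv / 2 - freeLim a b (lam * a * b * ru * rv) := by
  have hθ : 0 < lam * a * b * ru * rv := by positivity
  obtain ⟨A₀, B₀, hA0, hA1, hB0, hAB, hBA, hle, hge, hval⟩ := exists_saddle ha hb hθ
  set θ := lam * a * b * ru * rv with hθd
  have hmem : ∀ A : ℝ, 0 ≤ A → 0 < 1 / (b + θ * A) ∧ b * (1 / (b + θ * A)) ≤ 1 := fun A hA => by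
    have hw : 0 < b + θ * A := by positivity
    refine ⟨by positivity, ?_⟩
    rw [mul_one_div, div_le_one hw]
    nlinarith [mul_nonneg hθ.le hA]
  refine sInf_sSup_image_eq (f := rsPotential lam a b ru rv) (x₀ := ru * A₀)
    ⟨by positivity, by nlinarith⟩ ?_ ?_ ?_
  · intro mv hmv
    rw [rsPotential_eq_ratioPotential ha hb hru hrv, ← hθd, mul_div_cancel_left₀ _ hru.ne', ← hval]
    exact ratioPotential_le ha hθ hAB hB0 (div_nonneg hmv.1 hrv.le)
  · intro mu hmu
    have hA : 0 ≤ mu / ru := div_nonneg hmu.1 hru.le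
    have hw : 0 < b + θ * (mu / ru) := by positivity
    refine ⟨rv * (θ * (mu / ru) / (b + θ * (mu / ru))), ⟨by positivity, ?_⟩, ?_⟩
    · refine mul_le_of_le_one_right hrv.le ((div_le_one hw).2 ?_)
      linarith
    · rw [rsPotential_eq_ratioPotential ha hb hru hrv, ← hθd, mul_div_cancel_left₀ _ hrv.ne', ← hval,
        ratioPotential_eq_reducedPotential ha hb hθ hA, hBA,
        ratioPotential_eq_reducedPotential ha hb hθ hA0]
      exact reducedPotential_le ha hb hθ (hmem _ hA0).1 (hmem _ hA0).2 (hmem _ hA).1 (hmem _ hA).2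
        hle hge
  · intro mu _
    refine (isCompact_Icc.image_of_continuousOn ?_).bddAbove
    intro mv hmv
    have hpos : 0 < 1 + lam * b * ru * mv := by have := hmv.1; positivity
    unfold rsPotential
    refine ContinuousAt.continuousWithinAt ?_
    have := hpos.ne'
    fun_prop (disch := assumption)

theorem integral_stdGaussianMat {p q : ℕ} (f : (Fin p → Fin q → ℝ) → ℝ) :
    ∫ Z, f Z ∂(stdGaussianMat p q) = ∫ z, f (fun i j => z (i, j)) ∂(gauss (Mat p q)) := by
  have h : (stdGaussianMat p q).map (MeasurableEquiv.curry (Fin p) (Fin q) ℝ).symm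
      = Measure.pi fun _ : Fin p × Fin q => ProbabilityTheory.gaussianReal 0 1 := by
    refine (Measure.pi_eq fun s hs => ?_).symm
    rw [Measure.map_apply (MeasurableEquiv.measurable _) (MeasurableSet.univ_pi hs)]
    have e : (MeasurableEquiv.curry (Fin p) (Fin q) ℝ).symm ⁻¹' Set.univ.pi s
        = Set.univ.pi fun i => Set.univ.pi fun j => s (i, j) := by
      ext Z
      simp [MeasurableEquiv.coe_curry_symm, Function.uncurry]
    have : ∀ n, SigmaFinite (stdGaussian n) := fun n => by unfold stdGaussian; infer_instance
    rw [e, stdGaussianMat, Measure.pi_pi, Fintype.prod_prod_type]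
    refine Finset.prod_congr rfl fun i _ => ?_
    rw [stdGaussian, Measure.pi_pi]
  rw [integral_gauss_eq_pi, ← h, integral_map_equiv]
  rfl

/-- The law of a point divided by `r`. -/
def dirLaw {p : ℕ} (r : ℝ) (P : Measure (Fin p → ℝ)) : Measure (Vec p) :=
  P.map fun x => r⁻¹ • WithLp.toLp 2 x

theorem measurable_smul_toLp {p : ℕ} (r : ℝ) :
    Measurable fun x : Fin p → ℝ => r⁻¹ • (WithLp.toLp 2 x : Vec p) := by fun_prop

theorem ae_norm_smul_toLp {p : ℕ} {r : ℝ} (hr : 0 < r) {P : Measure (Fin p → ℝ)}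
    (hP : IsUniformSphere p r P) : ∀ᵐ x ∂P, ‖r⁻¹ • (WithLp.toLp 2 x : Vec p)‖ = 1 := by
  filter_upwards [hP.2.1] with x hx
  have : ‖(WithLp.toLp 2 x : Vec p)‖ = r := by
    rw [EuclideanSpace.norm_eq]
    simp [hx, Real.sqrt_sq hr.le]
  rw [norm_smul, this, norm_of_nonneg (by positivity), inv_mul_cancel₀ hr.ne']

theorem isUniformDir_dirLaw {p : ℕ} {r : ℝ} (hr : 0 < r) {P : Measure (Fin p → ℝ)}
    (hP : IsUniformSphere p r P) : IsUniformDir (dirLaw r P) := by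
  have := hP.1
  refine ⟨Measure.isProbabilityMeasure_map (measurable_smul_toLp r).aemeasurable, ?_, fun f => ?_⟩
  · exact (ae_map_iff (measurable_smul_toLp r).aemeasurable
      (measurableSet_eq_fun measurable_norm measurable_const)).2 (ae_norm_smul_toLp hr hP)
  · set b := EuclideanSpace.basisFun (Fin p) ℝ
    set O : Matrix (Fin p) (Fin p) ℝ := f.toLinearMap.toMatrix b.toBasis b.toBasis with hO
    have hmem : O ∈ Matrix.orthogonalGroup (Fin p) ℝ := f.toMatrix_mem_unitaryGroup b b
    have hOx : ∀ x : Fin p → ℝ, f (WithLp.toLp 2 x) = WithLp.toLp 2 (O.mulVec x) := fun x => by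
      have := LinearMap.toMatrix_mulVec_repr b.toBasis b.toBasis f.toLinearMap (WithLp.toLp 2 x)
      ext i
      have := congrFun this i
      have hb : ⇑(b.toBasis.repr (WithLp.toLp 2 x)) = x := by ext j; simp [b]
      rw [hb] at this
      exact (this.trans (by simp [b])).symm
    have hm : Measurable fun x : Fin p → ℝ => O.mulVec x :=
      (Continuous.matrix_mulVec continuous_const continuous_id).measurable
    rw [dirLaw, Measure.map_map f.continuous.measurable (measurable_smul_toLp r)]
    conv_rhs => rw [← hP.2.2 O hmem, Measure.map_map (measurable_smul_toLp r) hm]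
    congr 1
    funext x
    rw [Function.comp_apply, map_smul, hOx, Function.comp_apply]

theorem integral_dirLaw_prod {p q : ℕ} (r r' : ℝ) (P : Measure (Fin p → ℝ))
    (P' : Measure (Fin q → ℝ)) [IsProbabilityMeasure P] [IsProbabilityMeasure P']
    (f : Vec p × Vec q → ℝ) (hf : Integrable f ((dirLaw r P).prod (dirLaw r' P'))) :
    ∫ u, ∫ v, f (r⁻¹ • WithLp.toLp 2 u, r'⁻¹ • WithLp.toLp 2 v) ∂P' ∂P
      = ∫ x, f x ∂((dirLaw r P).prod (dirLaw r' P')) := by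
  have hm := (measurable_smul_toLp (p := p) r).prodMap (measurable_smul_toLp (p := q) r')
  unfold dirLaw at hf ⊢
  rw [Measure.map_prod_map _ _ (measurable_smul_toLp r) (measurable_smul_toLp r')] at hf ⊢
  rw [integral_map hm.aemeasurable hf.1]
  exact (integral_prod _ (hf.comp_measurable hm)).symm

theorem sum_exponent_eq {p q : ℕ} {lam r r' : ℝ} {n : ℕ} (hlam : 0 ≤ lam) (hr : 0 < r)
    (hr' : 0 < r') (hp : 1 ≤ p) (hq : 1 ≤ q) (s : ℝ) (hs : s = √(lam / n) * r * r')
    (u U : Fin p → ℝ) (v V : Fin q → ℝ) (z : Mat p q)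
    (hu : ‖r⁻¹ • (WithLp.toLp 2 u : Vec p)‖ = 1) (hv : ‖r'⁻¹ • (WithLp.toLp 2 v : Vec q)‖ = 1)
    (hU : ‖r⁻¹ • (WithLp.toLp 2 U : Vec p)‖ = 1) (hV : ‖r'⁻¹ • (WithLp.toLp 2 V : Vec q)‖ = 1) :
    ∑ i, ∑ j, (√(lam / n) * u i * v j * (√(lam / n) * U i * V j + z (i, j))
        - lam / (2 * n) * u i ^ 2 * v j ^ 2)
      = s * ⟪spikeDir hp hq (r⁻¹ • WithLp.toLp 2 u, r'⁻¹ • WithLp.toLp 2 v),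
          z + s • spikeDir hp hq (r⁻¹ • WithLp.toLp 2 U, r'⁻¹ • WithLp.toLp 2 V)⟫ - s ^ 2 / 2 := by
  have hn := norm_spikeDir hp hq (r⁻¹ • (WithLp.toLp 2 u : Vec p), r'⁻¹ • (WithLp.toLp 2 v : Vec q))
  have e : s ^ 2 / 2 = s ^ 2 / 2
      * ⟪spikeDir hp hq (r⁻¹ • WithLp.toLp 2 u, r'⁻¹ • WithLp.toLp 2 v),
        spikeDir hp hq (r⁻¹ • WithLp.toLp 2 u, r'⁻¹ • WithLp.toLp 2 v)⟫ := by
    rw [real_inner_self_eq_norm_sq, hn]; ring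
  have hl : lam / (2 * n) = √(lam / n) ^ 2 / 2 := by
    rw [Real.sq_sqrt (by positivity), div_div, mul_comm]
  rw [e]
  simp only [spikeDir, unitize_of_norm_eq_one _ hu, unitize_of_norm_eq_one _ hv,
    unitize_of_norm_eq_one _ hU, unitize_of_norm_eq_one _ hV, PiLp.inner_apply,
    Fintype.sum_prod_type, Finset.mul_sum, ← Finset.sum_sub_distrib]
  refine Finset.sum_congr rfl fun i _ => Finset.sum_congr rfl fun j _ => ?_
  simp only [PiLp.add_apply, PiLp.smul_apply, tens_apply, smul_eq_mul, RCLike.inner_apply,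
    conj_trivial, hl, hs]
  field_simp
  ring

theorem matrixFreeEntropy_eq {lam ru rv : ℝ} (hlam : 0 < lam) (hru : 0 < ru) (hrv : 0 < rv)
    {n p q : ℕ} (hn : 1 ≤ n) (hp : 1 ≤ p) (hq : 1 ≤ q) {P : Measure (Fin p → ℝ)}
    {P' : Measure (Fin q → ℝ)} (hP : IsUniformSphere p √(ru * p) P)
    (hP' : IsUniformSphere q √(rv * q) P') :
    matrixFreeEntropy lam n p q P P' = spikedFreeEnt (dirLaw √(ru * p) P) (dirLaw √(rv * q) P') n
      (lam * ((p : ℝ) / n) * ((q : ℝ) / n) * ru * rv) := by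
  have hp0 : (0 : ℝ) < p := by exact_mod_cast hp
  have hq0 : (0 : ℝ) < q := by exact_mod_cast hq
  have hn0 : (0 : ℝ) < n := by exact_mod_cast hn
  have hr : 0 < √(ru * p) := Real.sqrt_pos.2 (by positivity)
  have hr' : 0 < √(rv * q) := Real.sqrt_pos.2 (by positivity)
  set s := √(n * (lam * ((p : ℝ) / n) * ((q : ℝ) / n) * ru * rv)) with hs
  have hs' : s = √(lam / n) * √(ru * p) * √(rv * q) := by
    rw [hs, ← Real.sqrt_mul (by positivity), ← Real.sqrt_mul (by positivity)]
    congr 1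
    field_simp
  rw [spikedFreeEnt, dif_pos ⟨hp, hq⟩, matrixFreeEntropy, ← hs, div_eq_inv_mul (freeEnt _ _ _), one_div]
  congr 1
  have := hP.1
  have := hP'.1
  have := (isUniformDir_dirLaw hr hP).prob
  have := (isUniformDir_dirLaw hr' hP').prob
  set r := √(ru * p)
  set r' := √(rv * q)
  have hφ := measurable_spikeDir hp hq
  have hφ1 := norm_spikeDir hp hq
  set μ := (dirLaw r P).prod (dirLaw r' P') with hμ
  have hΦ : Integrable (fun x => ∫ z, log (lik μ (spikeDir hp hq) s (z + s • spikeDir hp hq x))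
      ∂(gauss (Mat p q))) μ :=
    (integrable_log_lik μ (spikeDir hp hq) hφ hφ1 s).integral_prod_left
  rw [freeEnt, hμ, ← integral_dirLaw_prod r r' P P' _ hΦ]
  refine integral_congr_ae ?_
  filter_upwards [ae_norm_smul_toLp hr hP] with U hU
  refine integral_congr_ae ?_
  filter_upwards [ae_norm_smul_toLp hr' hP'] with V hV
  rw [integral_stdGaussianMat]
  congr 1
  funext z
  rw [lik, ← integral_dirLaw_prod r r' P P' _ (integrable_exp_lik μ (spikeDir hp hq) hφ hφ1 s _)]
  congr 1
  refine integral_congr_ae ?_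
  filter_upwards [ae_norm_smul_toLp hr hP] with u hu
  refine integral_congr_ae ?_
  filter_upwards [ae_norm_smul_toLp hr' hP'] with v hv
  rw [sum_exponent_eq hlam.le hr hr' hp hq s hs' u U v V z hu hv hU hV]

end SpikedMatrix

/-- **Theorem 1.** In the high-dimensional limit `n_u/n → α_u`,
`n_v/n → α_v`, the average free entropy of the spherical rank-one matrix
factorization model converges to `λα_uα_vρ_uρ_v/2 − inf sup i`, and equivalently the
average mutual information per dimension
`I(U,V;Y)/n = λ n_u n_v ρ_u ρ_v/(2n²) − fₙ` converges to
`inf_{m_u ∈ [0,ρ_u]} sup_{m_v ∈ [0,ρ_v]} i(m_u,m_v)`. -/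
theorem matrix_factorization_free_entropy_limit
    (lam au av ru rv : ℝ)
    (hlam : 0 < lam) (hau : 0 < au) (hav : 0 < av) (hru : 0 < ru) (hrv : 0 < rv)
    (nu nv : ℕ → ℕ)
    (hnu : Tendsto (fun n => (nu n : ℝ) / n) atTop (nhds au))
    (hnv : Tendsto (fun n => (nv n : ℝ) / n) atTop (nhds av))
    (Pu : (n : ℕ) → Measure (Fin (nu n) → ℝ))
    (Pv : (n : ℕ) → Measure (Fin (nv n) → ℝ))
    (hPu : ∀ n, IsUniformSphere (nu n) (Real.sqrt (ru * nu n)) (Pu n))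
    (hPv : ∀ n, IsUniformSphere (nv n) (Real.sqrt (rv * nv n)) (Pv n)) :
    Tendsto (fun n => matrixFreeEntropy lam n (nu n) (nv n) (Pu n) (Pv n)) atTop
        (nhds (lam * au * av * ru * rv / 2 - rsInfSup lam au av ru rv)) ∧
    Tendsto (fun n =>
        lam * (nu n : ℝ) * (nv n : ℝ) * ru * rv / (2 * (n : ℝ) ^ 2)
          - matrixFreeEntropy lam n (nu n) (nv n) (Pu n) (Pv n)) atTop
        (nhds (rsInfSup lam au av ru rv)) := by
  have hnu1 := (SpikedMatrix.tendsto_pred_div hau hnu).1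
  have hnv1 := (SpikedMatrix.tendsto_pred_div hav hnv).1
  have hθ : Tendsto (fun n : ℕ => lam * ((nu n : ℝ) / n) * ((nv n : ℝ) / n) * ru * rv) atTop
      (nhds (lam * au * av * ru * rv)) :=
    ((((hnu.const_mul lam).mul hnv).mul_const ru).mul_const rv)
  have hlim : Tendsto (fun n => matrixFreeEntropy lam n (nu n) (nv n) (Pu n) (Pv n)) atTop
      (nhds (lam * au * av * ru * rv / 2 - rsInfSup lam au av ru rv)) := by
    rw [SpikedMatrix.rsInfSup_eq hlam hau hav hru hrv, sub_sub_cancel]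
    refine (SpikedMatrix.tendsto_spikedFreeEnt hau hav hnu hnv
      (fun n => SpikedMatrix.dirLaw √(ru * nu n) (Pu n))
      (fun n => SpikedMatrix.dirLaw √(rv * nv n) (Pv n)) ?_ ?_ _ (by positivity) _ hθ).congr' ?_
    · filter_upwards [hnu1] with n hn
      exact SpikedMatrix.isUniformDir_dirLaw (Real.sqrt_pos.2 (mul_pos hru (by exact_mod_cast hn)))
        (hPu n)
    · filter_upwards [hnv1] with n hn
      exact SpikedMatrix.isUniformDir_dirLaw (Real.sqrt_pos.2 (mul_pos hrv (by exact_mod_cast hn)))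
        (hPv n)
    · filter_upwards [hnu1, hnv1, eventually_ge_atTop 1] with n h1 h2 h3
      exact (SpikedMatrix.matrixFreeEntropy_eq hlam hru hrv h3 h1 h2 (hPu n) (hPv n)).symm
  refine ⟨hlim, ?_⟩
  have h := (hθ.div_const 2).sub hlim
  rw [sub_sub_cancel] at h
  refine h.congr fun n => ?_
  congr 1
  rw [mul_div_assoc', mul_div_assoc', div_mul_eq_mul_div, div_mul_eq_mul_div, div_mul_eq_mul_div,
    div_mul_eq_mul_div, div_mul_eq_mul_div, div_div, div_div]
  ring

end
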